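/- arXiv:math/0603588 — 2 statements merged into one kernel-verified Lean document; each statement's English description precedes it below -/
import Mathlib

section
/- If V is a rational vertex operator algebra, then the Zhu algebra A(V) is a finite-dimensional semisimple associative algebra. -/
/-- Generalized binomial coefficient `C(n, k)` for `n : ℤ`, valued in `ℂ`. -/
noncomputable def cbinom (n : ℤ) (k : ℕ) : ℂ :=
  (∏ i ∈ Finset.range k, ((n : ℂ) - (i : ℂ))) / (Nat.factorial k : ℂ)

/-- A vertex operator algebra structure on a complex vector space `V`. -/
structure VOA (V : Type) [AddCommGroup V] [Module ℂ V] where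
  mode : V → ℤ → Module.End ℂ V
  vacuum : V
  conformal : V
  grading : ℤ → Submodule ℂ V
  internal : Function.Bijective (DirectSum.coeLinearMap grading)
  mode_add : ∀ (u v : V) (n : ℤ), mode (u + v) n = mode u n + mode v n
  mode_smul : ∀ (c : ℂ) (u : V) (n : ℤ), mode (c • u) n = c • mode u n
  truncation : ∀ u v : V, ∃ N : ℤ, ∀ n : ℤ, N ≤ n → mode u n v = 0
  vacuum_mem : vacuum ∈ grading 0
  conformal_mem : conformal ∈ grading 2
  vacuum_mode : ∀ (v : V) (n : ℤ), mode vacuum n v = if n = -1 then v else 0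
  creation : ∀ (u : V) (n : ℤ), 0 ≤ n → mode u n vacuum = 0
  creation_neg_one : ∀ u : V, mode u (-1) vacuum = u
  L0_eigen : ∀ (n : ℤ) (u : V), u ∈ grading n → mode conformal 1 u = (n : ℂ) • u
  Lneg1_deriv : ∀ (u : V) (n : ℤ), mode (mode conformal 0 u) n = (-n : ℂ) • mode u (n - 1)
  grading_mode : ∀ (r s m : ℤ) (u v : V), u ∈ grading r → v ∈ grading s →
    mode u m v ∈ grading (r + s - m - 1)
  bounded_below : ∃ N : ℤ, ∀ n : ℤ, n < N → grading n = ⊥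
  fin_dim : ∀ n : ℤ, FiniteDimensional ℂ (grading n)
  borcherds : ∀ (p q r : ℤ) (u v w : V),
    (∑ᶠ i : ℕ, cbinom p i • mode (mode u (r + i) v) (p + q - i) w) =
    ∑ᶠ i : ℕ, ((-1 : ℂ) ^ i * cbinom r i) •
      (mode u (p + r - i) (mode v (q + i) w)
        - (-1 : ℂ) ^ r • mode v (q + r - i) (mode u (p + i) w))

variable {V : Type} [AddCommGroup V] [Module ℂ V]

/-- Projection onto the weight-`n` subspace. -/
noncomputable def VOA.proj (d : VOA V) (n : ℤ) : V →ₗ[ℂ] V :=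
  (d.grading n).subtype ∘ₗ (DirectSum.component ℂ ℤ (fun m => d.grading m) n) ∘ₗ
    (LinearEquiv.ofBijective (DirectSum.coeLinearMap d.grading) d.internal).symm.toLinearMap

/-- `Res_z (1+z)^N z^{-k} Y(u,z)v` for a vector `u` regarded as having weight contribution `N`. -/
noncomputable def VOA.hres (d : VOA V) (N k : ℤ) (u v : V) : V :=
  ∑ᶠ i : ℕ, cbinom N i • d.mode u ((i : ℤ) - k) v

/-- `Res_z (1+z)^{wt u + m} z^{-k} Y(u,z)v`, extended bilinearly from homogeneous `u`. -/
noncomputable def VOA.bres (d : VOA V) (m k : ℤ) (u v : V) : V :=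
  ∑ᶠ n : ℤ, d.hres (n + m) k (d.proj n u) v

/-- The Zhu product `u * v`. -/
noncomputable def VOA.star (d : VOA V) (u v : V) : V := d.bres 0 1 u v

/-- The Zhu circle product `u ∘ v`. -/
noncomputable def VOA.circ (d : VOA V) (u v : V) : V := d.bres 0 2 u v

/-- The subspace `O(V)` spanned by all `u ∘ v`. -/
def VOA.Ozhu (d : VOA V) : Submodule ℂ V := Submodule.span ℂ {w : V | ∃ u v : V, w = d.circ u v}

/-- The product `u ∘_n v`. -/
noncomputable def VOA.circn (d : VOA V) (n : ℕ) (u v : V) : V := d.bres n (2 * n + 2) u v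

/-- The product `u *_n v` of Dong–Li–Mason. -/
noncomputable def VOA.starn (d : VOA V) (n : ℕ) (u v : V) : V :=
  ∑ m ∈ Finset.range (n + 1),
    ((-1 : ℂ) ^ m * cbinom ((m : ℤ) + (n : ℤ)) n) • d.bres n ((n : ℤ) + (m : ℤ) + 1) u v

/-- The subspace `O_n(V)`. -/
def VOA.On (d : VOA V) (n : ℕ) : Submodule ℂ V :=
  Submodule.span ℂ ({w : V | ∃ u v : V, w = d.circn n u v} ∪
    {w : V | ∃ u : V, w = d.mode d.conformal 0 u + d.mode d.conformal 1 u})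

/-- The Dong–Jiang product `u *_{m,p}^n v`. -/
noncomputable def VOA.starmpn (d : VOA V) (m p n : ℕ) (u v : V) : V :=
  ∑ i ∈ Finset.range (p + 1),
    ((-1 : ℂ) ^ i * cbinom ((m : ℤ) + (n : ℤ) - (p : ℤ) + (i : ℤ)) i) •
      d.bres m ((m : ℤ) + (n : ℤ) - (p : ℤ) + (i : ℤ) + 1) u v

/-- The Dong–Jiang product `u ∘_m^n v`. -/
noncomputable def VOA.circmn (d : VOA V) (n m : ℕ) (u v : V) : V :=
  d.bres m ((n : ℤ) + (m : ℤ) + 2) u v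

/-- The subspace `O_{n,m}(V) = O'_{n,m}(V) + O''_{n,m}(V) + O'''_{n,m}(V)` of Dong–Jiang. -/
def VOA.Onm (d : VOA V) (n m : ℕ) : Submodule ℂ V :=
  Submodule.span ℂ (
    {w : V | ∃ u v : V, w = d.circmn n m u v} ∪
    {w : V | ∃ u : V, w = d.mode d.conformal 0 u + d.mode d.conformal 1 u
        + (((m : ℂ) - (n : ℂ)) • u)} ∪
    {w : V | ∃ (u a b c : V) (p₁ p₂ p₃ : ℕ), w = d.starmpn m p₃ n u
        (d.starmpn m p₁ p₃ (d.starmpn p₁ p₂ p₃ a b) c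
          - d.starmpn m p₂ p₃ a (d.starmpn m p₁ p₂ b c))} ∪
    {w : V | ∃ (p : ℕ) (u x v : V), x ∈ d.On p ∧ w = d.starmpn m p n (d.starmpn p p n u x) v})

/-- The subspace `C_2(V)` spanned by the `u_{-2} v`. -/
def VOA.C2 (d : VOA V) : Submodule ℂ V := Submodule.span ℂ {w : V | ∃ u v : V, w = d.mode u (-2) v}

/-- `V` is a simple vertex operator algebra: its only ideals are `0` and `V`. -/
def VOA.IsSimpleVOA (d : VOA V) : Prop :=
  (∃ v : V, v ≠ 0) ∧ ∀ P : Submodule ℂ V,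
    (∀ (u : V) (n : ℤ), ∀ w ∈ P, d.mode u n w ∈ P) → P = ⊥ ∨ P = ⊤

/-- A weak module for the vertex operator algebra `d`. -/
structure WeakMod (d : VOA V) (M : Type) [AddCommGroup M] [Module ℂ M] where
  act : V → ℤ → Module.End ℂ M
  act_add : ∀ (u v : V) (n : ℤ), act (u + v) n = act u n + act v n
  act_smul : ∀ (c : ℂ) (u : V) (n : ℤ), act (c • u) n = c • act u n
  truncation : ∀ (u : V) (w : M), ∃ N : ℤ, ∀ n : ℤ, N ≤ n → act u n w = 0
  vacuum_act : ∀ (w : M) (n : ℤ), act d.vacuum n w = if n = -1 then w else 0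
  borcherds : ∀ (p q r : ℤ) (u v : V) (w : M),
    (∑ᶠ i : ℕ, cbinom p i • act (d.mode u (r + i) v) (p + q - i) w) =
    ∑ᶠ i : ℕ, ((-1 : ℂ) ^ i * cbinom r i) •
      (act u (p + r - i) (act v (q + i) w)
        - (-1 : ℂ) ^ r • act v (q + r - i) (act u (p + i) w))

/-- An admissible (ℤ₊-graded) module for the vertex operator algebra `d`. -/
structure AdmMod (d : VOA V) (M : Type) [AddCommGroup M] [Module ℂ M]
    extends WeakMod d M where
  gr : ℤ → Submodule ℂ M
  gr_internal : Function.Bijective (DirectSum.coeLinearMap gr)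
  gr_neg : ∀ n : ℤ, n < 0 → gr n = ⊥
  gr_act : ∀ (r : ℤ) (u : V), u ∈ d.grading r → ∀ (m n : ℤ) (w : M), w ∈ gr n →
    act u m w ∈ gr (r + n - m - 1)

variable {M : Type} [AddCommGroup M] [Module ℂ M]

/-- The zero-mode `o(v) = v_{wt v - 1}`, extended linearly from homogeneous `v`. -/
noncomputable def WeakMod.o {d : VOA V} (W : WeakMod d M) (v : V) (w : M) : M :=
  ∑ᶠ r : ℤ, W.act (d.proj r v) (r - 1) w

/-- The mode `o_t(v) = v_{wt v - 1 - t}`, extended linearly from homogeneous `v`. -/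
noncomputable def WeakMod.ot {d : VOA V} (W : WeakMod d M) (t : ℤ) (v : V) (w : M) : M :=
  ∑ᶠ r : ℤ, W.act (d.proj r v) (r - 1 - t) w

/-- The subspace `Ω_n(M)` of a weak module. -/
def WeakMod.OmegaSet {d : VOA V} (W : WeakMod d M) (n : ℕ) : Set M :=
  {w : M | ∀ (r : ℤ) (u : V), u ∈ d.grading r → ∀ m : ℤ, m > r - 1 + (n : ℤ) → W.act u m w = 0}

/-- A subspace stable under all modes. -/
def WeakMod.IsStable {d : VOA V} (W : WeakMod d M) (P : Submodule ℂ M) : Prop :=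
  ∀ (u : V) (n : ℤ), ∀ w ∈ P, W.act u n w ∈ P

/-- A subspace compatible with the grading of an admissible module. -/
def AdmMod.IsGraded {d : VOA V} (A : AdmMod d M) (P : Submodule ℂ M) : Prop :=
  P = ⨆ n : ℤ, (P ⊓ A.gr n)

/-- `P` is an irreducible admissible submodule. -/
def AdmMod.IrredSub {d : VOA V} (A : AdmMod d M) (P : Submodule ℂ M) : Prop :=
  P ≠ ⊥ ∧ A.toWeakMod.IsStable P ∧ A.IsGraded P ∧
    ∀ Q : Submodule ℂ M, Q ≤ P → A.toWeakMod.IsStable Q → A.IsGraded Q → Q = ⊥ ∨ Q = P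

/-- The admissible module is irreducible. -/
def AdmMod.IsIrreducible {d : VOA V} (A : AdmMod d M) : Prop :=
  (∃ w : M, w ≠ 0) ∧
    ∀ P : Submodule ℂ M, A.toWeakMod.IsStable P → A.IsGraded P → P = ⊥ ∨ P = ⊤

/-- Rationality: every admissible module is a direct sum of irreducible admissible submodules. -/
def Rational (d : VOA V) : Prop :=
  ∀ (M : Type) [AddCommGroup M] [Module ℂ M] (A : AdmMod d M),
    ∃ (ι : Type) (f : ι → Submodule ℂ M),
      (∀ i, A.IrredSub (f i)) ∧ iSupIndep f ∧ (⨆ i, f i) = ⊤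

/-- Equivalence of admissible modules. -/
def AdmEquiv {d : VOA V} {M₁ M₂ : Type} [AddCommGroup M₁] [Module ℂ M₁]
    [AddCommGroup M₂] [Module ℂ M₂] (A₁ : AdmMod d M₁) (A₂ : AdmMod d M₂) : Prop :=
  ∃ e : M₁ ≃ₗ[ℂ] M₂, ∀ (u : V) (n : ℤ) (w : M₁), e (A₁.act u n w) = A₂.act u n (e w)

/-- An ordinary-module structure on a weak module: a `ℂ`-grading by finite dimensional
`L(0)`-eigenspaces, bounded below in each coset of `ℤ`. -/
structure OrdinaryStruct {d : VOA V} (W : WeakMod d M) where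
  grc : ℂ → Submodule ℂ M
  internal : Function.Bijective (DirectSum.coeLinearMap grc)
  eigen : ∀ (lam : ℂ) (w : M), w ∈ grc lam → W.act d.conformal 1 w = lam • w
  findim : ∀ lam : ℂ, FiniteDimensional ℂ (grc lam)
  bounded : ∀ lam : ℂ, ∃ N : ℤ, ∀ n : ℤ, n < N → grc (lam + (n : ℂ)) = ⊥

/-- An admissible module is ordinary. -/
def AdmMod.IsOrdinary {d : VOA V} (A : AdmMod d M) : Prop :=
  Nonempty (OrdinaryStruct A.toWeakMod)

/-- A realization of the quotient associative algebra `V/Osub` with product induced by `mu`. -/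
structure Realization (Osub : Submodule ℂ V) (mu : V → V → V) (one : V) where
  carrier : Type
  [ring : Ring carrier]
  [alg : Algebra ℂ carrier]
  emb : V →ₗ[ℂ] carrier
  surj : Function.Surjective emb
  ker_eq : LinearMap.ker emb = Osub
  mul_compat : ∀ u v : V, emb (mu u v) = emb u * emb v
  one_compat : emb one = 1

/-- The realized algebra is semisimple. -/
def Realization.Semisimple {Osub : Submodule ℂ V} {mu : V → V → V} {one : V}
    (R : Realization Osub mu one) : Prop :=
  letI := R.ring; IsSemisimpleRing R.carrier

/-- The realized algebra is finite dimensional over `ℂ`. -/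
def Realization.FinDim {Osub : Submodule ℂ V} {mu : V → V → V} {one : V}
    (R : Realization Osub mu one) : Prop :=
  letI := R.ring; letI := R.alg; FiniteDimensional ℂ R.carrier

/-- A module over the quotient algebra `V/Osub`, given as a representation of `V`
killing `Osub` and multiplicative for `mu`. -/
structure RepOf (Osub : Submodule ℂ V) (mu : V → V → V) (one : V)
    (U : Type) [AddCommGroup U] [Module ℂ U] where
  rep : V →ₗ[ℂ] Module.End ℂ U
  kills : ∀ v ∈ Osub, rep v = 0
  mul_compat : ∀ u v : V, rep (mu u v) = rep u * rep v
  one_compat : rep one = 1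

/-- Simplicity of such a representation. -/
def RepOf.IsSimple {Osub : Submodule ℂ V} {mu : V → V → V} {one : V}
    {U : Type} [AddCommGroup U] [Module ℂ U] (Z : RepOf Osub mu one U) : Prop :=
  (∃ u : U, u ≠ 0) ∧
    ∀ P : Submodule ℂ U, (∀ v : V, ∀ x ∈ P, Z.rep v x ∈ P) → P = ⊥ ∨ P = ⊤

/-- Equivalence of two such representations. -/
def RepEquiv {Osub : Submodule ℂ V} {mu : V → V → V} {one : V}
    {U₁ U₂ : Type} [AddCommGroup U₁] [Module ℂ U₁] [AddCommGroup U₂] [Module ℂ U₂]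
    (Z₁ : RepOf Osub mu one U₁) (Z₂ : RepOf Osub mu one U₂) : Prop :=
  ∃ e : U₁ ≃ₗ[ℂ] U₂, ∀ (v : V) (x : U₁), e (Z₁.rep v x) = Z₂.rep v (e x)

open Filter

theorem cbinom_eq_choose (n : ℤ) (k : ℕ) : cbinom n k = ((Ring.choose n k : ℤ) : ℂ) := by
  have hp : ∀ m : ℕ, (descPochhammer ℤ m).smeval (n : ℂ)
      = ∏ i ∈ Finset.range m, ((n : ℂ) - (i : ℂ)) := fun m => by
    induction m with
    | zero => simp
    | succ m ih =>
      rw [descPochhammer_succ_right, Polynomial.smeval_mul, ih, Finset.prod_range_succ]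
      simp [Polynomial.smeval_sub, Polynomial.smeval_natCast]
  have h := Ring.choose_eq_smul (a := (n : ℂ)) (n := k)
  have h2 := Ring.map_choose (Int.castRingHom ℂ) n k
  simp only [eq_intCast] at h2
  rw [h2, h, hp, cbinom, smul_eq_mul]
  ring

theorem cbinom_zero_right (n : ℤ) : cbinom n 0 = 1 := by
  simp [cbinom]

theorem cbinom_zero_succ (k : ℕ) : cbinom 0 (k + 1) = 0 := by
  simp [cbinom, Finset.prod_range_succ']

theorem cbinom_succ_succ (n : ℤ) (k : ℕ) :
    cbinom (n + 1) (k + 1) = cbinom n k + cbinom n (k + 1) := by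
  have hk : (k.factorial : ℂ) ≠ 0 := by exact_mod_cast k.factorial_ne_zero
  have hk' : (k : ℂ) + 1 ≠ 0 := by exact_mod_cast k.succ_ne_zero
  have hp : ∏ i ∈ Finset.range k, (((n + 1 : ℤ) : ℂ) - ((i + 1 : ℕ) : ℂ))
      = ∏ i ∈ Finset.range k, ((n : ℂ) - (i : ℂ)) :=
    Finset.prod_congr rfl fun i _ => by push_cast; ring
  unfold cbinom
  rw [Finset.prod_range_succ', hp, Finset.prod_range_succ, Nat.factorial_succ]
  push_cast
  field_simp
  ring

theorem cbinom_mul_cbinom_sub (r : ℤ) (i l : ℕ) :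
    cbinom r i * cbinom (r - i) l = cbinom r l * cbinom (r - l) i := by
  have key : ∀ i l : ℕ, (∏ j ∈ Finset.range i, ((r : ℂ) - (j : ℂ))) *
      ∏ j ∈ Finset.range l, (((r - i : ℤ) : ℂ) - (j : ℂ))
      = ∏ j ∈ Finset.range (i + l), ((r : ℂ) - (j : ℂ)) := fun i l => by
    rw [Finset.prod_range_add]
    congr 1
    exact Finset.prod_congr rfl fun j _ => by push_cast; ring
  unfold cbinom
  rw [div_mul_div_comm, div_mul_div_comm, key, key, add_comm i l,
    mul_comm (Nat.factorial i : ℂ)]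

/-- Formal Laurent series in the local coordinate `z = x - 1`. -/
def LS : Type := LaurentSeries ℂ

namespace LS

noncomputable instance : Field LS := inferInstanceAs (Field (LaurentSeries ℂ))

noncomputable instance : Algebra ℂ LS :=
  RingHom.toAlgebra (HahnSeries.C : ℂ →+* LaurentSeries ℂ)

/-- The coefficient of `z ^ k`. -/
def coeff (φ : LS) (k : ℤ) : ℂ := HahnSeries.coeff (φ : LaurentSeries ℂ) k

@[ext]
theorem ext {φ ψ : LS} (h : ∀ k, φ.coeff k = ψ.coeff k) : φ = ψ :=
  HahnSeries.ext (funext h)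

@[simp]
theorem coeff_zero (k : ℤ) : (0 : LS).coeff k = 0 := rfl

theorem coeff_add (φ ψ : LS) (k : ℤ) : (φ + ψ).coeff k = φ.coeff k + ψ.coeff k := rfl

theorem coeff_neg (φ : LS) (k : ℤ) : (-φ).coeff k = -φ.coeff k := rfl

theorem coeff_sub (φ ψ : LS) (k : ℤ) : (φ - ψ).coeff k = φ.coeff k - ψ.coeff k := by
  rw [sub_eq_add_neg, coeff_add, coeff_neg, sub_eq_add_neg]

theorem coeff_smul (c : ℂ) (φ : LS) (k : ℤ) : (c • φ).coeff k = c * φ.coeff k :=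
  HahnSeries.coeff_single_zero_mul

theorem exists_order (φ : LS) : ∃ B : ℤ, ∀ k < B, φ.coeff k = 0 :=
  ⟨HahnSeries.order (φ : LaurentSeries ℂ), fun _ hk => HahnSeries.coeff_eq_zero_of_lt_order hk⟩

theorem coeff_mul_eq_zero {φ ψ : LS} {k : ℤ} (h : ∀ i j, i + j = k → φ.coeff i * ψ.coeff j = 0) :
    (φ * ψ).coeff k = 0 := by
  refine (HahnSeries.coeff_mul (x := (φ : LaurentSeries ℂ)) (y := ψ) (a := k)).trans
    (Finset.sum_eq_zero fun ij hij => ?_)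
  exact h _ _ (Finset.mem_antidiagonal.1 hij).2.2

end LS

/-- The Laurent monomial `z ^ k`. -/
noncomputable def zp (k : ℤ) : LS := (HahnSeries.single k 1 : LaurentSeries ℂ)

/-- The expansion of `x ^ k = (1 + z) ^ k` in powers of `z`. -/
noncomputable def xp (k : ℤ) : LS := (1 + zp 1) ^ k

theorem zp_mul (a b : ℤ) : zp a * zp b = zp (a + b) :=
  (HahnSeries.single_mul_single (a := a) (b := b) (r := (1 : ℂ)) (s := 1)).trans
    (by rw [one_mul]; rfl)

theorem zp_zero : zp 0 = 1 := rfl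

theorem coeff_zp (a k : ℤ) : (zp a).coeff k = if k = a then 1 else 0 := by
  refine (HahnSeries.coeff_single (a := a) (b := k) (r := (1 : ℂ))).trans ?_
  congr

theorem coeff_zp_mul (a k : ℤ) (φ : LS) : (zp a * φ).coeff k = φ.coeff (k - a) :=
  (HahnSeries.coeff_single_mul (r := (1 : ℂ)) (x := (φ : LaurentSeries ℂ))).trans (one_mul _)

theorem coeff_mul_zp (a k : ℤ) (φ : LS) : (φ * zp a).coeff k = φ.coeff (k - a) := by
  rw [mul_comm, coeff_zp_mul]

theorem one_add_zp_one_ne_zero : (1 + zp 1 : LS) ≠ 0 := by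
  intro h
  have := congrArg (fun φ : LS => φ.coeff 0) h
  rw [← zp_zero] at this
  simp [LS.coeff_add, coeff_zp] at this

theorem xp_add (a b : ℤ) : xp (a + b) = xp a * xp b := zpow_add₀ one_add_zp_one_ne_zero a b

theorem xp_zero : xp 0 = 1 := zpow_zero _

theorem xp_one : xp 1 = 1 + zp 1 := zpow_one _

theorem xp_mul_neg (a : ℤ) : xp a * xp (-a) = 1 := by
  rw [← xp_add, add_neg_cancel, xp_zero]

theorem coeff_xp_one_mul (k : ℤ) (φ : LS) :
    (xp 1 * φ).coeff k = φ.coeff k + φ.coeff (k - 1) := by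
  rw [xp_one, add_mul, one_mul, LS.coeff_add, coeff_zp_mul]

/-- The binomial series `∑ C(s, l) z ^ l`. -/
noncomputable def binomSeries (s : ℤ) : LS :=
  (HahnSeries.ofPowerSeries ℤ ℂ (PowerSeries.mk (cbinom s)) : LaurentSeries ℂ)

theorem coeff_binomSeries_nat (s : ℤ) (l : ℕ) : (binomSeries s).coeff l = cbinom s l := by
  have := HahnSeries.ofPowerSeries_apply_coeff (Γ := ℤ) (PowerSeries.mk (cbinom s)) l
  rw [PowerSeries.coeff_mk] at this
  exact this

theorem coeff_binomSeries_neg (s : ℤ) {k : ℤ} (hk : k < 0) : (binomSeries s).coeff k = 0 := by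
  have := PowerSeries.coeff_coe (PowerSeries.mk (cbinom s)) k
  rw [if_pos hk] at this
  exact this

theorem xp_one_mul_binomSeries (s : ℤ) : xp 1 * binomSeries s = binomSeries (s + 1) := by
  ext k
  rw [coeff_xp_one_mul]
  rcases lt_trichotomy k 0 with hk | rfl | hk
  · rw [coeff_binomSeries_neg _ hk, coeff_binomSeries_neg _ hk,
      coeff_binomSeries_neg _ (by omega), add_zero]
  · have h1 := coeff_binomSeries_nat s 0
    have h2 := coeff_binomSeries_nat (s + 1) 0
    simp only [Nat.cast_zero, cbinom_zero_right] at h1 h2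
    rw [h1, h2, coeff_binomSeries_neg _ (by omega), add_zero]
  · obtain ⟨l, rfl⟩ : ∃ l : ℕ, k = ((l + 1 : ℕ) : ℤ) := ⟨(k - 1).toNat, by omega⟩
    rw [coeff_binomSeries_nat, coeff_binomSeries_nat, cbinom_succ_succ,
      show ((l + 1 : ℕ) : ℤ) - 1 = (l : ℕ) by push_cast; ring, coeff_binomSeries_nat, add_comm]

theorem xp_eq_binomSeries (s : ℤ) : xp s = binomSeries s := by
  have step : ∀ s, xp s = binomSeries s ↔ xp (s + 1) = binomSeries (s + 1) := fun s => by
    rw [← xp_one_mul_binomSeries, add_comm s 1, xp_add]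
    exact ⟨fun h => by rw [h], fun h => mul_left_cancel₀ (xp_one ▸ one_add_zp_one_ne_zero) h⟩
  induction s using Int.induction_on with
  | zero =>
    rw [xp_zero, ← zp_zero]
    ext k
    rcases lt_trichotomy k 0 with hk | rfl | hk
    · rw [coeff_binomSeries_neg _ hk, coeff_zp, if_neg (by omega)]
    · have h1 := coeff_binomSeries_nat 0 0
      rw [cbinom_zero_right] at h1
      exact (by simp [coeff_zp] : (zp 0).coeff 0 = 1).trans h1.symm
    · obtain ⟨l, rfl⟩ : ∃ l : ℕ, k = ((l + 1 : ℕ) : ℤ) := ⟨(k - 1).toNat, by omega⟩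
      rw [coeff_binomSeries_nat, cbinom_zero_succ, coeff_zp, if_neg (by omega)]
  | succ i ih => exact (step _).1 ih
  | pred i ih => exact (step _).2 (by rwa [sub_add_cancel])

theorem coeff_xp_nat (s : ℤ) (l : ℕ) : (xp s).coeff l = cbinom s l := by
  rw [xp_eq_binomSeries, coeff_binomSeries_nat]

theorem coeff_xp_neg (s : ℤ) {k : ℤ} (hk : k < 0) : (xp s).coeff k = 0 := by
  rw [xp_eq_binomSeries, coeff_binomSeries_neg s hk]

/-- A property of Laurent series that is additive, holds for monomials and holds for all series
of sufficiently high order holds for all series. -/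
theorem laurent_induction {P : LS → Prop} (hadd : ∀ φ ψ, P φ → P ψ → P (φ + ψ))
    (hmono : ∀ (c : ℂ) (k : ℤ), P (c • zp k))
    (htail : ∃ B : ℤ, ∀ φ : LS, (∀ k < B, φ.coeff k = 0) → P φ) (φ : LS) : P φ := by
  obtain ⟨B, hB⟩ := htail
  have main : ∀ (m : ℕ) (φ : LS), (∀ k < B - m, φ.coeff k = 0) → P φ := fun m => by
    induction m with
    | zero => exact fun φ h => hB φ fun k hk => h k (by simpa using hk)
    | succ m ih =>
      intro φ h
      have := hadd _ _ (hmono (φ.coeff (B - (m + 1 : ℕ))) (B - (m + 1 : ℕ)))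
        (ih (φ - φ.coeff (B - (m + 1 : ℕ)) • zp (B - (m + 1 : ℕ))) fun k hk => ?_)
      · rwa [add_sub_cancel] at this
      · rw [LS.coeff_sub, LS.coeff_smul, coeff_zp]
        split_ifs with hk'
        · simp [hk']
        · rw [h k (by push_cast at hk' ⊢; omega)]; simp
  obtain ⟨B', hB'⟩ := φ.exists_order
  exact main (B - B').toNat φ fun k hk => hB' k (by omega)

/-- Laurent series of the form `x ^ c * ρ` with `ρ` a Laurent polynomial in `z` of degree at most
`d - c`: expansions at `x = 1` of rational functions with poles at most in `{0, 1, ∞}`, of order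
at least `c` at `x = 0` and growing at most like `x ^ d` at infinity. -/
noncomputable def testSpace (c d : ℤ) : Submodule ℂ LS where
  carrier := {φ | ∀ k, d - c < k → (xp (-c) * φ).coeff k = 0}
  add_mem' := fun ha hb k hk => by
    rw [mul_add, LS.coeff_add, ha k hk, hb k hk, add_zero]
  zero_mem' := fun k _ => by simp
  smul_mem' := fun r φ h k hk => by
    rw [mul_smul_comm, LS.coeff_smul, h k hk, mul_zero]

theorem mem_testSpace {c d : ℤ} {φ : LS} :
    φ ∈ testSpace c d ↔ ∀ k, d - c < k → (xp (-c) * φ).coeff k = 0 := Iff.rfl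

theorem xp_mul_mem_testSpace {c d : ℤ} {ρ : LS} :
    xp c * ρ ∈ testSpace c d ↔ ∀ k, d - c < k → ρ.coeff k = 0 := by
  rw [mem_testSpace, ← mul_assoc, mul_comm (xp (-c)), xp_mul_neg, one_mul]

theorem exists_eq_xp_mul (c : ℤ) (φ : LS) : ∃ ρ, φ = xp c * ρ :=
  ⟨xp (-c) * φ, by rw [← mul_assoc, xp_mul_neg, one_mul]⟩

theorem coeff_mul_eq_zero {A B : LS} {e e' : ℤ} (hA : ∀ k, e < k → A.coeff k = 0)
    (hB : ∀ k, e' < k → B.coeff k = 0) {k : ℤ} (hk : e + e' < k) : (A * B).coeff k = 0 := by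
  refine LS.coeff_mul_eq_zero fun i j hij => ?_
  rcases lt_or_ge e i with h | h
  · rw [hA _ h, zero_mul]
  · rw [hB _ (by omega), mul_zero]

theorem mul_mem_testSpace {c d c' d' : ℤ} {φ ψ : LS} (hφ : φ ∈ testSpace c d)
    (hψ : ψ ∈ testSpace c' d') : φ * ψ ∈ testSpace (c + c') (d + d') := fun k hk => by
  rw [neg_add, xp_add, mul_mul_mul_comm]
  exact coeff_mul_eq_zero hφ hψ (by omega)

theorem xp_mem_testSpace (a : ℤ) : xp a ∈ testSpace a a := by
  rw [← mul_one (xp a), xp_mul_mem_testSpace]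
  intro k hk
  rw [← zp_zero, coeff_zp, if_neg (by omega)]

theorem zp_mem_testSpace (a : ℤ) : zp a ∈ testSpace 0 a := by
  rw [← one_mul (zp a), ← xp_zero, xp_mul_mem_testSpace]
  intro k hk
  rw [coeff_zp, if_neg (by omega)]

theorem one_mem_testSpace : (1 : LS) ∈ testSpace 0 0 := zp_mem_testSpace 0

theorem testSpace_mono_right {c d d' : ℤ} (h : d ≤ d') : testSpace c d ≤ testSpace c d' :=
  fun _ hφ k hk => hφ k (by omega)

theorem testSpace_succ_le (c d : ℤ) : testSpace (c + 1) d ≤ testSpace c d := fun φ hφ k hk => by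
  rw [show -c = 1 + -(c + 1) by ring, xp_add, mul_assoc, coeff_xp_one_mul, hφ k (by omega),
    hφ (k - 1) (by omega), add_zero]

theorem testSpace_anti_left {c c' d : ℤ} (h : c ≤ c') : testSpace c' d ≤ testSpace c d := by
  induction c', h using Int.leInduction with
  | base => exact le_rfl
  | succ n _ ih => exact (testSpace_succ_le n d).trans ih

theorem testSpace_mono {c c' d d' : ℤ} (hc : c' ≤ c) (hd : d ≤ d') :
    testSpace c d ≤ testSpace c' d' :=
  (testSpace_anti_left hc).trans (testSpace_mono_right hd)

theorem pow_mem_testSpace {c d : ℤ} {φ : LS} (h : φ ∈ testSpace c d) (n : ℕ) :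
    φ ^ n ∈ testSpace (n * c) (n * d) := by
  induction n with
  | zero => simpa using one_mem_testSpace
  | succ n ih =>
    rw [pow_succ]
    have := mul_mem_testSpace ih h
    push_cast
    rwa [add_mul, one_mul, add_mul, one_mul]

theorem testSpace_succ_inter {c d d' : ℤ} {φ : LS} (h : φ ∈ testSpace c d)
    (h' : φ ∈ testSpace (c + 1) d') : φ ∈ testSpace (c + 1) d := by
  obtain ⟨ρ, rfl⟩ := exists_eq_xp_mul (c + 1) φ
  rw [xp_mul_mem_testSpace] at h' ⊢
  rw [xp_add, mul_assoc, xp_mul_mem_testSpace] at h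
  have key : ∀ (m : ℕ) (k : ℤ), d - (c + 1) < k → d' - (c + 1) < k + m → ρ.coeff k = 0 := by
    intro m
    induction m with
    | zero => exact fun k _ hk => h' k (by simpa using hk)
    | succ m ih =>
      intro k hk hk'
      have h1 := h (k + 1) (by omega)
      rw [coeff_xp_one_mul, ih (k + 1) (by omega) (by push_cast at hk'; omega), zero_add,
        add_sub_cancel_right] at h1
      exact h1
  exact fun k hk => key (d' - (c + 1) - k + 1).toNat k hk (by omega)

/-- Order at `0` and growth at infinity can be estimated separately. -/
theorem testSpace_inter {c d c' d' : ℤ} {φ : LS} (h : φ ∈ testSpace c d)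
    (h' : φ ∈ testSpace c' d') : φ ∈ testSpace c' d := by
  rcases le_total c' c with hc | hc
  · exact testSpace_anti_left hc h
  · induction c', hc using Int.leInduction with
    | base => exact h
    | succ n _ ih => exact testSpace_succ_inter (ih (testSpace_succ_le _ _ h')) h'

theorem coeff_hasseDeriv (i : ℕ) (φ : LS) (k : ℤ) :
    LS.coeff (LaurentSeries.hasseDeriv ℂ i (φ : LaurentSeries ℂ)) k
      = cbinom (k + i) i * φ.coeff (k + i) := by
  rw [cbinom_eq_choose, ← zsmul_eq_mul]
  exact LaurentSeries.hasseDeriv_coeff (V := ℂ) i (φ : LaurentSeries ℂ) k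

/-- Hasse derivatives of Laurent series. -/
noncomputable def hasse (i : ℕ) : LS →ₗ[ℂ] LS where
  toFun := fun φ => LaurentSeries.hasseDeriv ℂ i (φ : LaurentSeries ℂ)
  map_add' := fun φ ψ => LS.ext fun k => by
    refine (coeff_hasseDeriv i (φ + ψ) k).trans (Eq.trans ?_ (LS.coeff_add _ _ _).symm)
    rw [LS.coeff_add, mul_add, coeff_hasseDeriv, coeff_hasseDeriv]
  map_smul' := fun c φ => LS.ext fun k => by
    refine (coeff_hasseDeriv i (c • φ) k).trans ?_
    rw [LS.coeff_smul]
    refine Eq.trans ?_ (LS.coeff_smul _ _ _).symm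
    rw [coeff_hasseDeriv, mul_left_comm, RingHom.id_apply]

theorem coeff_hasse (i : ℕ) (φ : LS) (k : ℤ) :
    (hasse i φ).coeff k = cbinom (k + i) i * φ.coeff (k + i) :=
  coeff_hasseDeriv i φ k

theorem cbinom_one_right (n : ℤ) : cbinom n 1 = n := by simp [cbinom]

theorem hasse_one_xp_one_mul (φ : LS) : hasse 1 (xp 1 * φ) = φ + xp 1 * hasse 1 φ := by
  ext k
  simp only [coeff_hasse, coeff_xp_one_mul, LS.coeff_add, cbinom_one_right, Nat.cast_one,
    add_sub_cancel_right, sub_add_cancel]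
  push_cast
  ring

theorem hasse_one_xp_mul (a : ℤ) (φ : LS) :
    hasse 1 (xp a * φ) = (a : ℂ) • (xp (a - 1) * φ) + xp a * hasse 1 φ := by
  have hx : xp 1 ≠ 0 := xp_one ▸ one_add_zp_one_ne_zero
  induction a using Int.induction_on generalizing φ with
  | zero => simp [xp_zero]
  | succ i ih =>
    rw [xp_add, mul_comm (xp _) (xp 1), mul_assoc, hasse_one_xp_one_mul, ih, mul_add,
      mul_smul_comm, ← mul_assoc (xp 1), ← xp_add, add_sub_cancel, add_sub_cancel_right,
      ← mul_assoc, ← add_assoc]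
    congr 1
    push_cast
    rw [add_smul, one_smul, add_comm]
  | pred i ih =>
    have h := hasse_one_xp_one_mul (xp (-(i : ℤ) - 1) * φ)
    rw [← mul_assoc, ← xp_add, add_sub_cancel, ih] at h
    apply mul_left_cancel₀ hx
    rw [eq_sub_of_add_eq' h.symm, mul_add, mul_smul_comm, ← mul_assoc (xp 1), ← mul_assoc (xp 1),
      ← xp_add, ← xp_add,
      show (1 : ℤ) + (-(i : ℤ) - 1 - 1) = -(i : ℤ) - 1 by ring,
      show (1 : ℤ) + (-(i : ℤ) - 1) = -(i : ℤ) by ring]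
    push_cast
    module

theorem hasse_zero (φ : LS) : hasse 0 φ = φ := by
  ext k
  rw [coeff_hasse, cbinom_zero_right, one_mul, Nat.cast_zero, add_zero]

theorem cbinom_succ_mul (p : ℤ) (i : ℕ) :
    cbinom p (i + 1) = ((i : ℂ) + 1)⁻¹ * (cbinom p i * ((p : ℂ) - i)) := by
  have hi : (i : ℂ) + 1 ≠ 0 := by exact_mod_cast i.succ_ne_zero
  have hk : (i.factorial : ℂ) ≠ 0 := by exact_mod_cast i.factorial_ne_zero
  unfold cbinom
  rw [Finset.prod_range_succ, Nat.factorial_succ]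
  push_cast
  field_simp

theorem hasse_succ (i : ℕ) (φ : LS) :
    hasse (i + 1) φ = ((i : ℂ) + 1)⁻¹ • hasse 1 (hasse i φ) := by
  ext k
  rw [LS.coeff_smul, coeff_hasse, coeff_hasse, coeff_hasse, cbinom_succ_mul, cbinom_one_right,
    show k + ((i + 1 : ℕ) : ℤ) = k + (1 : ℕ) + i by push_cast; ring]
  push_cast
  ring

theorem hasse_one_mem_testSpace {c d : ℤ} {φ : LS} (h : φ ∈ testSpace c d) :
    hasse 1 φ ∈ testSpace (c - 1) (d - 1) := by
  obtain ⟨ρ, rfl⟩ := exists_eq_xp_mul c φ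
  rw [xp_mul_mem_testSpace] at h
  have hx : xp c = xp (c - 1) * xp 1 := by rw [← xp_add, sub_add_cancel]
  rw [hasse_one_xp_mul, hx, mul_assoc, ← mul_smul_comm, ← mul_add, xp_mul_mem_testSpace]
  intro k hk
  rw [LS.coeff_add, LS.coeff_smul, coeff_xp_one_mul, coeff_hasse, coeff_hasse,
    h k (by omega), h (k + (1 : ℕ)) (by push_cast; omega),
    h (k - 1 + (1 : ℕ)) (by push_cast; omega)]
  simp

theorem hasse_mem_testSpace {c d : ℤ} {φ : LS} (h : φ ∈ testSpace c d) (i : ℕ) :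
    hasse i φ ∈ testSpace (c - i) (d - i) := by
  induction i with
  | zero => simpa [hasse_zero] using h
  | succ i ih =>
    rw [hasse_succ]
    have := hasse_one_mem_testSpace ih
    push_cast
    rw [← sub_sub, ← sub_sub]
    exact Submodule.smul_mem _ _ this

theorem hasse_xp (p : ℤ) (i : ℕ) : hasse i (xp p) = cbinom p i • xp (p - i) := by
  induction i with
  | zero => simp [hasse_zero, cbinom_zero_right]
  | succ i ih =>
    have h1 : hasse 1 (1 : LS) = 0 := by
      ext k
      rw [coeff_hasse, ← zp_zero, coeff_zp, cbinom_one_right]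
      split_ifs with h
      · push_cast at h ⊢; rw [show (k : ℂ) = -1 by exact_mod_cast (by omega : k = -1)]; simp
      · simp
    have h2 := hasse_one_xp_mul (p - i) 1
    rw [h1, mul_one, mul_one, mul_zero, add_zero] at h2
    rw [hasse_succ, ih, map_smul, h2, cbinom_succ_mul, smul_smul, smul_smul]
    push_cast
    rw [← sub_sub, mul_assoc]

theorem hasse_zp (p : ℤ) (i : ℕ) : hasse i (zp p) = cbinom p i • zp (p - i) := by
  ext k
  rw [coeff_hasse, LS.coeff_smul, coeff_zp, coeff_zp]
  by_cases h : k + i = p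
  · rw [if_pos h, if_pos (by omega), h]
  · rw [if_neg h, if_neg (by omega), mul_zero, mul_zero]

theorem exists_approx_one (K L : ℕ) : ∃ e ∈ testSpace 0 (-L), 1 - e ∈ testSpace K 0 := by
  set g : LS := -zp (-1) with hg
  have hg0 : g ∈ testSpace 0 (-1) := Submodule.neg_mem _ (zp_mem_testSpace _)
  have hg1 : 1 - g ∈ testSpace 1 0 := by
    have : 1 - g = xp 1 * zp (-1) := by
      rw [hg, xp_one, add_mul, zp_mul, one_mul, add_neg_cancel, zp_zero]; ring
    rw [this]
    simpa using mul_mem_testSpace (xp_mem_testSpace 1) (zp_mem_testSpace (-1))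
  have hgp : ∀ i : ℕ, g ^ i ∈ testSpace 0 (-i) := fun i => by simpa using pow_mem_testSpace hg0 i
  have hgL : 1 - g ^ L ∈ testSpace 1 0 := by
    rw [← mul_neg_geom_sum]
    simpa using mul_mem_testSpace hg1 (Submodule.sum_mem _ fun i (_ : i ∈ Finset.range L) =>
      testSpace_mono_right (by omega : -(i : ℤ) ≤ 0) (hgp i))
  refine ⟨1 - (1 - g ^ L) ^ K, ?_, ?_⟩
  · have h := mul_neg_geom_sum (1 - g ^ L) K
    rw [← h, sub_sub_cancel]
    have h0 : ∀ i ∈ Finset.range K, (1 - g ^ L) ^ i ∈ testSpace 0 0 := fun i _ => by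
      simpa using pow_mem_testSpace (testSpace_succ_le 0 0 (by simpa using hgL)) i
    have := mul_mem_testSpace (hgp L) (Submodule.sum_mem _ h0)
    rwa [add_zero, add_zero] at this
  · rw [sub_sub_cancel]
    simpa using pow_mem_testSpace hgL K

theorem exists_approx_xp (m K d : ℤ) : ∃ φ ∈ testSpace m d, xp m - φ ∈ testSpace K m := by
  obtain ⟨e, he, he'⟩ := exists_approx_one (K - m).toNat (m - d).toNat
  refine ⟨xp m * e, ?_, ?_⟩
  · exact testSpace_mono (by omega) (by omega) (mul_mem_testSpace (xp_mem_testSpace m) he)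
  · have : xp m - xp m * e = xp m * (1 - e) := by ring
    rw [this]
    exact testSpace_mono (by omega) (by omega) (mul_mem_testSpace (xp_mem_testSpace m) he')

/-- The remainder of the Taylor expansion of `(1 - x) ^ t` at `x = 0`. -/
noncomputable def taylorRem (t : ℤ) (I : ℕ) : LS :=
  (-1 : ℂ) ^ t • zp t - ∑ i ∈ Finset.range I, ((-1 : ℂ) ^ i * cbinom t i) • xp i

theorem taylorRem_succ_left (t : ℤ) (I : ℕ) :
    taylorRem (t + 1) (I + 1) =
      -zp 1 * taylorRem t (I + 1) + ((-1 : ℂ) ^ I * cbinom t I) • -xp ((I : ℤ) + 1) := by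
  have hz : -zp 1 = 1 - xp 1 := by rw [xp_one]; ring
  have hsum : ∀ I : ℕ, ∑ i ∈ Finset.range (I + 1), ((-1 : ℂ) ^ i * cbinom (t + 1) i) • xp i
      = (1 - xp 1) * (∑ i ∈ Finset.range (I + 1), ((-1 : ℂ) ^ i * cbinom t i) • xp i)
        + ((-1 : ℂ) ^ I * cbinom t I) • xp ((I : ℤ) + 1) := fun I => by
    induction I with
    | zero => simp [cbinom_zero_right, xp_zero]
    | succ I ih =>
      rw [Finset.sum_range_succ, ih, Finset.sum_range_succ _ (I + 1), mul_add,
        cbinom_succ_succ, mul_smul_comm]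
      simp only [sub_mul, one_mul, ← xp_add]
      push_cast
      rw [add_comm (1 : ℤ) ((I : ℤ) + 1)]
      module
  rw [taylorRem, taylorRem, hsum, mul_sub, zpow_add₀ (by norm_num), zpow_one, mul_smul_comm,
    neg_mul, zp_mul, add_comm 1 t, ← hz]
  module

theorem exists_taylorRem_mem (t : ℤ) (I : ℕ) : ∃ d, taylorRem t I ∈ testSpace I d := by
  cases I with
  | zero =>
    exact ⟨t, by simpa [taylorRem] using Submodule.smul_mem _ _ (zp_mem_testSpace t)⟩
  | succ I =>
    have hx : ∀ t : ℤ, ((-1 : ℂ) ^ I * cbinom t I) • -xp ((I : ℤ) + 1)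
        ∈ testSpace (I + 1 : ℕ) (I + 1) := fun t =>
      Submodule.smul_mem _ _ (Submodule.neg_mem _ (xp_mem_testSpace _))
    induction t using Int.induction_on with
    | zero =>
      refine ⟨0, ?_⟩
      rw [taylorRem, Finset.sum_range_succ']
      simp [cbinom_zero_right, cbinom_zero_succ, zp_zero, xp_zero]
    | succ t ih =>
      obtain ⟨d, hd⟩ := ih
      refine ⟨max (1 + d) (I + 1), ?_⟩
      rw [taylorRem_succ_left]
      refine Submodule.add_mem _ ?_ (testSpace_mono_right (le_max_right _ _) (hx _))
      have := mul_mem_testSpace (Submodule.neg_mem _ (zp_mem_testSpace 1)) hd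
      rw [zero_add] at this
      exact testSpace_mono_right (le_max_left _ _) this
    | pred t ih =>
      obtain ⟨d, hd⟩ := ih
      have h := taylorRem_succ_left (-(t : ℤ) - 1) I
      rw [sub_add_cancel, ← sub_eq_iff_eq_add] at h
      have h2 : taylorRem (-(t : ℤ) - 1) (I + 1) = -zp (-1) * (-zp 1 *
          taylorRem (-(t : ℤ) - 1) (I + 1)) := by
        rw [← mul_assoc, neg_mul_neg, zp_mul, neg_add_cancel, zp_zero, one_mul]
      refine ⟨-1 + max d (I + 1), ?_⟩
      rw [h2, ← h]
      have := mul_mem_testSpace (Submodule.neg_mem _ (zp_mem_testSpace (-1)))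
        (Submodule.sub_mem _ (testSpace_mono_right (le_max_left d (I + 1)) hd)
          (testSpace_mono_right (le_max_right d (I + 1)) (hx (-(t : ℤ) - 1))))
      rwa [zero_add] at this

theorem taylorRem_mem {t d : ℤ} {I : ℕ} (ht : t ≤ d) (hI : ∀ i < I, (i : ℤ) ≤ d) :
    taylorRem t I ∈ testSpace I d := by
  obtain ⟨d', hd'⟩ := exists_taylorRem_mem t I
  refine testSpace_inter (c := 0) ?_ hd'
  refine Submodule.sub_mem _
    (Submodule.smul_mem _ _ (testSpace_mono_right ht (zp_mem_testSpace t)))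
    (Submodule.sum_mem _ fun i hi => Submodule.smul_mem _ _ ?_)
  exact testSpace_mono (by omega) (hI i (Finset.mem_range.1 hi)) (xp_mem_testSpace i)

theorem eventually_sum_range_eq_finsum {E : Type*} [AddCommMonoid E] {f : ℕ → E}
    (hf : ∀ᶠ i in atTop, f i = 0) : ∀ᶠ N in atTop, ∑ i ∈ Finset.range N, f i = ∑ᶠ i, f i := by
  obtain ⟨N₀, hN₀⟩ := eventually_atTop.1 hf
  refine eventually_atTop.2 ⟨N₀, fun N hN =>
    (finsum_eq_sum_of_support_subset f fun i hi => ?_).symm⟩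
  rw [Finset.coe_range, Set.mem_Iio]
  by_contra h
  exact hi (hN₀ i (by omega))

/-- All coefficients of index less than `B` vanish. -/
def LS.OrderGE (B : ℤ) (φ : LS) : Prop := ∀ k < B, φ.coeff k = 0

theorem LS.OrderGE.mul {B C : ℤ} {φ ψ : LS} (hφ : OrderGE B φ) (hψ : OrderGE C ψ) :
    OrderGE (B + C) (φ * ψ) := fun k hk =>
  LS.coeff_mul_eq_zero fun i j hij => by
    rcases lt_or_ge i B with h | h
    · rw [hφ i h, zero_mul]
    · rw [hψ j (by omega), mul_zero]

theorem LS.OrderGE.mono {B C : ℤ} {φ : LS} (hφ : OrderGE B φ) (h : C ≤ B) : OrderGE C φ :=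
  fun k hk => hφ k (by omega)

theorem LS.OrderGE.hasse {B : ℤ} {φ : LS} (hφ : OrderGE B φ) (i : ℕ) :
    OrderGE (B - i) (hasse i φ) := fun k hk => by
  rw [coeff_hasse, hφ _ (by omega), mul_zero]

theorem orderGE_zp (k : ℤ) : LS.OrderGE k (zp k) := fun j hj => by
  rw [coeff_zp, if_neg (by omega)]

namespace VOA

theorem finite_support_modes (d : VOA V) (u : V) (φ : LS) (v : V) :
    (Function.support fun k : ℤ => φ.coeff k • d.mode u k v).Finite := by
  obtain ⟨B, hB⟩ := φ.exists_order
  obtain ⟨N, hN⟩ := d.truncation u v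
  refine (Set.finite_Icc B N).subset fun k hk => ?_
  by_contra h
  rw [Set.mem_Icc, not_and_or, not_le, not_le] at h
  rcases h with h | h
  · exact hk (by simp only [hB k h, zero_smul])
  · exact hk (by simp only [hN k h.le, smul_zero])

/-- `Y u φ v` is the residue `Res_z φ(z) Y(u, z) v`. -/
noncomputable def Y (d : VOA V) : V →ₗ[ℂ] LS →ₗ[ℂ] V →ₗ[ℂ] V :=
  LinearMap.mk₂ ℂ
    (fun u φ =>
      { toFun := fun v => ∑ᶠ k : ℤ, φ.coeff k • d.mode u k v
        map_add' := fun v w => by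
          rw [← finsum_add_distrib (d.finite_support_modes u φ v) (d.finite_support_modes u φ w)]
          simp only [map_add, smul_add]
        map_smul' := fun c v => by
          rw [RingHom.id_apply, smul_finsum]
          simp only [map_smul, smul_comm c] })
    (fun u u' φ => LinearMap.ext fun v => by
      refine Eq.trans ?_ (finsum_add_distrib (d.finite_support_modes u φ v)
        (d.finite_support_modes u' φ v))
      simp only [LinearMap.coe_mk, AddHom.coe_mk, d.mode_add, LinearMap.add_apply, smul_add])
    (fun c u φ => LinearMap.ext fun v => by
      refine Eq.trans ?_ (smul_finsum c _).symm
      simp only [LinearMap.coe_mk, AddHom.coe_mk, d.mode_smul, LinearMap.smul_apply, smul_comm c])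
    (fun u φ ψ => LinearMap.ext fun v => by
      refine Eq.trans ?_ (finsum_add_distrib (d.finite_support_modes u φ v)
        (d.finite_support_modes u ψ v))
      simp only [LinearMap.coe_mk, AddHom.coe_mk, LS.coeff_add, add_smul])
    (fun c u φ => LinearMap.ext fun v => by
      refine Eq.trans ?_ (smul_finsum c _).symm
      simp only [LinearMap.coe_mk, AddHom.coe_mk, LS.coeff_smul, mul_smul])

theorem Y_apply (d : VOA V) (u : V) (φ : LS) (v : V) :
    d.Y u φ v = ∑ᶠ k : ℤ, φ.coeff k • d.mode u k v := rfl

theorem Y_zp (d : VOA V) (u : V) (k : ℤ) (v : V) : d.Y u (zp k) v = d.mode u k v := by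
  rw [Y_apply, finsum_eq_single _ k fun j hj => by rw [coeff_zp, if_neg hj, zero_smul], coeff_zp,
    if_pos rfl, one_smul]

theorem eventually_Y_eq_zero (d : VOA V) (u v : V) :
    ∀ᶠ B : ℤ in atTop, ∀ φ : LS, φ.OrderGE B → d.Y u φ v = 0 := by
  obtain ⟨N, hN⟩ := d.truncation u v
  refine eventually_atTop.2 ⟨N, fun B hB φ hφ => ?_⟩
  rw [Y_apply]
  refine (finsum_congr fun k => ?_).trans finsum_zero
  rcases lt_or_ge k B with hk | hk
  · rw [hφ k hk, zero_smul]
  · rw [hN k (hB.trans hk), smul_zero]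

theorem eventually_Y_hasse_mul_eq_zero (d : VOA V) (u v : V) (i : ℕ) (χ : LS) :
    ∀ᶠ B : ℤ in atTop, ∀ φ : LS, φ.OrderGE B → d.Y u (hasse i φ * χ) v = 0 := by
  obtain ⟨C, hC⟩ := χ.exists_order
  obtain ⟨N, hN⟩ := eventually_atTop.1 (d.eventually_Y_eq_zero u v)
  refine eventually_atTop.2 ⟨N + i - C, fun B hB φ hφ => hN (B - i + C) (by omega) _ ?_⟩
  exact (hφ.hasse i).mul hC

theorem eventually_Y_mul_eq_zero (d : VOA V) (u v : V) (χ : LS) :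
    ∀ᶠ B : ℤ in atTop, ∀ φ : LS, φ.OrderGE B → d.Y u (φ * χ) v = 0 := by
  simpa only [hasse_zero] using d.eventually_Y_hasse_mul_eq_zero u v 0 χ

theorem eventually_Y_mul_zp_eq_zero (d : VOA V) (u v : V) (χ : LS) :
    ∀ᶠ i : ℕ in atTop, d.Y u (χ * zp i) v = 0 := by
  have h := tendsto_natCast_atTop_atTop.eventually (d.eventually_Y_mul_eq_zero u v χ)
  filter_upwards [h] with i hi
  rw [mul_comm]
  exact hi _ (orderGE_zp _)

theorem eventually_mode_eq_zero (d : VOA V) (u v : V) (r : ℤ) :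
    ∀ᶠ i : ℕ in atTop, d.mode u (r + i) v = 0 := by
  filter_upwards [d.eventually_Y_mul_zp_eq_zero u v (zp r)] with i hi
  rwa [zp_mul, Y_zp] at hi

/-- One side of the Borcherds identity for `φ`, `ψ` in place of monomials. -/
noncomputable def iterTerm (d : VOA V) (φ ψ : LS) (r : ℤ) (a b v : V) (i : ℕ) : V :=
  d.Y (d.mode a (r + i) b) (hasse i φ * ψ) v

/-- The other side of the Borcherds identity for `φ`, `ψ` in place of monomials. -/
noncomputable def commTerm (d : VOA V) (φ ψ : LS) (r : ℤ) (a b v : V) (i : ℕ) : V :=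
  ((-1 : ℂ) ^ i * cbinom r i) • (d.Y a (φ * zp (r - i)) (d.Y b (ψ * zp i) v)
    - (-1 : ℂ) ^ r • d.Y b (ψ * zp (r - i)) (d.Y a (φ * zp i) v))

theorem eventually_iterTerm_eq_zero (d : VOA V) (φ ψ : LS) (r : ℤ) (a b v : V) :
    ∀ᶠ i in atTop, d.iterTerm φ ψ r a b v i = 0 := by
  filter_upwards [d.eventually_mode_eq_zero a b r] with i hi
  rw [iterTerm, hi, map_zero, LinearMap.zero_apply, LinearMap.zero_apply]

theorem eventually_commTerm_eq_zero (d : VOA V) (φ ψ : LS) (r : ℤ) (a b v : V) :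
    ∀ᶠ i in atTop, d.commTerm φ ψ r a b v i = 0 := by
  filter_upwards [d.eventually_Y_mul_zp_eq_zero a v φ, d.eventually_Y_mul_zp_eq_zero b v ψ]
    with i h1 h2
  rw [commTerm, h1, h2, map_zero, map_zero, smul_zero, sub_zero, smul_zero]

/-- The Borcherds identity for `φ` and `ψ`. -/
def BorcherdsFor (d : VOA V) (r : ℤ) (a b v : V) (φ ψ : LS) : Prop :=
  ∀ᶠ N in atTop, ∑ i ∈ Finset.range N, d.iterTerm φ ψ r a b v i
    = ∑ i ∈ Finset.range N, d.commTerm φ ψ r a b v i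

theorem borcherdsFor_of_eq_zero (d : VOA V) {r : ℤ} {a b v : V} {φ ψ : LS}
    (h : ∀ i, d.iterTerm φ ψ r a b v i = 0) (h' : ∀ i, d.commTerm φ ψ r a b v i = 0) :
    d.BorcherdsFor r a b v φ ψ :=
  Eventually.of_forall fun N => by simp only [h, h']

theorem BorcherdsFor.add_left {d : VOA V} {r : ℤ} {a b v : V} {φ φ' ψ : LS}
    (h : d.BorcherdsFor r a b v φ ψ) (h' : d.BorcherdsFor r a b v φ' ψ) :
    d.BorcherdsFor r a b v (φ + φ') ψ := by
  filter_upwards [h, h'] with N h1 h2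
  have e1 (i : ℕ) : d.iterTerm (φ + φ') ψ r a b v i
      = d.iterTerm φ ψ r a b v i + d.iterTerm φ' ψ r a b v i := by
    simp only [iterTerm, map_add, add_mul, LinearMap.add_apply]
  have e2 (i : ℕ) : d.commTerm (φ + φ') ψ r a b v i
      = d.commTerm φ ψ r a b v i + d.commTerm φ' ψ r a b v i := by
    simp only [commTerm, map_add, add_mul, LinearMap.add_apply]
    module
  simp only [e1, e2, Finset.sum_add_distrib, h1, h2]

theorem BorcherdsFor.add_right {d : VOA V} {r : ℤ} {a b v : V} {φ ψ ψ' : LS}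
    (h : d.BorcherdsFor r a b v φ ψ) (h' : d.BorcherdsFor r a b v φ ψ') :
    d.BorcherdsFor r a b v φ (ψ + ψ') := by
  filter_upwards [h, h'] with N h1 h2
  have e1 (i : ℕ) : d.iterTerm φ (ψ + ψ') r a b v i
      = d.iterTerm φ ψ r a b v i + d.iterTerm φ ψ' r a b v i := by
    simp only [iterTerm, map_add, mul_add, LinearMap.add_apply]
  have e2 (i : ℕ) : d.commTerm φ (ψ + ψ') r a b v i
      = d.commTerm φ ψ r a b v i + d.commTerm φ ψ' r a b v i := by
    simp only [commTerm, map_add, add_mul, LinearMap.add_apply]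
    module
  simp only [e1, e2, Finset.sum_add_distrib, h1, h2]

theorem BorcherdsFor.smul {d : VOA V} {r : ℤ} {a b v : V} {φ ψ : LS} (c c' : ℂ)
    (h : d.BorcherdsFor r a b v φ ψ) : d.BorcherdsFor r a b v (c • φ) (c' • ψ) := by
  filter_upwards [h] with N h1
  have e1 (i : ℕ) : d.iterTerm (c • φ) (c' • ψ) r a b v i
      = (c * c') • d.iterTerm φ ψ r a b v i := by
    simp only [iterTerm, map_smul, smul_mul_smul_comm, LinearMap.smul_apply]
  have e2 (i : ℕ) : d.commTerm (c • φ) (c' • ψ) r a b v i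
      = (c * c') • d.commTerm φ ψ r a b v i := by
    simp only [commTerm, map_smul, smul_mul_assoc, LinearMap.smul_apply]
    module
  simp only [e1, e2, ← Finset.smul_sum, h1]

theorem borcherdsFor_zp (d : VOA V) (r : ℤ) (a b v : V) (p q : ℤ) :
    d.BorcherdsFor r a b v (zp p) (zp q) := by
  filter_upwards
    [eventually_sum_range_eq_finsum (d.eventually_iterTerm_eq_zero (zp p) (zp q) r a b v),
    eventually_sum_range_eq_finsum (d.eventually_commTerm_eq_zero (zp p) (zp q) r a b v)]
    with N h1 h2
  rw [h1, h2]
  have e1 (i : ℕ) : d.iterTerm (zp p) (zp q) r a b v i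
      = cbinom p i • d.mode (d.mode a (r + i) b) (p + q - i) v := by
    rw [iterTerm, hasse_zp, smul_mul_assoc, map_smul, zp_mul, LinearMap.smul_apply, Y_zp,
      sub_add_eq_add_sub]
  have e2 (i : ℕ) : d.commTerm (zp p) (zp q) r a b v i = ((-1 : ℂ) ^ i * cbinom r i) •
      (d.mode a (p + r - i) (d.mode b (q + i) v)
        - (-1 : ℂ) ^ r • d.mode b (q + r - i) (d.mode a (p + i) v)) := by
    simp only [commTerm, zp_mul, Y_zp, add_sub_assoc]
  simp only [e1, e2]
  exact d.borcherds p q r a b v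

theorem borcherdsFor (d : VOA V) (r : ℤ) (a b v : V) (φ ψ : LS) :
    d.BorcherdsFor r a b v φ ψ := by
  obtain ⟨I, hI⟩ := eventually_atTop.1 (d.eventually_mode_eq_zero a b r)
  have iter0 (φ ψ : LS) (h : ∀ i < I, d.iterTerm φ ψ r a b v i = 0) (i : ℕ) :
      d.iterTerm φ ψ r a b v i = 0 := by
    by_cases hi : i < I
    · exact h i hi
    · rw [iterTerm, hI i (by omega), map_zero, LinearMap.zero_apply, LinearMap.zero_apply]
  have left (q : ℤ) (φ : LS) : d.BorcherdsFor r a b v φ (zp q) := by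
    refine laurent_induction (P := fun φ => d.BorcherdsFor r a b v φ (zp q))
      (fun _ _ h h' => h.add_left h')
      (fun c k => by simpa using (d.borcherdsFor_zp r a b v k q).smul c 1) ?_ φ
    obtain ⟨J, hJ⟩ := eventually_atTop.1 (d.eventually_Y_mul_zp_eq_zero b v (zp q))
    have h1 : ∀ᶠ B : ℤ in atTop, ∀ i ∈ Finset.range I, ∀ φ : LS, φ.OrderGE B →
        d.iterTerm φ (zp q) r a b v i = 0 :=
      (Finset.eventually_all _).2 fun i _ => d.eventually_Y_hasse_mul_eq_zero _ _ _ _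
    have h2 : ∀ᶠ B : ℤ in atTop, ∀ i ∈ Finset.range J, ∀ φ : LS, φ.OrderGE B →
        d.Y a (φ * zp (r - i)) (d.Y b (zp q * zp i) v) = 0 :=
      (Finset.eventually_all _).2 fun i _ => d.eventually_Y_mul_eq_zero _ _ _
    obtain ⟨B, h1, h2, h3⟩ := (h1.and (h2.and (d.eventually_Y_eq_zero a v))).exists
    refine ⟨B, fun φ hφ => d.borcherdsFor_of_eq_zero
      (iter0 _ _ fun i hi => h1 i (Finset.mem_range.2 hi) φ hφ) fun i => ?_⟩
    rw [commTerm, h3 _ ((LS.OrderGE.mul hφ (orderGE_zp i)).mono (by omega)), map_zero, smul_zero,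
      sub_zero]
    by_cases hi : i < J
    · rw [h2 i (Finset.mem_range.2 hi) φ hφ, smul_zero]
    · rw [hJ i (by omega), map_zero, smul_zero]
  refine laurent_induction (P := fun ψ => d.BorcherdsFor r a b v φ ψ)
    (fun _ _ h h' => h.add_right h')
    (fun c k => by simpa using (left k φ).smul 1 c) ?_ ψ
  obtain ⟨J, hJ⟩ := eventually_atTop.1 (d.eventually_Y_mul_zp_eq_zero a v φ)
  have h1 : ∀ᶠ B : ℤ in atTop, ∀ i ∈ Finset.range I, ∀ ψ : LS, ψ.OrderGE B →
      d.iterTerm φ ψ r a b v i = 0 :=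
    (Finset.eventually_all _).2 fun i _ => by
      simpa only [iterTerm, mul_comm] using d.eventually_Y_mul_eq_zero _ _ _
  have h2 : ∀ᶠ B : ℤ in atTop, ∀ i ∈ Finset.range J, ∀ ψ : LS, ψ.OrderGE B →
      d.Y b (ψ * zp (r - i)) (d.Y a (φ * zp i) v) = 0 :=
    (Finset.eventually_all _).2 fun i _ => d.eventually_Y_mul_eq_zero _ _ _
  obtain ⟨B, h1, h2, h3⟩ := (h1.and (h2.and (d.eventually_Y_eq_zero b v))).exists
  refine ⟨B, fun ψ hψ => d.borcherdsFor_of_eq_zero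
    (iter0 _ _ fun i hi => h1 i (Finset.mem_range.2 hi) ψ hψ) fun i => ?_⟩
  rw [commTerm, h3 _ ((LS.OrderGE.mul hψ (orderGE_zp i)).mono (by omega)), map_zero, zero_sub]
  by_cases hi : i < J
  · rw [h2 i (Finset.mem_range.2 hi) ψ hψ, smul_zero, neg_zero, smul_zero]
  · rw [hJ i (by omega), map_zero, smul_zero, neg_zero, smul_zero]

end VOA

namespace VOA

variable {E : Type} [AddCommGroup E] [Module ℂ E]

/-- Functionals killing the residues of `φ(z) Y(u, z)` for homogeneous `u` and all `φ` of order at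
least `wt u + n` at `x = 0` and growing at most like `x ^ (wt u - 2)` at infinity. -/
def contra (d : VOA V) (E : Type) [AddCommGroup E] [Module ℂ E] (n : ℤ) :
    Submodule ℂ (V →ₗ[ℂ] E) where
  carrier := {f | ∀ (h : ℤ) (u : V), u ∈ d.grading h → ∀ φ ∈ testSpace (h + n) (h - 2),
    ∀ v, f (d.Y u φ v) = 0}
  add_mem' := fun hf hg h u hu φ hφ v => by
    rw [LinearMap.add_apply, hf h u hu φ hφ, hg h u hu φ hφ, add_zero]
  zero_mem' := fun _ _ _ _ _ _ => rfl
  smul_mem' := fun c f hf h u hu φ hφ v => by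
    rw [LinearMap.smul_apply, hf h u hu φ hφ, smul_zero]

theorem contra_apply_eq_zero {d : VOA V} {n : ℤ} {f : V →ₗ[ℂ] E} (hf : f ∈ d.contra E n) {h : ℤ}
    {u : V} (hu : u ∈ d.grading h) {c e : ℤ} {φ : LS} (hφ : φ ∈ testSpace c e) (hc : h + n ≤ c)
    (he : e ≤ h - 2) (v : V) : f (d.Y u φ v) = 0 :=
  hf h u hu φ (testSpace_mono hc he hφ) v

theorem orderGE_xp_sub (s : ℤ) (N : ℕ) :
    LS.OrderGE N (xp s - ∑ l ∈ Finset.range N, cbinom s l • zp l) := fun k hk => by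
  have hsum (M : ℕ) : (∑ l ∈ Finset.range M, cbinom s l • zp l).coeff k
      = ∑ l ∈ Finset.range M, cbinom s l * if k = l then 1 else 0 := by
    induction M with
    | zero => simp
    | succ M ih => rw [Finset.sum_range_succ, Finset.sum_range_succ, LS.coeff_add, ih,
        LS.coeff_smul, coeff_zp]
  rw [LS.coeff_sub, hsum]
  rcases lt_or_ge k 0 with h | h
  · rw [coeff_xp_neg s h, Finset.sum_eq_zero, sub_zero]
    intro l _
    rw [if_neg (by omega), mul_zero]
  · lift k to ℕ using h
    rw [coeff_xp_nat, Finset.sum_eq_single k, if_pos rfl, mul_one, sub_self]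
    · intro l _ hl
      rw [if_neg (by omega), mul_zero]
    · intro h
      exact absurd (Finset.mem_range.2 (by omega)) h

theorem eventually_Y_mul_xp (d : VOA V) (a v : V) (φ : LS) :
    ∀ᶠ N : ℕ in atTop, ∀ s : ℤ, d.Y a (φ * xp s) v
      = ∑ l ∈ Finset.range N, cbinom s l • d.Y a (φ * zp l) v := by
  filter_upwards [tendsto_natCast_atTop_atTop.eventually (d.eventually_Y_mul_eq_zero a v φ)]
    with N hN s
  have h := hN _ (orderGE_xp_sub s N)
  rw [mul_comm, mul_sub, map_sub, LinearMap.sub_apply, sub_eq_zero] at h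
  rw [h, Finset.mul_sum, map_sum, LinearMap.sum_apply]
  simp only [mul_smul_comm, map_smul, LinearMap.smul_apply]

theorem contra_taylor {d : VOA V} {n : ℤ} {f : V →ₗ[ℂ] E} (hf : f ∈ d.contra E n) {hb : ℤ} {b : V}
    (hb' : b ∈ d.grading hb) {q e r : ℤ} {ψ : LS} (hψ : ψ ∈ testSpace q e) {I : ℕ}
    (hI : hb + n ≤ q + I) (hr : e + r ≤ hb - 2) (he : ∀ i < I, e + i ≤ hb - 2) (a v : V) (φ : LS) :
    ∀ᶠ N in atTop,
      ∑ i ∈ Finset.range I, ((-1 : ℂ) ^ i * cbinom r i) •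
        f (d.Y b (ψ * xp i) (d.Y a (φ * xp (r - i)) v))
      = ∑ l ∈ Finset.range N, ((-1 : ℂ) ^ r * ((-1 : ℂ) ^ l * cbinom r l)) •
        f (d.Y b (ψ * zp (r - l)) (d.Y a (φ * zp l) v)) := by
  filter_upwards [d.eventually_Y_mul_xp a v φ] with N hN
  have key (l : ℕ) (w : V) : (-1 : ℂ) ^ (r - l) • f (d.Y b (ψ * zp (r - l)) w)
      = ∑ i ∈ Finset.range I, ((-1 : ℂ) ^ i * cbinom (r - l) i) • f (d.Y b (ψ * xp i) w) := by
    have h := contra_apply_eq_zero hf hb' (mul_mem_testSpace hψ (taylorRem_mem (t := r - l)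
      (d := hb - 2 - e) (I := I) (by omega) fun i hi => by have := he i hi; omega)) hI
      (by omega) w
    rw [taylorRem, mul_sub, map_sub, LinearMap.sub_apply, map_sub, sub_eq_zero, mul_smul_comm,
      map_smul, LinearMap.smul_apply, map_smul, Finset.mul_sum, map_sum, LinearMap.sum_apply,
      map_sum] at h
    rw [h]
    simp only [mul_smul_comm, map_smul, LinearMap.smul_apply]
  simp only [hN, map_sum, map_smul, Finset.smul_sum]
  rw [Finset.sum_comm]
  refine Finset.sum_congr rfl fun l _ => ?_
  have hs : (-1 : ℂ) ^ r * ((-1 : ℂ) ^ l * cbinom r l) = cbinom r l * (-1 : ℂ) ^ (r - l) := by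
    have : (-1 : ℂ) ^ l = ((-1 : ℂ) ^ l)⁻¹ := by rw [← inv_pow]; norm_num
    rw [zpow_sub₀ (by norm_num), zpow_natCast, div_eq_mul_inv, ← this]
    ring
  rw [hs, mul_smul, key, Finset.smul_sum]
  refine Finset.sum_congr rfl fun i _ => ?_
  rw [smul_smul, smul_smul, mul_assoc, cbinom_mul_cbinom_sub, mul_left_comm]

theorem contra_borcherds {d : VOA V} {n : ℤ} {f : V →ₗ[ℂ] E} (hf : f ∈ d.contra E n) {ha hb : ℤ}
    {a b : V} (ha' : a ∈ d.grading ha) (hb' : b ∈ d.grading hb) {ja da jb db r : ℤ} {φ ψ : LS}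
    (hφ : φ ∈ testSpace ja da) (hψ : ψ ∈ testSpace jb db) {I I' : ℕ}
    (hI : hb + n ≤ jb + I) (hr : db + r ≤ hb - 2) (he : ∀ i < I, db + i ≤ hb - 2)
    (hI' : ha + n ≤ ja + I') (hr' : da + r ≤ ha - 2) (he' : ∀ i < I', da + i ≤ ha - 2) (v : V) :
    ∀ᶠ N in atTop,
      ∑ i ∈ Finset.range I, ((-1 : ℂ) ^ i * cbinom r i) •
        f (d.Y b (ψ * xp i) (d.Y a (φ * xp (r - i)) v))
      - (-1 : ℂ) ^ r • ∑ i ∈ Finset.range I', ((-1 : ℂ) ^ i * cbinom r i) •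
        f (d.Y a (φ * xp i) (d.Y b (ψ * xp (r - i)) v))
      = -∑ i ∈ Finset.range N, f (d.Y (d.mode a (r + i) b) (hasse i φ * ψ) v) := by
  filter_upwards [contra_taylor hf hb' hψ hI hr he a v φ, contra_taylor hf ha' hφ hI' hr' he' b v ψ,
    d.borcherdsFor r a b v φ ψ] with N h1 h2 h3
  have hr2 : (-1 : ℂ) ^ r * (-1 : ℂ) ^ r = 1 := by
    rw [← mul_zpow]; norm_num
  have h4 := congrArg f h3
  rw [map_sum, map_sum] at h4
  simp only [iterTerm, commTerm] at h4
  rw [h4, h1, h2, Finset.smul_sum, ← Finset.sum_sub_distrib, ← Finset.sum_neg_distrib]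
  refine Finset.sum_congr rfl fun l _ => ?_
  rw [smul_smul, ← mul_assoc ((-1 : ℂ) ^ r) ((-1 : ℂ) ^ r), hr2, one_mul, map_smul, map_sub,
    map_smul]
  module

theorem contra_comp_apply_eq_zero {d : VOA V} {n : ℤ} {f : V →ₗ[ℂ] E} (hf : f ∈ d.contra E n)
    {ha hb : ℤ} {a b : V} (ha' : a ∈ d.grading ha) (hb' : b ∈ d.grading hb) {j k : ℤ} {φ ψ : LS}
    (hφ : φ ∈ testSpace j (ha - 2)) (hψ : ψ ∈ testSpace k (hb - 2))
    (hjk : ha + hb + n - 1 ≤ j + k) (v : V) : f (d.Y b ψ (d.Y a φ v)) = 0 := by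
  obtain ⟨s, hs⟩ : ∃ s : ℕ, hb + n - k ≤ s := ⟨(hb + n - k).toNat, by omega⟩
  induction s generalizing j k φ ψ with
  | zero => exact contra_apply_eq_zero hf hb' hψ (by push_cast at hs; omega) le_rfl _
  | succ s ih =>
    set I : ℕ := (hb + n - k).toNat with hI
    set M : ℕ := (ha + n - j).toNat with hM
    obtain ⟨e, he, he'⟩ := exists_approx_one I I
    have hψe := mul_mem_testSpace hψ he
    have h0 : f (d.Y b (ψ * (1 - e)) (d.Y a φ v)) = 0 :=
      contra_apply_eq_zero hf hb' (mul_mem_testSpace hψ he') (by omega) (by omega) _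
    rw [mul_sub, mul_one, map_sub, LinearMap.sub_apply, map_sub, sub_eq_zero] at h0
    rw [h0]
    have hφM := mul_mem_testSpace hφ (xp_mem_testSpace M)
    obtain ⟨N, hN⟩ := (contra_borcherds hf ha' hb' hφM hψe (r := -M) (I := I + 1) (I' := 0)
      (by push_cast; omega) (by omega) (fun i hi => by omega) (by push_cast; omega) (by omega)
      (fun i hi => by omega) v).exists
    rw [Finset.range_zero, Finset.sum_empty, smul_zero, sub_zero, Finset.sum_range_succ',
      Finset.sum_eq_zero, zero_add, Finset.sum_eq_zero, neg_zero] at hN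
    · simpa [cbinom_zero_right, xp_zero, mul_assoc, xp_mul_neg] using hN
    · intro i _
      refine contra_apply_eq_zero hf (d.grading_mode ha hb (-M + i) a b ha' hb')
        (mul_mem_testSpace (hasse_mem_testSpace hφM i) hψe) (by omega) (by omega) v
    · intro i _
      have hx : φ * xp M * xp (-(M : ℤ) - ((i + 1 : ℕ) : ℤ)) = φ * xp (-((i + 1 : ℕ) : ℤ)) := by
        rw [mul_assoc, ← xp_add]; congr 2; ring
      have h1 := mul_mem_testSpace hφ (xp_mem_testSpace (-((i + 1 : ℕ) : ℤ)))
      have h2 := mul_mem_testSpace hψe (xp_mem_testSpace ((i + 1 : ℕ) : ℤ))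
      by_cases hi : i + 1 ≤ I
      · rw [hx, ih (testSpace_mono_right (by omega) h1) (testSpace_mono_right (by omega) h2)
          (by omega) (by push_cast at hs ⊢; omega), smul_zero]
      · exact absurd (Finset.mem_range.1 ‹_›) (by omega)

theorem contra_comp_mem {d : VOA V} {n : ℤ} {f : V →ₗ[ℂ] E} (hf : f ∈ d.contra E n)
    {h k : ℤ} {b : V} (hb : b ∈ d.grading h) {ψ : LS} (hψ : ψ ∈ testSpace k (h - 2)) :
    f ∘ₗ d.Y b ψ ∈ d.contra E (h + n - k - 1) := fun ha a ha' φ hφ v =>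
  contra_comp_apply_eq_zero hf ha' hb hφ hψ (by omega) v

end VOA

namespace VOA

variable {E : Type} [AddCommGroup E] [Module ℂ E]

/-- A test function approximating `x ^ m` to order `h + n` at `x = 0` and growing at most like
`x ^ (h - 2)` at infinity. -/
noncomputable def testFn (h n m : ℤ) : LS := (exists_approx_xp m (h + n) (h - 2)).choose

theorem testFn_mem (h n m : ℤ) : testFn h n m ∈ testSpace m (h - 2) :=
  (exists_approx_xp m (h + n) (h - 2)).choose_spec.1

theorem xp_sub_testFn_mem (h n m : ℤ) : xp m - testFn h n m ∈ testSpace (h + n) m :=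
  (exists_approx_xp m (h + n) (h - 2)).choose_spec.2

theorem contra_apply_eq {d : VOA V} {n : ℤ} {f : V →ₗ[ℂ] E} (hf : f ∈ d.contra E n) {h : ℤ} {u : V}
    (hu : u ∈ d.grading h) {m c c' e e' : ℤ} {s : ℂ} {φ : LS} (hφ : φ ∈ testSpace c e)
    (he : e ≤ h - 2) (hφ' : s • xp m - φ ∈ testSpace c' e') (hc' : h + n ≤ c') (v : V) :
    f (d.Y u φ v) = s • f (d.Y u (testFn h n m) v) := by
  have h1 : φ - s • testFn h n m ∈ testSpace (min c m) (h - 2) :=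
    Submodule.sub_mem _ (testSpace_mono (min_le_left _ _) he hφ)
      (Submodule.smul_mem _ _ (testSpace_anti_left (min_le_right _ _) (testFn_mem h n m)))
  have h2 : φ - s • testFn h n m ∈ testSpace (h + n) (max m e') := by
    have : φ - s • testFn h n m = s • (xp m - testFn h n m) - (s • xp m - φ) := by module
    rw [this]
    exact Submodule.sub_mem _ (Submodule.smul_mem _ _
      (testSpace_mono_right (le_max_left _ _) (xp_sub_testFn_mem h n m)))
      (testSpace_mono hc' (le_max_right _ _) hφ')
  have h3 := hf h u hu _ (testSpace_inter h1 h2) v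
  rwa [map_sub, LinearMap.sub_apply, map_sub, sub_eq_zero, map_smul, LinearMap.smul_apply,
    map_smul] at h3

theorem Y_vacuum (d : VOA V) (φ : LS) (v : V) : d.Y d.vacuum φ v = φ.coeff (-1) • v := by
  rw [Y_apply, finsum_eq_single _ (-1) fun j hj => by rw [d.vacuum_mode, if_neg hj, smul_zero],
    d.vacuum_mode, if_pos rfl]

theorem contra_eq_zero_of_neg {d : VOA V} {n : ℤ} (hn : n < 0) {f : V →ₗ[ℂ] E}
    (hf : f ∈ d.contra E n) : f = 0 := by
  ext v
  have h := contra_apply_eq_zero hf d.vacuum_mem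
    (mul_mem_testSpace (xp_mem_testSpace n) (zp_mem_testSpace (-1))) (by omega) (by omega) v
  have hc := coeff_xp_nat n 0
  rw [Nat.cast_zero, cbinom_zero_right] at hc
  rw [Y_vacuum, coeff_mul_zp, sub_self, hc, one_smul] at h
  exact h

theorem coeff_testFn_zero (n m : ℤ) (hn : 0 ≤ n) :
    (testFn 0 n m).coeff (-1) = if m = -1 then -1 else 0 := by
  have h1 := testFn_mem 0 n m
  have h2 := testSpace_anti_left (by omega : (0 : ℤ) ≤ 0 + n) (xp_sub_testFn_mem 0 n m)
  have hc : testFn 0 n m = xp m - (xp m - testFn 0 n m) := by rw [sub_sub_cancel]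
  rw [mem_testSpace, neg_zero, xp_zero] at h2
  simp only [one_mul, sub_zero] at h2
  split_ifs with hm
  · subst hm
    have h3 := h1 0 (by omega)
    rw [hc, neg_neg, mul_sub, xp_mul_neg, LS.coeff_sub, coeff_xp_one_mul, h2 0 (by omega),
      ← zp_zero, coeff_zp, if_pos rfl, zero_add, sub_eq_zero, zero_sub] at h3
    rw [hc, LS.coeff_sub, ← h3, coeff_xp_neg _ (by omega), zero_sub]
  · rcases lt_or_ge m 0 with h | h
    · rw [hc, LS.coeff_sub, h2 _ (by omega), coeff_xp_neg _ (by omega), sub_zero]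
    · have h3 := testSpace_anti_left h h1
      rw [mem_testSpace, neg_zero, xp_zero] at h3
      have h4 := h3 (-1) (by omega)
      rwa [one_mul] at h4

/-- The mode `u_m` of a vector regarded as having weight `h`, acting on functionals of
degree `n`. -/
noncomputable def contraMode (d : VOA V) (E : Type) [AddCommGroup E] [Module ℂ E] (h n m : ℤ) :
    V →ₗ[ℂ] (V →ₗ[ℂ] E) →ₗ[ℂ] (V →ₗ[ℂ] E) :=
  -LinearMap.mk₂ ℂ (fun u f => f ∘ₗ d.Y u (testFn h n m))
    (fun u u' f => by ext; simp) (fun c u f => by ext; simp) (fun u f f' => by ext; simp)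
    (fun c u f => by ext; simp)

theorem contraMode_apply (d : VOA V) (h n m : ℤ) (u : V) (f : V →ₗ[ℂ] E) (v : V) :
    d.contraMode E h n m u f v = -f (d.Y u (testFn h n m) v) := by
  simp [contraMode]

theorem contraMode_mem {d : VOA V} {n h : ℤ} (m : ℤ) {u : V} (hu : u ∈ d.grading h)
    {f : V →ₗ[ℂ] E} (hf : f ∈ d.contra E n) :
    d.contraMode E h n m u f ∈ d.contra E (h + n - m - 1) :=
  neg_mem (contra_comp_mem hf hu (testFn_mem h n m))

theorem contraMode_eq_zero {d : VOA V} {n h m : ℤ} (hm : h + n ≤ m) {u : V} (hu : u ∈ d.grading h)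
    {f : V →ₗ[ℂ] E} (hf : f ∈ d.contra E n) : d.contraMode E h n m u f = 0 := by
  ext v
  rw [contraMode_apply, contra_apply_eq_zero hf hu (testFn_mem h n m) hm le_rfl, neg_zero]
  rfl

theorem contraMode_vacuum {d : VOA V} {n : ℤ} (m : ℤ) {f : V →ₗ[ℂ] E} (hf : f ∈ d.contra E n) :
    d.contraMode E 0 n m d.vacuum f = if m = -1 then f else 0 := by
  rcases lt_or_ge n 0 with h | h
  · simp [contra_eq_zero_of_neg h hf]
  · ext v
    rw [contraMode_apply, Y_vacuum, coeff_testFn_zero n m h]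
    split_ifs <;> simp

theorem contraMode_apply_eq {d : VOA V} {n : ℤ} {f : V →ₗ[ℂ] E} (hf : f ∈ d.contra E n) {h : ℤ}
    {u : V} (hu : u ∈ d.grading h) {m c c' e e' : ℤ} {s : ℂ} {φ : LS} (hφ : φ ∈ testSpace c e)
    (he : e ≤ h - 2) (hφ' : s • xp m - φ ∈ testSpace c' e') (hc' : h + n ≤ c') (v : V) :
    f (d.Y u φ v) = -(s • d.contraMode E h n m u f v) := by
  rw [contra_apply_eq hf hu hφ he hφ' hc', contraMode_apply, smul_neg, neg_neg]

set_option maxHeartbeats 1000000 in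
theorem contraMode_borcherds {d : VOA V} {n : ℤ} {f : V →ₗ[ℂ] E} (hf : f ∈ d.contra E n)
    {ha hb : ℤ} {a b : V} (ha' : a ∈ d.grading ha) (hb' : b ∈ d.grading hb) (p q r : ℤ) :
    ∀ᶠ I : ℕ in atTop, ∑ i ∈ Finset.range I,
      cbinom p i • d.contraMode E (ha + hb - (r + i) - 1) n (p + q - i) (d.mode a (r + i) b) f
    = ∑ i ∈ Finset.range I, ((-1 : ℂ) ^ i * cbinom r i) •
      (d.contraMode E ha (hb + n - (q + i) - 1) (p + r - i) a (d.contraMode E hb n (q + i) b f)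
        - (-1 : ℂ) ^ r • d.contraMode E hb (ha + n - (p + i) - 1) (q + r - i) b
          (d.contraMode E ha n (p + i) a f)) := by
  obtain ⟨N₁, hN₁⟩ := eventually_atTop.1 (d.eventually_mode_eq_zero a b r)
  filter_upwards [eventually_ge_atTop N₁, eventually_ge_atTop (hb + n - q).toNat,
    eventually_ge_atTop (ha + n - p).toNat] with I hI₁ hI₂ hI₃
  set K : ℕ := ha.natAbs + hb.natAbs + n.natAbs + p.natAbs + q.natAbs + r.natAbs + I + 5 with hK
  obtain ⟨e, he, he'⟩ := exists_approx_one K K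
  have hm (s : ℤ) := mul_mem_testSpace (xp_mem_testSpace s) he
  have hs (s : ℤ) : (1 : ℂ) • xp s - xp s * e ∈ testSpace (s + K) (s + 0) := by
    have : (1 : ℂ) • xp s - xp s * e = xp s * (1 - e) := by rw [mul_sub, mul_one, one_smul]
    rw [this]
    exact mul_mem_testSpace (xp_mem_testSpace s) he'
  have hmul (s t : ℤ) : xp s * e * xp t = xp (s + t) * e := by rw [xp_add]; ring
  have comm {ha hb : ℤ} {a b : V} (ha' : a ∈ d.grading ha) (hb' : b ∈ d.grading hb) (p q : ℤ)
      (hKa : ha.natAbs + hb.natAbs + n.natAbs + p.natAbs + q.natAbs + r.natAbs + I + 5 ≤ K)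
      (i : ℕ) (hi : i < I) (v : V) :
      f (d.Y b (xp q * e * xp i) (d.Y a (xp p * e * xp (r - i)) v))
      = d.contraMode E ha (hb + n - (q + i) - 1) (p + r - i) a
          (d.contraMode E hb n (q + i) b f) v := by
    rw [hmul, hmul, contraMode_apply_eq hf hb' (hm (q + i)) (by omega) (hs (q + i)) (by omega),
      contraMode_apply_eq (contraMode_mem _ hb' hf) ha' (hm (p + (r - i))) (by omega)
      (hs (p + (r - i))) (by omega)]
    simp [add_sub_assoc]
  have iter (i : ℕ) (hi : i < I) (v : V) :
      f (d.Y (d.mode a (r + i) b) (hasse i (xp p * e) * (xp q * e)) v)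
      = -(cbinom p i • d.contraMode E (ha + hb - (r + i) - 1) n (p + q - i)
          (d.mode a (r + i) b) f v) := by
    have h1 := hasse_mem_testSpace (hm p) i
    have h2 := hasse_mem_testSpace (hs p) i
    rw [one_smul, map_sub] at h2
    have h3 := hs q
    rw [one_smul] at h3
    have h4 : cbinom p i • xp (p + q - i) - hasse i (xp p * e) * (xp q * e)
        = (hasse i (xp p) - hasse i (xp p * e)) * xp q
          + hasse i (xp p * e) * (xp q - xp q * e) := by
      have : cbinom p i • xp (p + q - i) = hasse i (xp p) * xp q := by
        rw [hasse_xp, smul_mul_assoc, ← xp_add, sub_add_eq_add_sub]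
      rw [this]; ring
    refine contraMode_apply_eq hf (d.grading_mode ha hb (r + i) a b ha' hb')
      (mul_mem_testSpace h1 (hm q)) (by omega) (c' := p + q + K - i) (e' := p + q - i) ?_
      (by omega) v
    rw [h4]
    exact Submodule.add_mem _
      (testSpace_mono (by omega) (by omega) (mul_mem_testSpace h2 (xp_mem_testSpace q)))
      (testSpace_mono (by omega) (by omega) (mul_mem_testSpace h1 h3))
  ext v
  obtain ⟨N, hN, hIN⟩ := ((contra_borcherds hf ha' hb' (hm p) (hm q) (r := r) (I := I) (I' := I)
    (by omega) (by omega) (fun i hi => by omega) (by omega) (by omega) (fun i hi => by omega)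
    v).and (eventually_ge_atTop I)).exists
  rw [← Finset.sum_subset (Finset.range_subset_range.2 hIN) fun i _ hi => ?_,
    ← Finset.sum_neg_distrib, Finset.smul_sum, ← Finset.sum_sub_distrib] at hN
  · rw [LinearMap.sum_apply, LinearMap.sum_apply]
    refine (Finset.sum_congr rfl fun i hi => ?_).trans (hN.symm.trans
      (Finset.sum_congr rfl fun i hi => ?_))
    · rw [iter i (Finset.mem_range.1 hi), neg_neg, LinearMap.smul_apply]
    · rw [comm ha' hb' p q (by omega) i (Finset.mem_range.1 hi),
        comm hb' ha' q p (by omega) i (Finset.mem_range.1 hi), LinearMap.smul_apply,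
        LinearMap.sub_apply, LinearMap.smul_apply]
      module
  · rw [Finset.mem_range] at hi
    rw [hN₁ i (by omega), map_zero, LinearMap.zero_apply, LinearMap.zero_apply, map_zero]

end VOA

namespace VOA

theorem homogeneous_induction (d : VOA V) {p : V → Prop} (hom : ∀ h, ∀ u ∈ d.grading h, p u)
    (add : ∀ u v, p u → p v → p (u + v)) (u : V) : p u := by
  have hu : u ∈ ⨆ h, d.grading h := by
    rw [DirectSum.IsInternal.submodule_iSup_eq_top d.internal]
    trivial
  exact Submodule.iSup_induction _ (motive := p) hu (fun h u hu => hom h u hu)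
    (hom 0 0 (Submodule.zero_mem _)) add

/-- The linear map on `V` that agrees with `X h` on vectors of weight `h`. -/
noncomputable def lift (d : VOA V) {W : Type*} [AddCommMonoid W] [Module ℂ W]
    (X : ℤ → V →ₗ[ℂ] W) : V →ₗ[ℂ] W :=
  DirectSum.toModule ℂ ℤ W (fun h => X h ∘ₗ (d.grading h).subtype) ∘ₗ
    (LinearEquiv.ofBijective (DirectSum.coeLinearMap d.grading) d.internal).symm.toLinearMap

theorem decompose_coe (d : VOA V) {h : ℤ} {u : V} (hu : u ∈ d.grading h) :
    (LinearEquiv.ofBijective (DirectSum.coeLinearMap d.grading) d.internal).symm u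
      = DirectSum.lof ℂ ℤ (fun m => d.grading m) h ⟨u, hu⟩ := by
  rw [LinearEquiv.symm_apply_eq, LinearEquiv.ofBijective_apply, DirectSum.coeLinearMap_lof]

theorem lift_apply (d : VOA V) {W : Type*} [AddCommMonoid W] [Module ℂ W]
    (X : ℤ → V →ₗ[ℂ] W) {h : ℤ} {u : V} (hu : u ∈ d.grading h) : d.lift X u = X h u := by
  rw [lift, LinearMap.comp_apply, LinearEquiv.coe_coe, decompose_coe d hu, DirectSum.toModule_lof]
  rfl

theorem proj_apply (d : VOA V) {h : ℤ} {u : V} (hu : u ∈ d.grading h) (n : ℤ) :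
    d.proj n u = if h = n then u else 0 := by
  rw [proj, LinearMap.comp_apply, LinearMap.comp_apply, LinearEquiv.coe_coe, decompose_coe d hu]
  split_ifs with hn
  · subst hn
    rw [DirectSum.component.lof_self]
    rfl
  · rw [DirectSum.component.of, dif_neg hn, map_zero]

theorem eventually_borcherds_of_homogeneous (d : VOA V) {N : Type*} [AddCommGroup N] [Module ℂ N]
    (A : ℤ → V →ₗ[ℂ] Module.End ℂ N) (p q r : ℤ) (w : N)
    (hom : ∀ ha, ∀ a ∈ d.grading ha, ∀ hb, ∀ b ∈ d.grading hb, ∀ᶠ I : ℕ in atTop,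
      ∑ i ∈ Finset.range I, cbinom p i • A (p + q - i) (d.mode a (r + i) b) w
      = ∑ i ∈ Finset.range I, ((-1 : ℂ) ^ i * cbinom r i) •
        (A (p + r - i) a (A (q + i) b w) - (-1 : ℂ) ^ r • A (q + r - i) b (A (p + i) a w)))
    (a b : V) : ∀ᶠ I : ℕ in atTop,
      ∑ i ∈ Finset.range I, cbinom p i • A (p + q - i) (d.mode a (r + i) b) w
      = ∑ i ∈ Finset.range I, ((-1 : ℂ) ^ i * cbinom r i) •
        (A (p + r - i) a (A (q + i) b w) - (-1 : ℂ) ^ r • A (q + r - i) b (A (p + i) a w)) := by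
  induction a using d.homogeneous_induction with
  | hom ha a ha' =>
    induction b using d.homogeneous_induction with
    | hom hb b hb' => exact hom ha a ha' hb b hb'
    | add b b' h h' =>
      filter_upwards [h, h'] with I h h'
      simp only [map_add, LinearMap.add_apply, smul_add, smul_sub, Finset.sum_add_distrib,
        Finset.sum_sub_distrib] at h h' ⊢
      rw [h, h']
      abel
  | add a a' h h' =>
    filter_upwards [h, h'] with I h h'
    simp only [map_add, LinearMap.add_apply, smul_add, smul_sub, Finset.sum_add_distrib,
      Finset.sum_sub_distrib, d.mode_add] at h h' ⊢
    rw [h, h']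
    abel

/-- Eventual equality of the truncated Borcherds sums gives the Borcherds identity. -/
theorem borcherds_of_eventually (d : VOA V) {N : Type*} [AddCommGroup N] [Module ℂ N]
    (A : ℤ → V →ₗ[ℂ] Module.End ℂ N) (p q r : ℤ) (w : N) (a b : V)
    (hA : ∀ u : V, ∃ N : ℤ, ∀ n : ℤ, N ≤ n → A n u w = 0)
    (h : ∀ᶠ I : ℕ in atTop,
      ∑ i ∈ Finset.range I, cbinom p i • A (p + q - i) (d.mode a (r + i) b) w
      = ∑ i ∈ Finset.range I, ((-1 : ℂ) ^ i * cbinom r i) •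
        (A (p + r - i) a (A (q + i) b w) - (-1 : ℂ) ^ r • A (q + r - i) b (A (p + i) a w))) :
    (∑ᶠ i : ℕ, cbinom p i • A (p + q - i) (d.mode a (r + i) b) w) =
    ∑ᶠ i : ℕ, ((-1 : ℂ) ^ i * cbinom r i) •
        (A (p + r - i) a (A (q + i) b w) - (-1 : ℂ) ^ r • A (q + r - i) b (A (p + i) a w)) := by
  have hev (u : V) (s : ℤ) : ∀ᶠ i : ℕ in atTop, A (s + i) u w = 0 := by
    obtain ⟨K, hK⟩ := hA u
    filter_upwards [eventually_ge_atTop (K - s).toNat] with i hi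
    exact hK _ (by omega)
  have h1 := eventually_sum_range_eq_finsum
    (f := fun i : ℕ => cbinom p i • A (p + q - i) (d.mode a (r + i) b) w) (by
      filter_upwards [d.eventually_mode_eq_zero a b r] with i hi
      rw [hi, map_zero, LinearMap.zero_apply, smul_zero])
  have h2 := eventually_sum_range_eq_finsum
    (f := fun i : ℕ => ((-1 : ℂ) ^ i * cbinom r i) •
      (A (p + r - i) a (A (q + i) b w) - (-1 : ℂ) ^ r • A (q + r - i) b (A (p + i) a w))) (by
      filter_upwards [hev a p, hev b q] with i hi hi'
      rw [hi, hi', map_zero, map_zero, smul_zero, sub_zero, smul_zero])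
  obtain ⟨I, h, h1, h2⟩ := (h.and (h1.and h2)).exists
  rw [← h1, ← h2, h]

variable {E : Type} [AddCommGroup E] [Module ℂ E]

/-- The mode `u_m` of a vector regarded as having weight `h`, acting on finitely supported
families of functionals. -/
noncomputable def familyMode (d : VOA V) (E : Type) [AddCommGroup E] [Module ℂ E] (m h : ℤ) :
    V →ₗ[ℂ] Module.End ℂ (ℤ →₀ (V →ₗ[ℂ] E)) where
  toFun u := Finsupp.lsum ℂ fun n => Finsupp.lsingle (h + n - m - 1) ∘ₗ d.contraMode E h n m u
  map_add' u v := by ext n f : 2; simp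
  map_smul' c u := by ext n f : 2; simp

/-- The mode `u_m` acting on finitely supported families of functionals. -/
noncomputable def familyAct (d : VOA V) (E : Type) [AddCommGroup E] [Module ℂ E] (m : ℤ) :
    V →ₗ[ℂ] Module.End ℂ (ℤ →₀ (V →ₗ[ℂ] E)) :=
  d.lift (d.familyMode E m)

theorem familyAct_single (d : VOA V) {h : ℤ} {u : V} (hu : u ∈ d.grading h) (m n : ℤ)
    (f : V →ₗ[ℂ] E) : d.familyAct E m u (Finsupp.single n f)
      = Finsupp.single (h + n - m - 1) (d.contraMode E h n m u f) := by
  rw [familyAct, lift_apply d _ hu]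
  simp [familyMode]

/-- The finitely supported families whose component at `n` has degree `n`. -/
def family (d : VOA V) (E : Type) [AddCommGroup E] [Module ℂ E] :
    Submodule ℂ (ℤ →₀ (V →ₗ[ℂ] E)) where
  carrier := {g | ∀ n, g n ∈ d.contra E n}
  add_mem' hf hg n := add_mem (hf n) (hg n)
  zero_mem' _ := zero_mem _
  smul_mem' c _ hg n := Submodule.smul_mem _ c (hg n)

theorem single_mem_family {d : VOA V} {n : ℤ} {f : V →ₗ[ℂ] E} (hf : f ∈ d.contra E n) :
    Finsupp.single n f ∈ d.family E := by
  intro k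
  rw [Finsupp.single_apply]
  split_ifs with hk
  · exact hk ▸ hf
  · exact zero_mem _

theorem family_induction (d : VOA V) {p : (ℤ →₀ (V →ₗ[ℂ] E)) → Prop}
    (single : ∀ n, ∀ f ∈ d.contra E n, p (Finsupp.single n f))
    (add : ∀ g g', p g → p g' → p (g + g')) {g : ℤ →₀ (V →ₗ[ℂ] E)} (hg : g ∈ d.family E) :
    p g := by
  rw [← g.sum_single]
  exact Finset.sum_induction _ p add (by simpa using single 0 0 (zero_mem _))
    fun n _ => single n _ (hg n)

theorem familyAct_mem (d : VOA V) (m : ℤ) (u : V) {g : ℤ →₀ (V →ₗ[ℂ] E)} (hg : g ∈ d.family E) :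
    d.familyAct E m u g ∈ d.family E := by
  induction u using d.homogeneous_induction with
  | hom h u hu =>
    refine d.family_induction (p := fun g => d.familyAct E m u g ∈ d.family E) (fun n f hf => ?_)
      (fun g g' h h' => by rw [map_add]; exact add_mem h h') hg
    rw [familyAct_single d hu]
    exact single_mem_family (contraMode_mem m hu hf)
  | add u v h h' => rw [map_add]; exact add_mem h h'

theorem familyAct_truncation (d : VOA V) (u : V) {g : ℤ →₀ (V →ₗ[ℂ] E)} (hg : g ∈ d.family E) :
    ∃ N : ℤ, ∀ m : ℤ, N ≤ m → d.familyAct E m u g = 0 := by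
  induction u using d.homogeneous_induction with
  | hom h u hu =>
    refine d.family_induction (p := fun g => ∃ N : ℤ, ∀ m : ℤ, N ≤ m → d.familyAct E m u g = 0)
      (fun n f hf => ⟨h + n, fun m hm => ?_⟩)
      (fun g g' ⟨N, h⟩ ⟨N', h'⟩ => ⟨max N N', fun m hm => ?_⟩)
      hg
    · rw [familyAct_single d hu, contraMode_eq_zero hm hu hf, Finsupp.single_zero]
    · rw [map_add, h m (by omega), h' m (by omega), add_zero]
  | add u v h h' =>
    obtain ⟨N, h⟩ := h
    obtain ⟨N', h'⟩ := h'
    refine ⟨max N N', fun m hm => ?_⟩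
    rw [map_add, LinearMap.add_apply, h m (by omega), h' m (by omega), add_zero]

theorem familyAct_vacuum (d : VOA V) (m : ℤ) {g : ℤ →₀ (V →ₗ[ℂ] E)} (hg : g ∈ d.family E) :
    d.familyAct E m d.vacuum g = if m = -1 then g else 0 := by
  refine d.family_induction (p := fun g => d.familyAct E m d.vacuum g = if m = -1 then g else 0)
    (fun n f hf => ?_) (fun g g' h h' => ?_) hg
  · rw [familyAct_single d d.vacuum_mem, contraMode_vacuum m hf]
    split_ifs with hm
    · congr 1; omega
    · exact Finsupp.single_zero _
  · rw [map_add, h, h']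
    split_ifs <;> simp

theorem familyAct_borcherds (d : VOA V) (p q r : ℤ) (a b : V) {g : ℤ →₀ (V →ₗ[ℂ] E)}
    (hg : g ∈ d.family E) : ∀ᶠ I : ℕ in atTop,
      ∑ i ∈ Finset.range I, cbinom p i • d.familyAct E (p + q - i) (d.mode a (r + i) b) g
      = ∑ i ∈ Finset.range I, ((-1 : ℂ) ^ i * cbinom r i) •
        (d.familyAct E (p + r - i) a (d.familyAct E (q + i) b g)
          - (-1 : ℂ) ^ r • d.familyAct E (q + r - i) b (d.familyAct E (p + i) a g)) := by
  refine d.eventually_borcherds_of_homogeneous (d.familyAct E) p q r g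
    (fun ha a ha' hb b hb' => ?_) a b
  refine d.family_induction (p := fun g => ∀ᶠ I : ℕ in atTop, 
      ∑ i ∈ Finset.range I, cbinom p i • d.familyAct E (p + q - i) (d.mode a (r + i) b) g
      = ∑ i ∈ Finset.range I, ((-1 : ℂ) ^ i * cbinom r i) •
        (d.familyAct E (p + r - i) a (d.familyAct E (q + i) b g)
          - (-1 : ℂ) ^ r • d.familyAct E (q + r - i) b (d.familyAct E (p + i) a g)))
    (fun n f hf => ?_) (fun g g' h h' => ?_) hg
  · filter_upwards [contraMode_borcherds hf ha' hb' p q r] with I hI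
    have hI := congrArg (Finsupp.lsingle (R := ℂ) (ha + hb + n - p - q - r - 2)) hI
    rw [map_sum, map_sum] at hI
    refine (Finset.sum_congr rfl fun i _ => ?_).trans
      (hI.trans (Finset.sum_congr rfl fun i _ => ?_))
    · rw [familyAct_single d (d.grading_mode ha hb (r + i) a b ha' hb'), map_smul,
        Finsupp.lsingle_apply]
      congr 2
      ring
    · rw [familyAct_single d ha', familyAct_single d hb', familyAct_single d hb',
        familyAct_single d ha', map_smul, map_sub, map_smul, Finsupp.lsingle_apply,
        Finsupp.lsingle_apply,
        show ha + (hb + n - (q + i) - 1) - (p + r - i) - 1 = ha + hb + n - p - q - r - 2 by ring,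
        show hb + (ha + n - (p + i) - 1) - (q + r - i) - 1 = ha + hb + n - p - q - r - 2 by ring]
  · filter_upwards [h, h'] with I h h'
    simp only [map_add, smul_add, smul_sub, Finset.sum_add_distrib,
      Finset.sum_sub_distrib] at h h' ⊢
    rw [h, h']
    abel

end VOA

namespace VOA

/-- The underlying space of the admissible module of `E`-valued functionals. -/
def Family (d : VOA V) (E : Type) [AddCommGroup E] [Module ℂ E] : Type := d.family E

variable {E : Type} [AddCommGroup E] [Module ℂ E]

noncomputable instance (d : VOA V) : AddCommGroup (d.Family E) :=
  inferInstanceAs (AddCommGroup (d.family E))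

noncomputable instance (d : VOA V) : Module ℂ (d.Family E) :=
  inferInstanceAs (Module ℂ (d.family E))

namespace Family

/-- The inclusion of `Family` into all finitely supported families. -/
noncomputable def val (d : VOA V) (E : Type) [AddCommGroup E] [Module ℂ E] :
    d.Family E →ₗ[ℂ] (ℤ →₀ (V →ₗ[ℂ] E)) :=
  (d.family E).subtype

variable {d : VOA V}

theorem val_injective : Function.Injective (val d E) := Subtype.val_injective

theorem val_mem (g : d.Family E) : val d E g ∈ d.family E := g.2

/-- The element of `Family` concentrated in degree `n`. -/
noncomputable def single {n : ℤ} {f : V →ₗ[ℂ] E} (hf : f ∈ d.contra E n) : d.Family E :=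
  ⟨_, single_mem_family hf⟩

theorem val_single {n : ℤ} {f : V →ₗ[ℂ] E} (hf : f ∈ d.contra E n) :
    val d E (single hf) = Finsupp.single n f := rfl

/-- The restriction of `familyAct` to `Family`. -/
noncomputable def act (d : VOA V) (E : Type) [AddCommGroup E] [Module ℂ E] (m : ℤ) :
    V →ₗ[ℂ] Module.End ℂ (d.Family E) where
  toFun u := (d.familyAct E m u).restrict fun _ hg => d.familyAct_mem m u hg
  map_add' u v := by
    refine LinearMap.ext fun g => val_injective ?_
    exact congrArg (fun F : Module.End ℂ (ℤ →₀ (V →ₗ[ℂ] E)) => F g.1) (map_add _ u v)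
  map_smul' c u := by
    refine LinearMap.ext fun g => val_injective ?_
    exact congrArg (fun F : Module.End ℂ (ℤ →₀ (V →ₗ[ℂ] E)) => F g.1) (map_smul _ c u)

theorem val_act (m : ℤ) (u : V) (g : d.Family E) :
    val d E (act d E m u g) = d.familyAct E m u (val d E g) := rfl

theorem act_truncation (u : V) (g : d.Family E) :
    ∃ N : ℤ, ∀ m : ℤ, N ≤ m → act d E m u g = 0 := by
  obtain ⟨N, hN⟩ := d.familyAct_truncation u (val_mem g)
  refine ⟨N, fun m hm => val_injective ?_⟩
  rw [val_act, hN m hm, map_zero]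

/-- The homogeneous components of `Family`. -/
noncomputable def gr (d : VOA V) (E : Type) [AddCommGroup E] [Module ℂ E] (n : ℤ) :
    Submodule ℂ (d.Family E) :=
  (LinearMap.range (Finsupp.lsingle (R := ℂ) n)).comap (val d E)

theorem mem_gr {n : ℤ} {g : d.Family E} :
    g ∈ gr d E n ↔ ∃ f ∈ d.contra E n, Finsupp.single n f = val d E g := by
  constructor
  · rintro ⟨f, hf⟩
    refine ⟨f, ?_, hf⟩
    have h := val_mem g n
    rw [← hf] at h
    simpa using h
  · rintro ⟨f, -, hf⟩
    exact ⟨f, hf⟩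

theorem single_mem_gr {n : ℤ} {f : V →ₗ[ℂ] E} (hf : f ∈ d.contra E n) :
    single hf ∈ gr d E n :=
  mem_gr.2 ⟨f, hf, rfl⟩

theorem coeLinearMap_gr_apply (k : ℤ) (x : DirectSum ℤ fun n => gr d E n) :
    val d E (DirectSum.coeLinearMap (gr d E) x) k = val d E (x k) k := by
  induction x using DirectSum.induction_on with
  | zero => simp
  | of n g =>
    obtain ⟨f, -, hf⟩ := mem_gr.1 g.2
    rw [← DirectSum.lof_eq_of ℂ, DirectSum.coeLinearMap_lof]
    rcases eq_or_ne n k with rfl | hk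
    · rw [DirectSum.lof_apply]
    · rw [DirectSum.lof_eq_of, DirectSum.of_eq_of_ne _ _ _ hk.symm, ← hf,
        Finsupp.single_eq_of_ne hk.symm]
      simp
  | add x y hx hy => simp [hx, hy]

theorem gr_internal (d : VOA V) : Function.Bijective (DirectSum.coeLinearMap (gr d E)) := by
  constructor
  · refine (injective_iff_map_eq_zero (DirectSum.coeLinearMap (gr d E))).2 fun x hx => ?_
    ext1 k
    obtain ⟨f, -, hf⟩ := mem_gr.1 (x k).2
    have h := coeLinearMap_gr_apply k x
    rw [hx, ← hf, Finsupp.single_eq_same] at h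
    refine Subtype.ext (val_injective ?_)
    rw [← hf, ← h]
    simp
  · intro g
    have := d.family_induction (p := fun g => ∃ x : DirectSum ℤ fun n => gr d E n,
      val d E (DirectSum.coeLinearMap (gr d E) x) = g) (fun n f hf => ?_)
      (fun g g' ⟨x, hx⟩ ⟨y, hy⟩ => ⟨x + y, by rw [map_add, map_add, hx, hy]⟩) (val_mem g)
    · obtain ⟨x, hx⟩ := this
      exact ⟨x, val_injective hx⟩
    · refine ⟨DirectSum.lof ℂ ℤ (fun n => gr d E n) n ⟨single hf, single_mem_gr hf⟩, ?_⟩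
      rw [DirectSum.coeLinearMap_lof, val_single]

end Family

/-- The admissible module of `E`-valued functionals. -/
noncomputable def contraMod (d : VOA V) (E : Type) [AddCommGroup E] [Module ℂ E] :
    AdmMod d (d.Family E) where
  act u m := Family.act d E m u
  act_add u v n := map_add _ u v
  act_smul c u n := map_smul _ c u
  truncation := Family.act_truncation
  vacuum_act g m := by
    refine Family.val_injective ((d.familyAct_vacuum m (Family.val_mem g)).trans ?_)
    split_ifs
    · rfl
    · rw [map_zero]
  borcherds p q r u v w := by
    refine d.borcherds_of_eventually (Family.act d E) p q r w u v
      (fun u => Family.act_truncation u w) ?_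
    filter_upwards [d.familyAct_borcherds p q r u v (Family.val_mem w)] with I hI
    refine Family.val_injective ?_
    simpa only [map_sum, map_smul, map_sub, Family.val_act] using hI
  gr := Family.gr d E
  gr_internal := Family.gr_internal d
  gr_neg n hn := by
    refine eq_bot_iff.2 fun g hg => ?_
    obtain ⟨f, hf, h⟩ := Family.mem_gr.1 hg
    rw [contra_eq_zero_of_neg hn hf, Finsupp.single_zero] at h
    refine Family.val_injective ?_
    rw [← h, map_zero]
  gr_act h u hu m n g hg := by
    obtain ⟨f, hf, hfg⟩ := Family.mem_gr.1 hg
    refine Family.mem_gr.2 ⟨_, contraMode_mem m hu hf, ?_⟩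
    rw [Family.val_act, ← hfg, familyAct_single d hu]

end VOA

namespace VOA

theorem Y_xp_mul_zp (d : VOA V) (N k : ℤ) (u v : V) :
    d.Y u (xp N * zp k) v = ∑ᶠ i : ℕ, cbinom N i • d.mode u (k + i) v := by
  have h := eventually_sum_range_eq_finsum (f := fun i : ℕ => cbinom N i • d.mode u (k + i) v) (by
    filter_upwards [d.eventually_mode_eq_zero u v k] with i hi
    rw [hi, smul_zero])
  obtain ⟨I, h1, h2⟩ := (h.and (d.eventually_Y_mul_xp u v (zp k))).exists
  rw [mul_comm, h2, ← h1]
  simp only [zp_mul, Y_zp]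

theorem hres_eq (d : VOA V) (N k : ℤ) (u v : V) :
    d.hres N k u v = d.Y u (xp N * zp (-k)) v := by
  rw [Y_xp_mul_zp, hres]
  simp only [neg_add_eq_sub]

/-- The bilinear map underlying `VOA.bres`. -/
noncomputable def bresHom (d : VOA V) (m k : ℤ) : V →ₗ[ℂ] V →ₗ[ℂ] V :=
  d.lift fun h => d.Y.flip (xp (h + m) * zp (-k))

theorem bresHom_apply (d : VOA V) (m k : ℤ) {h : ℤ} {u : V} (hu : u ∈ d.grading h) :
    d.bresHom m k u = d.Y u (xp (h + m) * zp (-k)) := by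
  rw [bresHom, lift_apply d _ hu, LinearMap.flip_apply]

theorem finite_support_proj (d : VOA V) (u : V) : {n | d.proj n u ≠ 0}.Finite := by
  induction u using d.homogeneous_induction with
  | hom h u hu =>
    refine (Set.finite_singleton h).subset fun n hn => ?_
    rw [Set.mem_ofPred_eq, proj_apply d hu] at hn
    by_contra hne
    exact hn (if_neg (Ne.symm hne))
  | add u v hu hv =>
    refine (hu.union hv).subset fun n hn => ?_
    rw [Set.mem_union, Set.mem_ofPred_eq, Set.mem_ofPred_eq]
    by_contra! h
    exact hn (by rw [map_add, h.1, h.2, add_zero])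

theorem bres_eq (d : VOA V) (m k : ℤ) (u v : V) : d.bres m k u v = d.bresHom m k u v := by
  have hfin (u : V) : (Function.support fun n : ℤ =>
      d.Y (d.proj n u) (xp (n + m) * zp (-k)) v).Finite :=
    (d.finite_support_proj u).subset fun n hn h => hn (by
      beta_reduce
      rw [h, map_zero]
      rfl)
  simp only [bres, hres_eq]
  induction u using d.homogeneous_induction with
  | hom h u hu =>
    rw [finsum_eq_single _ h fun n hn => by
      rw [proj_apply d hu, if_neg hn.symm, map_zero]; rfl, proj_apply d hu, if_pos rfl,
      bresHom_apply d m k hu]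
  | add u u' h h' =>
    simp only [map_add, LinearMap.add_apply]
    rw [finsum_add_distrib (hfin u) (hfin u'), h, h']

theorem Y_mode_conformal_zero (d : VOA V) (u v : V) (φ : LS) :
    d.Y (d.mode d.conformal 0 u) φ v = -d.Y u (hasse 1 φ) v := by
  rw [Y_apply, Y_apply, ← finsum_neg_distrib]
  refine (finsum_comp_equiv (Equiv.addRight (1 : ℤ))).symm.trans (finsum_congr fun k => ?_)
  rw [Equiv.coe_addRight, d.Lneg1_deriv, coeff_hasse, cbinom_one_right, Nat.cast_one,
    LinearMap.smul_apply, add_sub_cancel_right]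
  module

theorem circ_mem_Ozhu (d : VOA V) (u v : V) : d.bresHom 0 2 u v ∈ d.Ozhu :=
  Submodule.subset_span ⟨u, v, (d.bres_eq 0 2 u v).symm⟩

theorem Y_xp_mul_zp_mem_Ozhu (d : VOA V) (k : ℕ) {h : ℤ} {u : V} (hu : u ∈ d.grading h) (v : V) :
    d.Y u (xp h * zp (-2 - k)) v ∈ d.Ozhu := by
  induction k generalizing h u with
  | zero =>
    have := d.circ_mem_Ozhu u v
    rwa [bresHom_apply d 0 2 hu, add_zero] at this
  | succ k ih =>
    have hL : d.mode d.conformal 0 u ∈ d.grading (h + 1) := by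
      have := d.grading_mode 2 h 0 _ u d.conformal_mem hu
      rwa [show (2 : ℤ) + h - 0 - 1 = h + 1 by ring] at this
    have h1 := ih hL
    have hx : xp (h + 1) * zp (-3 - k) = xp h * zp (-2 - k) + xp h * zp (-3 - k) := by
      rw [xp_add, xp_one, mul_assoc, add_mul, one_mul, zp_mul, mul_add, add_comm,
        show (1 : ℤ) + (-3 - k) = -2 - k by ring]
    have h2 : hasse 1 (xp (h + 1) * zp (-2 - k))
        = ((h : ℂ) - 1 - k) • (xp h * zp (-2 - k))
          - ((k : ℂ) + 2) • (xp h * zp (-2 - (k + 1 : ℕ))) := by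
      rw [hasse_one_xp_mul, hasse_zp, cbinom_one_right, mul_smul_comm, add_sub_cancel_right,
        Nat.cast_one, show (-2 - (k : ℤ)) - 1 = -3 - k by ring, hx,
        show (-2 - ((k + 1 : ℕ) : ℤ)) = -3 - k by push_cast; ring]
      push_cast
      module
    rw [Y_mode_conformal_zero, h2, neg_mem_iff, map_sub, map_smul, map_smul, LinearMap.sub_apply,
      LinearMap.smul_apply, LinearMap.smul_apply] at h1
    have h3 := (Submodule.sub_mem_iff_right _ (Submodule.smul_mem _ _ (ih hu))).1 h1
    exact (Submodule.smul_mem_iff _ (by norm_cast)).1 h3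

theorem Y_mem_Ozhu (d : VOA V) {h : ℤ} {u : V} (hu : u ∈ d.grading h) {φ : LS}
    (hφ : φ ∈ testSpace h (h - 2)) (v : V) : d.Y u φ v ∈ d.Ozhu := by
  obtain ⟨ρ, rfl⟩ := exists_eq_xp_mul h φ
  rw [xp_mul_mem_testSpace, sub_sub_cancel_left] at hφ
  obtain ⟨B, hB⟩ := ρ.exists_order
  have key (n : ℕ) : ∀ ρ : LS, (∀ k, -2 < k → ρ.coeff k = 0) → (∀ k < -1 - (n : ℤ), ρ.coeff k = 0) →
      d.Y u (xp h * ρ) v ∈ d.Ozhu := by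
    induction n with
    | zero =>
      intro ρ h1 h2
      have : ρ = 0 := LS.ext fun k => by
        rcases lt_or_ge (-2) k with hk | hk
        · rw [h1 k hk, LS.coeff_zero]
        · rw [h2 k (by omega), LS.coeff_zero]
      rw [this, mul_zero, map_zero]
      exact zero_mem _
    | succ n ih =>
      intro ρ h1 h2
      have e : xp h * ρ = xp h * (ρ - ρ.coeff (-2 - n) • zp (-2 - n))
          + ρ.coeff (-2 - n) • (xp h * zp (-2 - n)) := by
        rw [mul_sub, mul_smul_comm, sub_add_cancel]
      rw [e, map_add, map_smul]
      refine add_mem (ih _ (fun k hk => ?_) fun k hk => ?_)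
        (Submodule.smul_mem _ _ (d.Y_xp_mul_zp_mem_Ozhu n hu v))
      · rw [LS.coeff_sub, LS.coeff_smul, coeff_zp, h1 k hk, if_neg (by omega), mul_zero, sub_zero]
      · rw [LS.coeff_sub, LS.coeff_smul, coeff_zp]
        split_ifs with hk'
        · rw [hk', mul_one, sub_self]
        · rw [h2 k (by push_cast; omega), mul_zero, sub_zero]
  exact key (-B).toNat ρ hφ fun k hk => hB k (by omega)

/-- The quotient map `V → V / O(V)` is a functional of degree `0`. -/
theorem mkQ_mem_contra (d : VOA V) : d.Ozhu.mkQ ∈ d.contra (V ⧸ d.Ozhu) 0 := by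
  intro h u hu φ hφ v
  rw [add_zero] at hφ
  rw [Submodule.mkQ_apply, Submodule.Quotient.mk_eq_zero]
  exact d.Y_mem_Ozhu hu hφ v

theorem contraMode_mkQ (d : VOA V) {h : ℤ} {u : V} (hu : u ∈ d.grading h) :
    d.contraMode (V ⧸ d.Ozhu) h 0 (h - 1) u d.Ozhu.mkQ d.vacuum = d.Ozhu.mkQ u := by
  have h1 : (-(xp (h - 1) * zp (-1))) ∈ testSpace (h - 1 + 0) (h - 1 + -1) :=
    neg_mem (mul_mem_testSpace (xp_mem_testSpace _) (zp_mem_testSpace _))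
  have h2 : (1 : ℂ) • xp (h - 1) - -(xp (h - 1) * zp (-1)) ∈ testSpace (h + 0) (h + -1) := by
    have : (1 : ℂ) • xp (h - 1) - -(xp (h - 1) * zp (-1)) = xp h * zp (-1) := by
      nth_rw 3 [show h = h - 1 + 1 by ring]
      rw [xp_add (h - 1) 1, xp_one, mul_assoc, add_mul, one_mul, zp_mul, add_neg_cancel, zp_zero,
        one_smul]
      ring
    rw [this]
    exact mul_mem_testSpace (xp_mem_testSpace _) (zp_mem_testSpace _)
  have h3 := contraMode_apply_eq d.mkQ_mem_contra hu h1 (by omega) h2 le_rfl d.vacuum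
  rw [map_neg, LinearMap.neg_apply, map_neg, neg_inj, one_smul] at h3
  rw [← h3, Y_xp_mul_zp, finsum_eq_single _ 0 fun i hi => by
    rw [d.creation u _ (by omega), smul_zero], cbinom_zero_right, Nat.cast_zero, add_zero,
    d.creation_neg_one, one_smul]

end VOA

namespace AdmMod

variable {M : Type} [AddCommGroup M] [Module ℂ M] {d : VOA V}

/-- The action of an admissible module as a linear map in the acting vector. -/
def actHom (A : AdmMod d M) (m : ℤ) : V →ₗ[ℂ] Module.End ℂ M where
  toFun u := A.act u m
  map_add' u v := A.act_add u v m
  map_smul' c u := A.act_smul c u m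

theorem act_zero (A : AdmMod d M) (m : ℤ) : A.act 0 m = 0 := map_zero (A.actHom m)

theorem act_eq_zero (A : AdmMod d M) {h n m : ℤ} {u : V} (hu : u ∈ d.grading h) {w : M}
    (hw : w ∈ A.gr n) (hm : h + n ≤ m) : A.act u m w = 0 := by
  have := A.gr_act h u hu m n w hw
  rwa [A.gr_neg _ (by omega), Submodule.mem_bot] at this

/-- The zero mode `o(u)` on all of `M`, as a linear map in `u`. -/
noncomputable def zeroModeAux (A : AdmMod d M) : V →ₗ[ℂ] Module.End ℂ M :=
  d.lift fun h => A.actHom (h - 1)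

theorem zeroModeAux_apply (A : AdmMod d M) {h : ℤ} {u : V} (hu : u ∈ d.grading h) :
    A.zeroModeAux u = A.act u (h - 1) :=
  d.lift_apply _ hu

theorem zeroModeAux_mem (A : AdmMod d M) (u : V) {n : ℤ} {w : M} (hw : w ∈ A.gr n) :
    A.zeroModeAux u w ∈ A.gr n := by
  induction u using d.homogeneous_induction with
  | hom h u hu =>
    rw [A.zeroModeAux_apply hu]
    have := A.gr_act h u hu (h - 1) n w hw
    rwa [show h + n - (h - 1) - 1 = n by ring] at this
  | add u v h h' => rw [map_add]; exact add_mem h h'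

/-- The zero mode `o(u)` on the degree-zero component, as a linear map in `u`. -/
noncomputable def zeroMode (A : AdmMod d M) : V →ₗ[ℂ] Module.End ℂ (A.gr 0) where
  toFun u := (A.zeroModeAux u).restrict fun _ hw => A.zeroModeAux_mem u hw
  map_add' u v := by ext; simp
  map_smul' c u := by ext; simp

theorem coe_zeroMode (A : AdmMod d M) (u : V) (w : A.gr 0) :
    (A.zeroMode u w : M) = A.zeroModeAux u w := rfl

theorem zeroModeAux_Y (A : AdmMod d M) {ha hb : ℤ} {a b : V} (ha' : a ∈ d.grading ha)
    (hb' : b ∈ d.grading hb) (r : ℤ) (w : M) :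
    A.zeroModeAux (d.Y a (xp ha * zp r) b) w
      = ∑ᶠ i : ℕ, ((-1 : ℂ) ^ i * cbinom r i) •
          (A.act a (ha + r - i) (A.act b (hb - 2 - r + i) w)
            - (-1 : ℂ) ^ r • A.act b (hb - 2 - r + r - i) (A.act a (ha + i) w)) := by
  rw [← A.borcherds ha (hb - 2 - r) r a b w, VOA.Y_xp_mul_zp]
  have h1 := eventually_sum_range_eq_finsum (f := fun i : ℕ => cbinom ha i • d.mode a (r + i) b) (by
    filter_upwards [d.eventually_mode_eq_zero a b r] with i hi
    rw [hi, smul_zero])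
  have h2 := eventually_sum_range_eq_finsum (f := fun i : ℕ =>
    cbinom ha i • A.act (d.mode a (r + i) b) (ha + (hb - 2 - r) - i) w) (by
    filter_upwards [d.eventually_mode_eq_zero a b r] with i hi
    rw [hi, A.act_zero, LinearMap.zero_apply, smul_zero])
  obtain ⟨I, h1, h2⟩ := (h1.and h2).exists
  rw [← h1, ← h2, map_sum, LinearMap.sum_apply]
  refine Finset.sum_congr rfl fun i _ => ?_
  rw [map_smul, A.zeroModeAux_apply (d.grading_mode ha hb (r + i) a b ha' hb'),
    LinearMap.smul_apply, show ha + hb - (r + i) - 1 - 1 = ha + (hb - 2 - r) - i by ring]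

theorem zeroMode_star (A : AdmMod d M) (a b : V) :
    A.zeroMode (d.star a b) = A.zeroMode a * A.zeroMode b := by
  rw [VOA.star, d.bres_eq]
  induction a using d.homogeneous_induction with
  | hom ha a ha' =>
    induction b using d.homogeneous_induction with
    | hom hb b hb' =>
      ext w
      rw [d.bresHom_apply 0 1 ha', add_zero, Module.End.mul_apply, coe_zeroMode, coe_zeroMode,
        coe_zeroMode, A.zeroModeAux_Y ha' hb', finsum_eq_single _ 0 fun i hi => ?_,
        A.zeroModeAux_apply ha', A.zeroModeAux_apply hb']
      · rw [A.act_eq_zero ha' w.2 (m := ha + (0 : ℕ)) (by omega), map_zero, smul_zero, sub_zero,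
          pow_zero, cbinom_zero_right, mul_one, one_smul]
        congr 2
        · push_cast; ring
        · congr 1; push_cast; ring
      · rw [A.act_eq_zero ha' w.2 (by omega), A.act_eq_zero hb' w.2 (by omega), map_zero, map_zero,
          smul_zero, sub_zero, smul_zero]
    | add b b' h h' => rw [map_add, map_add, map_add, h, h', mul_add]
  | add a a' h h' => rw [map_add, LinearMap.add_apply, map_add, map_add, h, h', add_mul]

theorem zeroMode_circ (A : AdmMod d M) (a b : V) : A.zeroMode (d.circ a b) = 0 := by
  rw [VOA.circ, d.bres_eq]
  induction a using d.homogeneous_induction with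
  | hom ha a ha' =>
    induction b using d.homogeneous_induction with
    | hom hb b hb' =>
      ext w
      rw [d.bresHom_apply 0 2 ha', add_zero, coe_zeroMode, A.zeroModeAux_Y ha' hb',
        finsum_eq_zero_of_forall_eq_zero fun i => ?_]
      · rfl
      · rw [A.act_eq_zero ha' w.2 (by omega), A.act_eq_zero hb' w.2 (by omega), map_zero, map_zero,
          smul_zero, sub_zero, smul_zero]
    | add b b' h h' => rw [map_add, map_add, h, h', add_zero]
  | add a a' h h' => rw [map_add, LinearMap.add_apply, map_add, h, h', add_zero]

theorem Ozhu_le_ker_zeroMode (A : AdmMod d M) : d.Ozhu ≤ LinearMap.ker A.zeroMode := by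
  rw [VOA.Ozhu, Submodule.span_le]
  rintro _ ⟨a, b, rfl⟩
  exact A.zeroMode_circ a b

theorem zeroMode_vacuum (A : AdmMod d M) : A.zeroMode d.vacuum = 1 := by
  ext w
  rw [coe_zeroMode, A.zeroModeAux_apply d.vacuum_mem, A.vacuum_act, if_pos (by norm_num)]
  rfl

/-- The image of the zero modes on the degree-zero component. -/
noncomputable def zeroModeAlgebra (A : AdmMod d M) :
    Subalgebra ℂ (Module.End ℂ (A.gr 0)) where
  carrier := Set.range A.zeroMode
  mul_mem' := by
    rintro _ _ ⟨a, rfl⟩ ⟨b, rfl⟩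
    exact ⟨d.star a b, A.zeroMode_star a b⟩
  add_mem' := by
    rintro _ _ ⟨a, rfl⟩ ⟨b, rfl⟩
    exact ⟨a + b, map_add _ a b⟩
  algebraMap_mem' c := ⟨c • d.vacuum, by
    rw [map_smul, A.zeroMode_vacuum, Algebra.algebraMap_eq_smul_one]⟩

end AdmMod

namespace VOA

/-- The degree-zero element of `contraMod` given by the quotient map `V → V / O(V)`. -/
noncomputable def quotientVector (d : VOA V) : (d.contraMod (V ⧸ d.Ozhu)).gr 0 :=
  ⟨Family.single d.mkQ_mem_contra, Family.single_mem_gr d.mkQ_mem_contra⟩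

theorem zeroMode_quotientVector (d : VOA V) (u : V) :
    Family.val d (V ⧸ d.Ozhu) ((d.contraMod (V ⧸ d.Ozhu)).zeroMode u d.quotientVector) 0 d.vacuum
      = d.Ozhu.mkQ u := by
  induction u using d.homogeneous_induction with
  | hom h u hu =>
    rw [← contraMode_mkQ d hu, AdmMod.coe_zeroMode, AdmMod.zeroModeAux_apply _ hu]
    change d.familyAct _ (h - 1) u (Finsupp.single 0 d.Ozhu.mkQ) 0 d.vacuum = _
    rw [familyAct_single d hu, show h + 0 - (h - 1) - 1 = 0 by ring, Finsupp.single_eq_same]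
  | add u v h h' =>
    rw [map_add, map_add, ← h, ← h', LinearMap.add_apply, Submodule.coe_add, map_add]
    rfl

theorem mem_Ozhu_of_zeroMode (d : VOA V) {u : V}
    (h : (d.contraMod (V ⧸ d.Ozhu)).zeroMode u d.quotientVector = 0) : u ∈ d.Ozhu := by
  rw [← d.Ozhu.ker_mkQ, LinearMap.mem_ker, ← d.zeroMode_quotientVector, h]
  simp

theorem ker_zeroMode_contraMod (d : VOA V) :
    LinearMap.ker (d.contraMod (V ⧸ d.Ozhu)).zeroMode = d.Ozhu := by
  refine le_antisymm (fun u hu => d.mem_Ozhu_of_zeroMode ?_) (AdmMod.Ozhu_le_ker_zeroMode _)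
  rw [LinearMap.mem_ker.1 hu]
  rfl

/-- The Zhu algebra, realized by zero modes. -/
noncomputable def zhuRealization (d : VOA V) : Realization d.Ozhu d.star d.vacuum where
  carrier := (d.contraMod (V ⧸ d.Ozhu)).zeroModeAlgebra
  emb := (d.contraMod (V ⧸ d.Ozhu)).zeroMode.codRestrict
    (Subalgebra.toSubmodule (d.contraMod (V ⧸ d.Ozhu)).zeroModeAlgebra) fun u => ⟨u, rfl⟩
  surj := by
    rintro ⟨_, u, rfl⟩
    exact ⟨u, rfl⟩
  ker_eq := (LinearMap.ker_codRestrict _ _ _).trans d.ker_zeroMode_contraMod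
  mul_compat u v := Subtype.ext (AdmMod.zeroMode_star _ u v)
  one_compat := Subtype.ext (AdmMod.zeroMode_vacuum _)

end VOA

theorem linearIndependent_sub_inv_of_transcendental {F D : Type*} [Field F] [DivisionRing D]
    [Algebra F D] {x : D} (H : Transcendental F x) :
    LinearIndependent F fun a => (x - algebraMap F D a)⁻¹ := by
  classical
  rw [transcendental_iff] at H
  have hx (a : F) : Polynomial.aeval x (Polynomial.X - Polynomial.C a) = x - algebraMap F D a := by
    simp
  have hnz (a : F) : x - algebraMap F D a ≠ 0 := fun h =>
    Polynomial.X_sub_C_ne_zero a (H _ (by rw [hx, h]))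
  refine linearIndependent_iff'.2 fun s m hm i hi => ?_
  set q : F → Polynomial F := fun i => ∏ j ∈ s.erase i, (Polynomial.X - Polynomial.C j) with hq
  have h1 : ∀ i ∈ s, Polynomial.aeval x (∏ j ∈ s, (Polynomial.X - Polynomial.C j))
      * (x - algebraMap F D i)⁻¹ = Polynomial.aeval x (q i) := fun i hi => by
    rw [← Finset.prod_erase_mul _ _ hi, map_mul, hx, mul_inv_cancel_right₀ (hnz i)]
  have h2 : ∑ i ∈ s, m i • q i = 0 := by
    refine H _ ?_
    have h3 := congrArg (Polynomial.aeval x (∏ j ∈ s, (Polynomial.X - Polynomial.C j)) * ·) hm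
    simp only [Finset.mul_sum, mul_zero, mul_smul_comm] at h3
    rw [map_sum, ← h3]
    exact Finset.sum_congr rfl fun i hi => by rw [map_smul, h1 i hi]
  have h3 := congrArg (Polynomial.eval i) h2
  rw [Polynomial.eval_finsetSum, Finset.sum_eq_single i, Polynomial.eval_smul, Polynomial.eval_zero,
    smul_eq_mul] at h3
  · refine (mul_eq_zero.1 h3).resolve_right ?_
    rw [hq, Polynomial.eval_prod]
    refine Finset.prod_ne_zero_iff.2 fun j hj => ?_
    rw [Polynomial.eval_sub, Polynomial.eval_X, Polynomial.eval_C, sub_ne_zero]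
    exact (Finset.ne_of_mem_erase hj).symm
  · intro j _ hji
    rw [Polynomial.eval_smul, Polynomial.eval_prod,
      Finset.prod_eq_zero (Finset.mem_erase.2 ⟨hji.symm, hi⟩) (by simp), smul_zero]
  · exact fun h => absurd hi h

open Cardinal in
/-- A division algebra of countable dimension over `ℂ` is `ℂ`. -/
theorem algebraMap_bijective_of_rank_le_aleph0 {D : Type} [DivisionRing D] [Algebra ℂ D]
    (h : Module.rank ℂ D ≤ ℵ₀) : Function.Bijective (algebraMap ℂ D) := by
  have : Algebra.IsIntegral ℂ D := by
    refine ⟨fun x => ?_⟩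
    rw [← isAlgebraic_iff_isIntegral]
    by_contra hx
    have h1 := (linearIndependent_sub_inv_of_transcendental (F := ℂ) hx).cardinal_le_rank
    rw [Cardinal.mk_complex] at h1
    exact absurd (h1.trans h) (not_le.2 aleph0_lt_continuum)
  exact IsAlgClosed.algebraMap_bijective_of_isIntegral

open Cardinal in
theorem finiteDimensional_of_isSemisimpleRing {S : Type} [Ring S] [Algebra ℂ S] [IsSemisimpleRing S]
    (h : Module.rank ℂ S ≤ ℵ₀) : FiniteDimensional ℂ S := by
  obtain ⟨n, D, k, _, _, hk, ⟨e⟩⟩ := IsSemisimpleRing.exists_algEquiv_pi_matrix_divisionRing ℂ S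
  have hD (i : Fin n) : FiniteDimensional ℂ (D i) := by
    have := hk i
    have hr : Module.rank ℂ (D i) ≤ ℵ₀ := by
      refine le_trans ?_ h
      refine LinearMap.rank_le_of_surjective (Matrix.entryLinearMap ℂ (D i) 0 0 ∘ₗ
        LinearMap.proj (φ := fun i => Matrix (Fin (k i)) (Fin (k i)) (D i)) i ∘ₗ
          e.toLinearEquiv.toLinearMap) ?_
      intro x
      refine ⟨e.symm (Function.update 0 i (Matrix.of fun _ _ => x)), ?_⟩
      simp
    have hb := algebraMap_bijective_of_rank_le_aleph0 hr
    exact Module.Finite.of_surjective (Algebra.linearMap ℂ (D i)) hb.2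
  exact Module.Finite.equiv e.symm.toLinearEquiv

open Cardinal in
theorem VOA.rank_le_aleph0 (d : VOA V) : Module.rank ℂ V ≤ ℵ₀ := by
  have hfg (n : ℤ) : ∃ s : Finset V, Submodule.span ℂ (s : Set V) = d.grading n := by
    have := d.fin_dim n
    exact Module.Finite.iff_fg.1 this
  choose s hs using hfg
  have htop : Submodule.span ℂ (⋃ n, (s n : Set V)) = ⊤ := by
    rw [Submodule.span_iUnion, ← DirectSum.IsInternal.submodule_iSup_eq_top d.internal]
    exact iSup_congr hs
  rw [← rank_top, ← htop]
  exact (rank_span_le _).trans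
    (Set.countable_iUnion fun n => (s n).countable_toSet).le_aleph0

namespace WeakMod

variable {M : Type} [AddCommGroup M] [Module ℂ M] {d : VOA V}

/-- The span of all `u_m w` with `w ∈ N`. -/
def actSpan (W : WeakMod d M) (N : Set M) : Submodule ℂ M :=
  Submodule.span ℂ {x | ∃ (u : V) (m : ℤ), ∃ w ∈ N, x = W.act u m w}

theorem act_mem_actSpan (W : WeakMod d M) {N : Set M} (u : V) (m : ℤ) {w : M} (hw : w ∈ N) :
    W.act u m w ∈ W.actSpan N :=
  Submodule.subset_span ⟨u, m, w, hw, rfl⟩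

theorem subset_actSpan (W : WeakMod d M) (N : Set M) : N ⊆ W.actSpan N := fun w hw => by
  have := W.act_mem_actSpan d.vacuum (-1) hw
  rwa [W.vacuum_act, if_pos rfl] at this

theorem act_act_mem_actSpan (W : WeakMod d M) {N : Set M} (a b : V) (m n : ℤ) {w : M}
    (hw : w ∈ N) : W.act a m (W.act b n w) ∈ W.actSpan N := by
  obtain ⟨J, hJ⟩ := W.truncation a w
  obtain ⟨K, hK⟩ := W.truncation b w
  obtain ⟨k, hk⟩ : ∃ k : ℕ, K ≤ n + k := ⟨(K - n).toNat, by omega⟩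
  induction k using Nat.strong_induction_on generalizing m n with
  | _ k ih =>
    have hev : ∀ᶠ i : ℕ in atTop, W.act b (n + i) w = 0 := by
      filter_upwards [eventually_ge_atTop (K - n).toNat] with i hi
      exact hK _ (by omega)
    have h := W.borcherds J n (m - J) a b w
    have hl : (∑ᶠ i : ℕ, cbinom J i • W.act (d.mode a (m - J + i) b) (J + n - i) w)
        ∈ W.actSpan N :=
      finsum_induction (· ∈ W.actSpan N) (zero_mem _) (fun _ _ => add_mem)
        fun i => Submodule.smul_mem _ _ (W.act_mem_actSpan _ _ hw)
    have hterm (i : ℕ) : ((-1 : ℂ) ^ i * cbinom (m - J) i) •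
        (W.act a (J + (m - J) - i) (W.act b (n + i) w)
          - (-1 : ℂ) ^ (m - J) • W.act b (n + (m - J) - i) (W.act a (J + i) w))
        = ((-1 : ℂ) ^ i * cbinom (m - J) i) • W.act a (m - i) (W.act b (n + i) w) := by
      rw [hJ (J + i) (by omega), map_zero, smul_zero, sub_zero, add_sub_cancel]
    rw [h, finsum_congr hterm] at hl
    have hsum := eventually_sum_range_eq_finsum (f := fun i : ℕ =>
      ((-1 : ℂ) ^ i * cbinom (m - J) i) • W.act a (m - i) (W.act b (n + i) w)) (by
        filter_upwards [hev] with i hi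
        rw [hi, map_zero, smul_zero])
    obtain ⟨I, hI, hI0⟩ := (hsum.and (eventually_ge_atTop 1)).exists
    obtain ⟨I, rfl⟩ := Nat.exists_eq_add_of_le' hI0
    rw [← hI, Finset.sum_range_succ', Submodule.add_mem_iff_right] at hl
    · rwa [pow_zero, cbinom_zero_right, mul_one, one_smul, Nat.cast_zero, sub_zero, add_zero] at hl
    · refine Submodule.sum_mem _ fun i _ => Submodule.smul_mem _ _ ?_
      rcases le_or_gt K (n + (i + 1 : ℕ)) with hle | hlt
      · rw [hK _ hle, map_zero]
        exact zero_mem _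
      · exact ih (k - (i + 1)) (by push_cast at hlt; omega) _ _ (by push_cast at hlt ⊢; omega)

theorem isStable_actSpan (W : WeakMod d M) (N : Set M) : W.IsStable (W.actSpan N) := by
  intro u m x hx
  have : W.actSpan N ≤ (W.actSpan N).comap (W.act u m) := by
    refine Submodule.span_le.2 ?_
    rintro _ ⟨v, n, w, hw, rfl⟩
    exact W.act_act_mem_actSpan u v m n hw
  exact this hx

end WeakMod

namespace AdmMod

variable {M : Type} [AddCommGroup M] [Module ℂ M] {d : VOA V}

/-- The projection onto the degree-zero component. -/
noncomputable def projZero (A : AdmMod d M) : M →ₗ[ℂ] A.gr 0 :=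
  DirectSum.component ℂ ℤ (fun n => A.gr n) 0 ∘ₗ
    (LinearEquiv.ofBijective (DirectSum.coeLinearMap A.gr) A.gr_internal).symm.toLinearMap

theorem decompose_coe (A : AdmMod d M) {n : ℤ} {w : M} (hw : w ∈ A.gr n) :
    (LinearEquiv.ofBijective (DirectSum.coeLinearMap A.gr) A.gr_internal).symm w
      = DirectSum.lof ℂ ℤ (fun n => A.gr n) n ⟨w, hw⟩ := by
  rw [LinearEquiv.symm_apply_eq, LinearEquiv.ofBijective_apply, DirectSum.coeLinearMap_lof]

theorem projZero_coe (A : AdmMod d M) (w : A.gr 0) : A.projZero w = w := by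
  rw [projZero, LinearMap.comp_apply, LinearEquiv.coe_coe, A.decompose_coe w.2,
    DirectSum.component.lof_self]

theorem projZero_eq_zero (A : AdmMod d M) {n : ℤ} (hn : n ≠ 0) {w : M} (hw : w ∈ A.gr n) :
    A.projZero w = 0 := by
  rw [projZero, LinearMap.comp_apply, LinearEquiv.coe_coe, A.decompose_coe hw,
    DirectSum.component.of, dif_neg hn]

theorem projZero_mem (A : AdmMod d M) {P : Submodule ℂ M} (hP : A.IsGraded P) {w : M}
    (hw : w ∈ P) : (A.projZero w : M) ∈ P := by
  rw [hP] at hw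
  refine Submodule.iSup_induction _ (motive := fun w => (A.projZero w : M) ∈ P) hw
    (fun n w hw => ?_) ?_ fun w w' h h' => ?_
  · rcases eq_or_ne n 0 with rfl | hn
    · rw [A.projZero_coe ⟨w, hw.2⟩]
      exact hw.1
    · rw [A.projZero_eq_zero hn hw.2]
      exact zero_mem _
  · rw [map_zero]
    exact zero_mem _
  · rw [map_add]
    exact add_mem h h'

theorem isGraded_actSpan (A : AdmMod d M) {n : ℤ} {N : Set M} (hN : N ⊆ A.gr n) :
    A.IsGraded (A.actSpan N) := by
  refine le_antisymm (Submodule.span_le.2 ?_) (iSup_le fun n => inf_le_left)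
  rintro _ ⟨u, m, w, hw, rfl⟩
  rw [SetLike.mem_coe]
  induction u using d.homogeneous_induction with
  | hom h u hu =>
    exact Submodule.mem_iSup_of_mem _
      ⟨A.act_mem_actSpan u m hw, A.gr_act h u hu m n w (hN hw)⟩
  | add u v h h' =>
    rw [A.act_add]
    exact add_mem h h'

theorem zeroModeAux_mem_of_isStable (A : AdmMod d M) {P : Submodule ℂ M} (hP : A.IsStable P)
    (u : V) {w : M} (hw : w ∈ P) : A.zeroModeAux u w ∈ P := by
  induction u using d.homogeneous_induction with
  | hom h u hu =>
    rw [A.zeroModeAux_apply hu]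
    exact hP _ _ _ hw
  | add u v h h' =>
    rw [map_add]
    exact add_mem h h'

theorem smul_eq_zeroMode (A : AdmMod d M) (s : A.zeroModeAlgebra) :
    ∃ u, ∀ w : A.gr 0, s • w = A.zeroMode u w := by
  obtain ⟨_, u, rfl⟩ := s
  exact ⟨u, fun w => rfl⟩

theorem zeroMode_mem (A : AdmMod d M) (N : Submodule A.zeroModeAlgebra (A.gr 0)) (u : V)
    {w : A.gr 0} (hw : w ∈ N) : A.zeroMode u w ∈ N :=
  N.smul_mem (⟨_, u, rfl⟩ : A.zeroModeAlgebra) hw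

/-- The degree-zero part of a stable subspace. -/
def zeroPart (A : AdmMod d M) {P : Submodule ℂ M} (hP : A.IsStable P) :
    Submodule A.zeroModeAlgebra (A.gr 0) where
  carrier := {w | (w : M) ∈ P}
  add_mem' h h' := P.add_mem h h'
  zero_mem' := P.zero_mem
  smul_mem' s w hw := by
    obtain ⟨u, hu⟩ := A.smul_eq_zeroMode s
    rw [Set.mem_ofPred_eq, hu]
    exact A.zeroModeAux_mem_of_isStable hP u hw

theorem mem_zeroPart (A : AdmMod d M) {P : Submodule ℂ M} {hP : A.IsStable P} {w : A.gr 0} :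
    w ∈ A.zeroPart hP ↔ (w : M) ∈ P := Iff.rfl

/-- The submodule generated by a submodule `N` of the degree-zero component meets the degree-zero
component in `N`. -/
theorem projZero_mem_of_mem_actSpan (A : AdmMod d M) (N : Submodule A.zeroModeAlgebra (A.gr 0))
    {x : M} (hx : x ∈ A.actSpan (Set.image (↑) (N : Set (A.gr 0)))) : A.projZero x ∈ N := by
  refine Submodule.span_induction (p := fun x _ => A.projZero x ∈ N) ?_ ?_ (fun x y _ _ h h' => ?_)
    (fun c x _ h => ?_) hx
  · rintro _ ⟨u, m, _, ⟨w, hw, rfl⟩, rfl⟩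
    induction u using d.homogeneous_induction with
    | hom h u hu =>
      rcases eq_or_ne m (h - 1) with rfl | hm
      · rw [← A.zeroModeAux_apply hu, ← A.coe_zeroMode, A.projZero_coe]
        exact A.zeroMode_mem N u hw
      · rw [A.projZero_eq_zero (n := h + 0 - m - 1) (by omega) (A.gr_act h u hu m 0 w w.2)]
        exact zero_mem _
    | add u v h h' =>
      rw [A.act_add, LinearMap.add_apply, map_add]
      exact add_mem h h'
  · rw [map_zero]
    exact zero_mem _
  · rw [map_add]
    exact add_mem h h'
  · rw [map_smul]
    exact N.smul_mem (algebraMap ℂ A.zeroModeAlgebra c) h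

theorem zeroPart_eq_bot_or_isAtom (A : AdmMod d M) {P : Submodule ℂ M} (hP : A.IrredSub P) :
    A.zeroPart hP.2.1 = ⊥ ∨ IsAtom (A.zeroPart hP.2.1) := by
  have key (N : Submodule A.zeroModeAlgebra (A.gr 0)) (hN : N ≤ A.zeroPart hP.2.1) :
      N = ⊥ ∨ N = A.zeroPart hP.2.1 := by
    set Q := A.actSpan (Set.image (↑) (N : Set (A.gr 0))) with hQ
    have hNQ : ∀ w ∈ N, (w : M) ∈ Q := fun w hw => A.subset_actSpan _ ⟨w, hw, rfl⟩
    have hQP : Q ≤ P := by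
      refine Submodule.span_le.2 ?_
      rintro _ ⟨u, m, _, ⟨w, hw, rfl⟩, rfl⟩
      exact hP.2.1 u m w (hN hw)
    rcases hP.2.2.2 Q hQP (A.isStable_actSpan _)
      (A.isGraded_actSpan (n := 0) (by rintro _ ⟨w, -, rfl⟩; exact w.2)) with h | h
    · refine Or.inl ((Submodule.eq_bot_iff _).2 fun w hw => Subtype.ext ?_)
      have := hNQ w hw
      rwa [h, Submodule.mem_bot] at this
    · refine Or.inr (le_antisymm hN fun w hw => ?_)
      rw [mem_zeroPart, ← h] at hw
      have := A.projZero_mem_of_mem_actSpan N hw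
      rwa [A.projZero_coe] at this
  rcases eq_or_ne (A.zeroPart hP.2.1) ⊥ with h | h
  · exact Or.inl h
  · exact Or.inr ⟨h, fun N hN => (key N hN.le).resolve_right hN.ne⟩

theorem isSemisimpleModule_gr_zero (A : AdmMod d M) {ι : Type} {f : ι → Submodule ℂ M}
    (hf : ∀ i, A.IrredSub (f i)) (htop : ⨆ i, f i = ⊤) :
    IsSemisimpleModule A.zeroModeAlgebra (A.gr 0) := by
  rw [isSemisimpleModule_iff]
  have : IsModularLattice (Submodule A.zeroModeAlgebra (A.gr 0)) :=
    @Submodule.instIsModularLattice A.zeroModeAlgebra (A.gr 0) _ _ _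
  refine complementedLattice_of_sSup_atoms_eq_top (eq_top_iff.2 ?_)
  have hle : ⨆ i, A.zeroPart (hf i).2.1 ≤
      sSup {N : Submodule A.zeroModeAlgebra (A.gr 0) | IsAtom N} := by
    refine iSup_le fun i => ?_
    rcases A.zeroPart_eq_bot_or_isAtom (hf i) with h | h
    · rw [h]
      exact bot_le
    · exact le_sSup h
  refine le_trans (fun w _ => ?_) hle
  have key (x : M) (hx : x ∈ ⨆ i, f i) : A.projZero x ∈ ⨆ i, A.zeroPart (hf i).2.1 := by
    refine Submodule.iSup_induction f
      (motive := fun x => A.projZero x ∈ ⨆ i, A.zeroPart (hf i).2.1) hx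
      (fun i x hx => ?_) ?_ fun x y h h' => ?_
    · exact Submodule.mem_iSup_of_mem i (A.projZero_mem (hf i).2.2.1 hx)
    · rw [map_zero]
      exact zero_mem _
    · rw [map_add]
      exact add_mem h h'
  rw [← A.projZero_coe w]
  exact key w (htop ▸ Submodule.mem_top)

end AdmMod

namespace Realization

variable {O : Submodule ℂ V} {mu : V → V → V} {one : V}

attribute [local instance] Realization.ring Realization.alg

/-- The comparison map between two realizations of the same quotient algebra. -/
noncomputable def comparison (R R' : Realization O mu one) (x : R.carrier) : R'.carrier :=
  R'.emb (Function.surjInv R.surj x)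

theorem comparison_emb (R R' : Realization O mu one) (u : V) :
    R.comparison R' (R.emb u) = R'.emb u := by
  have h : Function.surjInv R.surj (R.emb u) - u ∈ LinearMap.ker R.emb := by
    rw [LinearMap.mem_ker, map_sub, Function.surjInv_eq R.surj, sub_self]
  have h' : Function.surjInv R.surj (R.emb u) - u ∈ LinearMap.ker R'.emb :=
    R'.ker_eq.ge (R.ker_eq.le h)
  rwa [LinearMap.mem_ker, map_sub, sub_eq_zero] at h'

/-- The comparison map as a ring homomorphism. -/
noncomputable def comparisonHom (R R' : Realization O mu one) : R.carrier →+* R'.carrier where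
  toFun := R.comparison R'
  map_one' := by rw [← R.one_compat, comparison_emb, R'.one_compat]
  map_mul' x y := by
    obtain ⟨u, rfl⟩ := R.surj x
    obtain ⟨v, rfl⟩ := R.surj y
    rw [← R.mul_compat, comparison_emb, comparison_emb, comparison_emb, R'.mul_compat]
  map_zero' := by rw [← map_zero R.emb, comparison_emb, map_zero]
  map_add' x y := by
    obtain ⟨u, rfl⟩ := R.surj x
    obtain ⟨v, rfl⟩ := R.surj y
    rw [← map_add, comparison_emb, comparison_emb, comparison_emb, map_add]

theorem Semisimple.of_realization {R : Realization O mu one} (h : R.Semisimple)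
    (R' : Realization O mu one) : R'.Semisimple := by
  have : IsSemisimpleRing R.carrier := h
  refine RingHom.isSemisimpleRing_of_surjective (R.comparisonHom R') fun y => ?_
  obtain ⟨u, rfl⟩ := R'.surj y
  exact ⟨R.emb u, R.comparison_emb R' u⟩

end Realization

theorem VOA.semisimple_zhuRealization (d : VOA V) (h : Rational d) :
    d.zhuRealization.Semisimple := by
  obtain ⟨ι, f, hf, -, htop⟩ := h (d.Family (V ⧸ d.Ozhu)) (d.contraMod (V ⧸ d.Ozhu))
  have := (d.contraMod (V ⧸ d.Ozhu)).isSemisimpleModule_gr_zero hf htop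
  change IsSemisimpleModule (d.contraMod (V ⧸ d.Ozhu)).zeroModeAlgebra
    (d.contraMod (V ⧸ d.Ozhu)).zeroModeAlgebra
  refine IsSemisimpleModule.of_injective (LinearMap.toSpanSingleton
    (d.contraMod (V ⧸ d.Ozhu)).zeroModeAlgebra _ d.quotientVector) ?_
  rintro ⟨_, u, rfl⟩ ⟨_, v, rfl⟩ huv
  have h0 : (d.contraMod (V ⧸ d.Ozhu)).zeroMode (u - v) d.quotientVector = 0 := by
    rw [map_sub, LinearMap.sub_apply, sub_eq_zero]
    exact huv
  have h1 := AdmMod.Ozhu_le_ker_zeroMode (d.contraMod (V ⧸ d.Ozhu)) (d.mem_Ozhu_of_zeroMode h0)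
  rw [LinearMap.mem_ker, map_sub, sub_eq_zero] at h1
  exact Subtype.ext h1

/-- if `V` is rational then `A(V)` is a finite-dimensional semisimple
associative algebra. -/
theorem stmt7 (d : VOA V) (h : Rational d) :
    (∃ _ : Realization d.Ozhu d.star d.vacuum, True) ∧
    ∀ R : Realization d.Ozhu d.star d.vacuum, R.FinDim ∧ R.Semisimple := by
  refine ⟨⟨d.zhuRealization, trivial⟩, fun R => ?_⟩
  let := R.ring
  let := R.alg
  have hR := (d.semisimple_zhuRealization h).of_realization R
  have : IsSemisimpleRing R.carrier := hR
  exact ⟨finiteDimensional_of_isSemisimpleRing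
    ((LinearMap.rank_le_of_surjective R.emb R.surj).trans d.rank_le_aleph0), hR⟩
end

section
/- If V is a rational vertex operator algebra, then V has only finitely many irreducible admissible modules up to isomorphism, and every irreducible admissible V-module is an ordinary V-module. -/
variable {V : Type} [AddCommGroup V] [Module ℂ V]

variable {M : Type} [AddCommGroup M] [Module ℂ M]

section Graded

variable {R E : Type} [Ring R] [AddCommGroup E] [Module R E]

/-- The projection onto the degree `n` piece of an internal grading. -/
noncomputable def gradedComp (g : ℤ → Submodule R E)
    (hg : Function.Bijective (DirectSum.coeLinearMap g)) (n : ℤ) : E →ₗ[R] E :=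
  (g n).subtype ∘ₗ DirectSum.component R ℤ (fun m => g m) n ∘ₗ
    (LinearEquiv.ofBijective (DirectSum.coeLinearMap g) hg).symm.toLinearMap

variable {g : ℤ → Submodule R E} (hg : Function.Bijective (DirectSum.coeLinearMap g))

theorem gradedComp_mem (n : ℤ) (w : E) : gradedComp g hg n w ∈ g n :=
  Subtype.property _

theorem gradedComp_of_mem {n : ℤ} {w : E} (hw : w ∈ g n) : gradedComp g hg n w = w :=
  congrArg Subtype.val (DirectSum.IsInternal.ofBijective_coeLinearMap_of_mem hg hw)

theorem gradedComp_of_mem_ne {n m : ℤ} (h : m ≠ n) {w : E} (hw : w ∈ g m) :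
    gradedComp g hg n w = 0 :=
  congrArg Subtype.val (DirectSum.IsInternal.ofBijective_coeLinearMap_of_mem_ne hg h hw)

theorem iSup_eq_top_of_bijective {g : ℤ → Submodule R E}
    (hg : Function.Bijective (DirectSum.coeLinearMap g)) : ⨆ n, g n = ⊤ :=
  (DirectSum.isInternal_submodule_iff_iSupIndep_and_iSup_eq_top g).1 hg |>.2

theorem graded_induction {g : ℤ → Submodule R E}
    (hg : Function.Bijective (DirectSum.coeLinearMap g)) {p : E → Prop} (hom : ∀ n, ∀ w ∈ g n, p w)
    (hadd : ∀ x y, p x → p y → p (x + y)) (w : E) : p w := by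
  have hw : w ∈ ⨆ n, g n := by rw [iSup_eq_top_of_bijective hg]; trivial
  exact Submodule.iSup_induction g (motive := p) hw hom (hom 0 0 (zero_mem _)) hadd

theorem mem_of_gradedComp_mem {P : Submodule R E} {w : E}
    (h : ∀ n, gradedComp g hg n w ∈ P) : w ∈ P := by
  classical
  have key : w = DirectSum.coeLinearMap g
      ((LinearEquiv.ofBijective (DirectSum.coeLinearMap g) hg).symm w) :=
    ((LinearEquiv.ofBijective (DirectSum.coeLinearMap g) hg).apply_symm_apply w).symm
  rw [key, DirectSum.coeLinearMap_eq_dfinsuppSum]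
  exact Submodule.sum_mem _ fun n _ => h n

theorem eq_zero_of_gradedComp_eq_zero {w : E} (h : ∀ n, gradedComp g hg n w = 0) : w = 0 :=
  (Submodule.mem_bot R).1 (mem_of_gradedComp_mem hg fun n => (Submodule.mem_bot R).2 (h n))

theorem eq_iSup_inf_iff_gradedComp_mem {P : Submodule R E} :
    P = ⨆ n, P ⊓ g n ↔ ∀ w ∈ P, ∀ n, gradedComp g hg n w ∈ P := by
  constructor
  · intro h w hw n
    rw [h] at hw
    refine Submodule.iSup_induction _ (motive := fun w => gradedComp g hg n w ∈ P) hw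
      (fun m x hx => ?_) (by simp) fun x y hx hy => by rw [map_add]; exact add_mem hx hy
    by_cases hmn : m = n
    · subst hmn
      rw [gradedComp_of_mem hg hx.2]
      exact hx.1
    · rw [gradedComp_of_mem_ne hg hmn hx.2]
      exact zero_mem _
  · intro h
    refine le_antisymm (fun w hw => mem_of_gradedComp_mem hg fun n => ?_)
      (iSup_le fun n => inf_le_left)
    exact Submodule.mem_iSup_of_mem n ⟨h w hw n, gradedComp_mem hg n w⟩

/-- The diagonal operator acting on the degree `n` piece as multiplication by `c n`. -/
theorem exists_diagonal (c : ℤ → ℂ) {E : Type} [AddCommGroup E] [Module ℂ E]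
    {g : ℤ → Submodule ℂ E} (hg : Function.Bijective (DirectSum.coeLinearMap g)) :
    ∃ D : Module.End ℂ E, ∀ n, ∀ w ∈ g n, D w = c n • w := by
  classical
  refine ⟨DirectSum.toModule ℂ ℤ E (fun n => c n • (g n).subtype) ∘ₗ
    (LinearEquiv.ofBijective (DirectSum.coeLinearMap g) hg).symm.toLinearMap, fun n w hw => ?_⟩
  have : (LinearEquiv.ofBijective (DirectSum.coeLinearMap g) hg).symm w
      = DirectSum.lof ℂ ℤ (fun n => g n) n ⟨w, hw⟩ := by
    rw [LinearEquiv.symm_apply_eq]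
    exact (DirectSum.coeLinearMap_of g n ⟨w, hw⟩).symm
  simp [this]

end Graded

section Homs

variable {d : VOA V} {M₁ M₂ M₃ : Type} [AddCommGroup M₁] [Module ℂ M₁]
  [AddCommGroup M₂] [Module ℂ M₂] [AddCommGroup M₃] [Module ℂ M₃]

/-- A degree-preserving homomorphism of admissible modules. -/
structure IsAdmHom (A₁ : AdmMod d M₁) (A₂ : AdmMod d M₂) (φ : M₁ →ₗ[ℂ] M₂) : Prop where
  map_act : ∀ (u : V) (n : ℤ) (w : M₁), φ (A₁.act u n w) = A₂.act u n (φ w)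
  map_gr : ∀ n : ℤ, ∀ w ∈ A₁.gr n, φ w ∈ A₂.gr n

theorem AdmMod.isGraded_iff (A : AdmMod d M₁) {P : Submodule ℂ M₁} :
    A.IsGraded P ↔ ∀ w ∈ P, ∀ n, gradedComp A.gr A.gr_internal n w ∈ P :=
  eq_iSup_inf_iff_gradedComp_mem A.gr_internal

theorem AdmMod.isGraded_span (A : AdmMod d M₁) {s : Set M₁} (hs : ∀ w ∈ s, ∃ n, w ∈ A.gr n) :
    A.IsGraded (Submodule.span ℂ s) := by
  refine le_antisymm (Submodule.span_le.2 fun w hw => ?_) (iSup_le fun n => inf_le_left)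
  obtain ⟨n, hn⟩ := hs w hw
  exact Submodule.mem_iSup_of_mem n ⟨Submodule.subset_span hw, hn⟩

namespace IsAdmHom

variable {A₁ : AdmMod d M₁} {A₂ : AdmMod d M₂} {φ : M₁ →ₗ[ℂ] M₂}

theorem map_gradedComp (h : IsAdmHom A₁ A₂ φ) (n : ℤ) (w : M₁) :
    φ (gradedComp A₁.gr A₁.gr_internal n w) = gradedComp A₂.gr A₂.gr_internal n (φ w) := by
  refine graded_induction A₁.gr_internal (p := fun w => φ (gradedComp A₁.gr A₁.gr_internal n w)
    = gradedComp A₂.gr A₂.gr_internal n (φ w)) (fun m x hx => ?_)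
    (fun x y hx hy => by simp only [map_add, hx, hy]) w
  by_cases hmn : m = n
  · subst hmn
    rw [gradedComp_of_mem _ hx, gradedComp_of_mem _ (h.map_gr _ _ hx)]
  · rw [gradedComp_of_mem_ne _ hmn hx, gradedComp_of_mem_ne _ hmn (h.map_gr _ _ hx), map_zero]

/-- The lemma of Schur: a homomorphism to an irreducible module vanishes on a given irreducible
submodule or maps it isomorphically onto the target. -/
theorem eq_zero_or_bijective (h : IsAdmHom A₁ A₂ φ) (h₂ : A₂.IsIrreducible)
    {S : Submodule ℂ M₁} (hS : A₁.IrredSub S) :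
    (∀ w ∈ S, φ w = 0) ∨ Function.Bijective (φ ∘ₗ S.subtype) := by
  obtain ⟨-, hst, hgr, hirr⟩ := hS
  rw [AdmMod.isGraded_iff] at hgr
  have hker := hirr (S ⊓ LinearMap.ker φ) inf_le_left
    (fun u n w hw => ⟨hst u n w hw.1, by
      show φ _ = 0
      rw [h.map_act, LinearMap.mem_ker.1 hw.2, map_zero]⟩)
    ((AdmMod.isGraded_iff A₁).2 fun w hw n => ⟨hgr w hw.1 n, by
      show φ _ = 0
      rw [h.map_gradedComp, LinearMap.mem_ker.1 hw.2, map_zero]⟩)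
  rcases hker with hker | hker
  · have hran := h₂.2 (S.map φ)
      (by
        rintro u n _ ⟨w, hw, rfl⟩
        exact ⟨_, hst u n w hw, h.map_act u n w⟩)
      ((AdmMod.isGraded_iff A₂).2 (by
        rintro _ ⟨w, hw, rfl⟩ n
        exact ⟨_, hgr w hw n, h.map_gradedComp n w⟩))
    rcases hran with hran | hran
    · exact Or.inl fun w hw => (Submodule.mem_bot ℂ).1 (hran ▸ Submodule.mem_map_of_mem hw)
    · refine Or.inr ⟨?_, ?_⟩
      · rw [← LinearMap.ker_eq_bot, LinearMap.ker_eq_bot']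
        intro w hw
        have : (w : M₁) ∈ S ⊓ LinearMap.ker φ := ⟨w.2, hw⟩
        rw [hker] at this
        exact Subtype.ext this
      · rw [← LinearMap.range_eq_top, LinearMap.range_comp, Submodule.range_subtype, hran]
  · exact Or.inl fun w hw => (hker.ge hw).2

end IsAdmHom

theorem AdmMod.IsIrreducible.irredSub_top {A : AdmMod d M₁} (h : A.IsIrreducible) :
    A.IrredSub ⊤ := by
  obtain ⟨⟨w, hw⟩, h⟩ := h
  refine ⟨fun e => hw ((Submodule.mem_bot ℂ).1 (e ▸ Submodule.mem_top)),
    fun _ _ _ _ => trivial, (AdmMod.isGraded_iff A).2 fun _ _ _ => trivial,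
    fun Q _ => h Q⟩

end Homs

section Countable

theorem VOA.exists_countable_homogeneous (d : VOA V) :
    ∃ B : Set V, B.Countable ∧ Submodule.span ℂ B = ⊤ ∧ ∀ b ∈ B, ∃ r, b ∈ d.grading r := by
  have h : ∀ n, ∃ s : Finset V, Submodule.span ℂ (s : Set V) = d.grading n := fun n =>
    Module.Finite.iff_fg.1 (d.fin_dim n)
  choose s hs using h
  refine ⟨⋃ n, (s n : Set V), Set.countable_iUnion fun n => (s n).countable_toSet, ?_, ?_⟩
  · rw [Submodule.span_iUnion]
    simp only [hs]
    exact iSup_eq_top_of_bijective d.internal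
  · intro b hb
    obtain ⟨n, hn⟩ := Set.mem_iUnion.1 hb
    exact ⟨n, hs n ▸ Submodule.subset_span hn⟩

variable {d : VOA V}

theorem WeakMod.act_mem_of_mem_span (W : WeakMod d M) {B : Set V} {P : Submodule ℂ M}
    {n : ℤ} {w : M} (h : ∀ b ∈ B, W.act b n w ∈ P) {u : V} (hu : u ∈ Submodule.span ℂ B) :
    W.act u n w ∈ P := by
  induction hu using Submodule.span_induction with
  | mem x hx => exact h x hx
  | zero =>
    have := W.act_smul 0 0 n
    rw [zero_smul, zero_smul] at this
    rw [this]
    exact zero_mem _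
  | add x y _ _ hx hy => rw [W.act_add]; exact add_mem hx hy
  | smul c x _ hx => rw [W.act_smul]; exact P.smul_mem c hx

theorem AdmMod.IsIrreducible.rank_le_aleph0 {A : AdmMod d M} (h : A.IsIrreducible) :
    Module.rank ℂ M ≤ Cardinal.aleph0 := by
  obtain ⟨B, hBc, hBs, hBh⟩ := d.exists_countable_homogeneous
  obtain ⟨⟨w₀, hw₀⟩, hirr⟩ := h
  obtain ⟨n, hn⟩ : ∃ n, gradedComp A.gr A.gr_internal n w₀ ≠ 0 := by
    by_contra! hc
    exact hw₀ (eq_zero_of_gradedComp_eq_zero _ hc)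
  set w := gradedComp A.gr A.gr_internal n w₀
  have hw : w ∈ A.gr n := gradedComp_mem _ _ _
  let word : List (B × ℤ) → M := List.foldr (fun b x => A.act b.1 b.2 x) w
  have hword : ∀ l, ∃ k, word l ∈ A.gr k := by
    intro l
    induction l with
    | nil => exact ⟨n, hw⟩
    | cons b l ih =>
      obtain ⟨k, hk⟩ := ih
      obtain ⟨r, hr⟩ := hBh b.1 b.1.2
      exact ⟨_, A.gr_act r _ hr b.2 k _ hk⟩
  have htop : Submodule.span ℂ (Set.range word) = ⊤ := by
    refine (hirr _ ?_ (A.isGraded_span (by rintro _ ⟨l, rfl⟩; exact hword l))).resolve_left ?_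
    · intro u m x hx
      refine Submodule.span_le (p := (Submodule.span ℂ (Set.range word)).comap (A.act u m)).2 ?_ hx
      rintro _ ⟨l, rfl⟩
      show A.act u m (word l) ∈ Submodule.span ℂ (Set.range word)
      refine A.act_mem_of_mem_span (B := B) (fun b hb => ?_) (hBs ▸ Submodule.mem_top)
      exact Submodule.subset_span ⟨(⟨b, hb⟩, m) :: l, rfl⟩
    · intro e
      have : w ∈ Submodule.span ℂ (Set.range word) := Submodule.subset_span ⟨[], rfl⟩
      rw [e] at this
      exact hn this
  have := hBc.to_subtype
  rw [← rank_top, ← htop]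
  exact (rank_span_le _).trans (Set.countable_range word).le_aleph0

end Countable

/-- The lemma of Dixmier: an operator on a nonzero complex space of countable dimension cannot have
all its translates by scalars invertible. -/
theorem exists_not_bijective_sub_smul [Nontrivial M] (hM : Module.rank ℂ M ≤ Cardinal.aleph0)
    (φ : Module.End ℂ M) : ∃ c : ℂ, ¬ Function.Bijective (φ - algebraMap ℂ (Module.End ℂ M) c) := by
  by_contra! hb
  have hinj : ∀ p : Polynomial ℂ, p ≠ 0 → Function.Injective (Polynomial.aeval φ p) := by
    intro p hp
    rw [(IsAlgClosed.splits p).eq_prod_roots, map_mul, Polynomial.aeval_C]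
    have hprod : ∀ s : Multiset ℂ, Function.Injective
        (Polynomial.aeval φ (s.map fun a => Polynomial.X - Polynomial.C a).prod) := by
      intro s
      induction s using Multiset.induction with
      | empty => simp [Function.Injective]
      | cons a s ih =>
        rw [Multiset.map_cons, Multiset.prod_cons, map_mul, Module.End.mul_eq_comp,
          LinearMap.coe_comp]
        refine Function.Injective.comp ?_ ih
        simpa using (hb a).1
    rw [Module.End.mul_eq_comp, LinearMap.coe_comp]
    refine Function.Injective.comp ?_ (hprod _)
    exact smul_right_injective M (Polynomial.leadingCoeff_ne_zero.2 hp)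
  obtain ⟨w, hw⟩ := exists_ne (0 : M)
  choose v hv using fun c => (hb c).2 w
  have hli : LinearIndependent ℂ v := by
    classical
    rw [linearIndependent_iff']
    intro s a hs c hc
    let q : ℂ → Polynomial ℂ := fun b => ∏ x ∈ s.erase b, (Polynomial.X - Polynomial.C x)
    let p : Polynomial ℂ := ∑ b ∈ s, Polynomial.C (a b) * q b
    have hq : ∀ b ∈ s, Polynomial.aeval φ (∏ x ∈ s, (Polynomial.X - Polynomial.C x)) (v b)
        = Polynomial.aeval φ (q b) w := by
      intro b hb'
      rw [← Finset.prod_erase_mul s _ hb', map_mul, Module.End.mul_apply, ← hv b]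
      simp [q]
    have hpw : Polynomial.aeval φ p w = 0 := by
      have := congrArg (Polynomial.aeval φ (∏ x ∈ s, (Polynomial.X - Polynomial.C x))) hs
      rw [map_sum, map_zero] at this
      rw [← this, map_sum, LinearMap.sum_apply]
      refine Finset.sum_congr rfl fun b hb' => ?_
      rw [map_smul, hq b hb', map_mul, Polynomial.aeval_C, Module.End.mul_apply,
        Module.algebraMap_end_apply]
    have hp : p = 0 := by
      by_contra hp
      exact hw (hinj p hp (by rw [hpw, map_zero]))
    have he : p.eval c = a c * (q c).eval c := by
      rw [Polynomial.eval_finsetSum, Finset.sum_eq_single_of_mem c hc]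
      · simp
      · intro b _ hbc
        simp only [Polynomial.eval_mul, q, Polynomial.eval_prod]
        rw [Finset.prod_eq_zero (Finset.mem_erase.2 ⟨hbc.symm, hc⟩) (by simp), mul_zero]
    rw [hp, Polynomial.eval_zero] at he
    refine (mul_eq_zero.1 he.symm).resolve_right ?_
    simp only [q, Polynomial.eval_prod]
    refine Finset.prod_ne_zero_iff.2 fun x hx => ?_
    simpa [sub_eq_zero] using (Finset.ne_of_mem_erase hx).symm
  have h1 := hli.cardinal_le_rank.trans hM
  rw [Cardinal.mk_complex] at h1
  exact absurd h1 (not_le.2 Cardinal.aleph0_lt_continuum)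

/-- Every degree-preserving endomorphism of an irreducible module is a scalar. -/
theorem IsAdmHom.exists_eq_smul {d : VOA V} {A : AdmMod d M} {φ : Module.End ℂ M}
    (h : IsAdmHom A A φ) (hA : A.IsIrreducible) : ∃ c : ℂ, ∀ w, φ w = c • w := by
  obtain ⟨w₀, hw₀⟩ := hA.1
  have : Nontrivial M := ⟨w₀, 0, hw₀⟩
  obtain ⟨c, hc⟩ := exists_not_bijective_sub_smul hA.rank_le_aleph0 φ
  have hφ : IsAdmHom A A (φ - algebraMap ℂ (Module.End ℂ M) c) :=
    ⟨fun u n w => by simp [h.map_act],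
      fun n w hw => sub_mem (h.map_gr n w hw) ((A.gr n).smul_mem c hw)⟩
  refine ⟨c, fun w => ?_⟩
  rcases hφ.eq_zero_or_bijective hA hA.irredSub_top with h0 | hb
  · simpa [sub_eq_zero] using h0 w trivial
  · refine absurd ⟨fun x y hxy => ?_, fun y => ?_⟩ hc
    · exact congrArg Subtype.val (@hb.1 ⟨x, trivial⟩ ⟨y, trivial⟩ hxy)
    · obtain ⟨x, hx⟩ := hb.2 y
      exact ⟨x, hx⟩

theorem WeakMod.act_zero {d : VOA V} (W : WeakMod d M) (n : ℤ) : W.act 0 n = 0 := by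
  simpa using W.act_smul 0 0 n

section Product

variable {d : VOA V} {I : Type} {F : I → Type} [∀ i, AddCommGroup (F i)] [∀ i, Module ℂ (F i)]
  (A : ∀ i, AdmMod d (F i))

/-- The degree `n` piece of the graded product of a family of admissible modules. -/
def prodGr (n : ℤ) : Submodule ℂ (∀ i, F i) :=
  Submodule.pi Set.univ fun i => (A i).gr n

theorem mem_prodGr {n : ℤ} {f : ∀ i, F i} : f ∈ prodGr A n ↔ ∀ i, f i ∈ (A i).gr n := by
  simp [prodGr, Submodule.mem_pi]

/-- The graded product of a family of admissible modules, as a subspace of the full product. -/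
def gradedProd : Submodule ℂ (∀ i, F i) := ⨆ n, prodGr A n

/-- The componentwise action on the full product. -/
def piAct (u : V) (m : ℤ) : Module.End ℂ (∀ i, F i) :=
  LinearMap.pi fun i => (A i).act u m ∘ₗ LinearMap.proj i

theorem piAct_mem_prodGr {r n m : ℤ} {u : V} (hu : u ∈ d.grading r) {f : ∀ i, F i}
    (hf : f ∈ prodGr A n) : piAct A u m f ∈ prodGr A (r + n - m - 1) :=
  (mem_prodGr A).2 fun i => (A i).gr_act r u hu m n _ ((mem_prodGr A).1 hf i)

theorem piAct_add (u v : V) (m : ℤ) : piAct A (u + v) m = piAct A u m + piAct A v m := by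
  ext1 f; funext i; simp [piAct, (A i).act_add]

theorem piAct_mem_gradedProd (u : V) (m : ℤ) {f : ∀ i, F i} (hf : f ∈ gradedProd A) :
    piAct A u m f ∈ gradedProd A := by
  refine graded_induction d.internal (p := fun u => piAct A u m f ∈ gradedProd A)
    (fun r u hu => ?_) (fun x y hx hy => ?_) u
  · refine Submodule.iSup_induction _ (motive := fun f => piAct A u m f ∈ gradedProd A) hf
      (fun n x hx => Submodule.mem_iSup_of_mem _ (piAct_mem_prodGr A hu hx)) (by simp)
      fun x y hx hy => by rw [map_add]; exact add_mem hx hy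
  · rw [piAct_add]
    exact add_mem hx hy

theorem exists_piAct_eq_zero (u : V) {f : ∀ i, F i} (hf : f ∈ gradedProd A) :
    ∃ N : ℤ, ∀ n : ℤ, N ≤ n → piAct A u n f = 0 := by
  refine graded_induction d.internal
    (p := fun u => ∃ N : ℤ, ∀ n : ℤ, N ≤ n → piAct A u n f = 0)
    (fun r u hu => ?_) (fun x y ⟨N, hN⟩ ⟨N', hN'⟩ => ⟨max N N', fun n hn => ?_⟩) u
  · refine Submodule.iSup_induction _
      (motive := fun f => ∃ N : ℤ, ∀ n : ℤ, N ≤ n → piAct A u n f = 0) hf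
      (fun n x hx => ⟨r + n, fun m hm => ?_⟩) ⟨0, by simp⟩
      fun x y ⟨N, hN⟩ ⟨N', hN'⟩ => ⟨max N N', fun n hn => ?_⟩
    · funext i
      have := (mem_prodGr A).1 (piAct_mem_prodGr A (m := m) hu hx) i
      rw [(A i).gr_neg _ (by omega)] at this
      exact (Submodule.mem_bot ℂ).1 this
    · rw [map_add, hN n (le_trans (le_max_left _ _) hn), hN' n (le_trans (le_max_right _ _) hn),
        add_zero]
  · rw [piAct_add, LinearMap.add_apply, hN n (le_trans (le_max_left _ _) hn),
      hN' n (le_trans (le_max_right _ _) hn), add_zero]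

theorem finite_support_of_eventually_eq_zero {E : Type} [Zero E] {f : ℕ → E} {N : ℕ}
    (h : ∀ i, N ≤ i → f i = 0) : f.HasFiniteSupport :=
  (Set.finite_lt_nat N).subset fun i hi => by
    by_contra hc
    exact hi (h i (not_lt.1 hc))

theorem prodGr_bijective : Function.Bijective
    (DirectSum.coeLinearMap fun n => (prodGr A n).comap (gradedProd A).subtype) := by
  refine (DirectSum.isInternal_submodule_iff_iSupIndep_and_iSup_eq_top _).2 ⟨?_, ?_⟩
  · rw [iSupIndep_iff_finsetSum_eq_zero_imp_eq_zero]
    intro s v hv hs n hn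
    refine Subtype.ext (funext fun i => ?_)
    have hi := ((DirectSum.isInternal_submodule_iff_iSupIndep_and_iSup_eq_top _).1
      (A i).gr_internal).1
    rw [iSupIndep_iff_finsetSum_eq_zero_imp_eq_zero] at hi
    refine hi s (fun n => (v n : ∀ i, F i) i) (fun k hk => (mem_prodGr A).1 (hv k hk) i) ?_ n hn
    simpa using congrFun (congrArg Subtype.val hs) i
  · apply Submodule.map_injective_of_injective (gradedProd A).subtype_injective
    rw [Submodule.map_iSup, Submodule.map_top, Submodule.range_subtype]
    refine iSup_congr fun n => ?_
    rw [Submodule.map_comap_subtype]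
    exact inf_eq_right.2 (le_iSup (prodGr A) n)

/-- The graded product of a family of admissible modules is an admissible module. -/
noncomputable def prodMod : AdmMod d (gradedProd A) where
  act u m := (piAct A u m).restrict fun _ hf => piAct_mem_gradedProd A u m hf
  act_add u v n := by
    ext1 f
    exact Subtype.ext (by simp [piAct_add])
  act_smul c u n := by
    ext1 f
    exact Subtype.ext (funext fun i => by simp [piAct, (A i).act_smul])
  truncation u f := by
    obtain ⟨N, hN⟩ := exists_piAct_eq_zero A u f.2
    exact ⟨N, fun n hn => Subtype.ext (hN n hn)⟩
  vacuum_act f n := by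
    refine Subtype.ext (funext fun i => ?_)
    have := (A i).vacuum_act (f.1 i) n
    split_ifs at this ⊢ <;> simpa [piAct] using this
  borcherds p q r u v f := by
    let ev (i : I) : gradedProd A →+ F i :=
      (LinearMap.proj i ∘ₗ (gradedProd A).subtype).toAddMonoidHom
    refine Subtype.ext (funext fun i => ?_)
    have hb := (A i).borcherds p q r u v (f.1 i)
    obtain ⟨N₁, h₁⟩ := d.truncation u v
    obtain ⟨N₂, h₂⟩ := exists_piAct_eq_zero A u f.2
    obtain ⟨N₃, h₃⟩ := exists_piAct_eq_zero A v f.2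
    refine ((ev i).map_finsum (finite_support_of_eventually_eq_zero (N := (N₁ - r).toNat)
      fun k hk => ?_)).trans (Eq.trans ?_ ((ev i).map_finsum
      (finite_support_of_eventually_eq_zero (N := (max (N₂ - p) (N₃ - q)).toNat)
      fun k hk => ?_)).symm)
    · rw [h₁ _ (by omega)]
      refine Subtype.ext (funext fun j => ?_)
      simp [piAct, (A j).act_zero]
    · simpa [ev, piAct] using hb
    · have e₂ := h₂ (p + k) (by omega)
      have e₃ := h₃ (q + k) (by omega)
      refine Subtype.ext ?_
      simp [e₂, e₃]
  gr n := (prodGr A n).comap (gradedProd A).subtype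
  gr_internal := prodGr_bijective A
  gr_neg n hn := by
    refine (Submodule.eq_bot_iff _).2 fun f hf => Subtype.ext (funext fun i => ?_)
    have := (mem_prodGr A).1 hf i
    rw [(A i).gr_neg n hn] at this
    exact (Submodule.mem_bot ℂ).1 this
  gr_act r u hu m n f hf := piAct_mem_prodGr A hu hf

/-- The projection of the graded product to a factor. -/
def prodCoord (i : I) : gradedProd A →ₗ[ℂ] F i :=
  LinearMap.proj i ∘ₗ (gradedProd A).subtype

theorem isAdmHom_prodCoord (i : I) : IsAdmHom (prodMod A) (A i) (prodCoord A i) :=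
  ⟨fun _ _ _ => rfl, fun _ _ hf => (mem_prodGr A).1 hf i⟩

/-- Over a rational vertex operator algebra, a homogeneous family of vectors in a family of
admissible modules has only finitely many nonzero components under a decomposition of the graded
product into irreducibles. -/
theorem Rational.exists_decomposition (h : Rational d) {n : ℤ} (x : ∀ i, F i)
    (hx : ∀ i, x i ∈ (A i).gr n) :
    ∃ (J : Type) (_ : Fintype J) (S : J → Submodule ℂ (gradedProd A)) (y : J → gradedProd A),
      (∀ j, (prodMod A).IrredSub (S j)) ∧ (∀ j, y j ∈ S j) ∧
      ∀ i, x i = ∑ j, prodCoord A i (y j) := by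
  classical
  obtain ⟨ι, f, hf, -, htop⟩ := h _ (prodMod A)
  let X : gradedProd A := ⟨x, Submodule.mem_iSup_of_mem n ((mem_prodGr A).2 hx)⟩
  have hX : X ∈ ⨆ i, f i := htop ▸ Submodule.mem_top
  obtain ⟨y, hy, hsum⟩ := (Submodule.mem_iSup_iff_exists_finsupp f X).1 hX
  refine ⟨y.support, inferInstance, fun j => f j, fun j => y j, fun j => hf j, fun j => hy j,
    fun i => ?_⟩
  have : x i = prodCoord A i X := rfl
  rw [this, ← hsum, Finsupp.sum, map_sum, ← Finset.sum_coe_sort]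

end Product

section Consequences

variable {d : VOA V}

/-- Homomorphisms from an irreducible submodule to an irreducible module take a given vector to
a fixed line. -/
theorem IsAdmHom.exists_mem_span_singleton {N : Type} [AddCommGroup N] [Module ℂ N]
    {B : AdmMod d N} {A : AdmMod d M} (hA : A.IsIrreducible) {S : Submodule ℂ N}
    (hS : B.IrredSub S) {I : Type} {φ : I → N →ₗ[ℂ] M} (hφ : ∀ i, IsAdmHom B A (φ i))
    {y : N} (hy : y ∈ S) : ∃ z : M, ∀ i, φ i y ∈ Submodule.span ℂ {z} := by
  by_cases hc : ∀ i, φ i y = 0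
  · exact ⟨0, fun i => by simp [hc i]⟩
  obtain ⟨k, hk⟩ := not_forall.1 hc
  have hbij := ((hφ k).eq_zero_or_bijective hA hS).resolve_left fun h0 => hk (h0 y hy)
  let e : S ≃ₗ[ℂ] M := LinearEquiv.ofBijective (φ k ∘ₗ S.subtype) hbij
  have he : ∀ w, φ k (e.symm w) = w := e.apply_symm_apply
  have hinj : ∀ a ∈ S, ∀ b ∈ S, φ k a = φ k b → a = b := fun a ha b hb hab =>
    congrArg Subtype.val (@hbij.1 ⟨a, ha⟩ ⟨b, hb⟩ hab)
  refine ⟨φ k y, fun i => ?_⟩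
  have hend : IsAdmHom A A (φ i ∘ₗ S.subtype ∘ₗ e.symm.toLinearMap) := by
    refine ⟨fun u n w => ?_, fun n w hw => ?_⟩
    · have : (e.symm (A.act u n w) : N) = B.act u n (e.symm w) :=
        hinj _ (e.symm _).2 _ (hS.2.1 u n _ (e.symm w).2) (by rw [(hφ k).map_act, he, he])
      change φ i (e.symm (A.act u n w)) = A.act u n (φ i (e.symm w))
      rw [this, (hφ i).map_act]
    · have : gradedComp B.gr B.gr_internal n (e.symm w) = (e.symm w : N) :=
        hinj _ (B.isGraded_iff.1 hS.2.2.1 _ (e.symm w).2 n) _ (e.symm w).2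
          (by rw [(hφ k).map_gradedComp, he, gradedComp_of_mem _ hw])
      refine (hφ i).map_gr n (e.symm w) ?_
      rw [← this]
      exact gradedComp_mem _ _ _
  obtain ⟨c, hc⟩ := hend.exists_eq_smul hA
  have hsy : (e.symm (φ k y) : N) = y := hinj _ (e.symm _).2 _ hy (he _)
  refine Submodule.mem_span_singleton.2 ⟨c, ?_⟩
  rw [← hc (φ k y)]
  exact congrArg (φ i) hsy

theorem AdmMod.IsIrreducible.finiteDimensional_gr (h : Rational d) {A : AdmMod d M}
    (hA : A.IsIrreducible) (n : ℤ) : FiniteDimensional ℂ (A.gr n) := by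
  obtain ⟨J, _, S, y, hS, hy, hsum⟩ :=
    h.exists_decomposition (fun _ : A.gr n => A) (fun i => (i : M)) fun i => i.2
  choose z hz using fun j =>
    IsAdmHom.exists_mem_span_singleton hA (hS j) (isAdmHom_prodCoord fun _ : A.gr n => A) (hy j)
  have hle : A.gr n ≤ Submodule.span ℂ (Set.range z) := fun w hw => by
    have hw' : w = ∑ j, prodCoord (fun _ : A.gr n => A) ⟨w, hw⟩ (y j) := hsum ⟨w, hw⟩
    rw [hw']
    exact Submodule.sum_mem _ fun j _ =>
      Submodule.span_mono (Set.singleton_subset_iff.2 (Set.mem_range_self j)) (hz j ⟨w, hw⟩)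
  have := FiniteDimensional.span_of_finite ℂ (Set.finite_range z)
  exact Submodule.finiteDimensional_of_le hle

theorem cbinom_eq_zero {n k : ℕ} (h : n < k) : cbinom n k = 0 := by
  rw [cbinom, Finset.prod_eq_zero (Finset.mem_range.2 h) (by simp), zero_div]

/-- The `L(-1)`-derivative property holds on every weak module. -/
theorem WeakMod.act_Lneg1 (W : WeakMod d M) (u : V) (n : ℤ) (w : M) :
    W.act (d.mode d.conformal 0 u) n w = (-n : ℂ) • W.act u (n - 1) w := by
  have hu : d.mode d.conformal 0 u = d.mode u (-2) d.vacuum := by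
    have := d.Lneg1_deriv u (-1)
    rw [← d.creation_neg_one (d.mode d.conformal 0 u), this]
    norm_num
  have hb := W.borcherds n 0 (-2) u d.vacuum w
  rw [finsum_eq_sum_of_support_subset (s := Finset.range 2),
    finsum_eq_zero_of_forall_eq_zero] at hb
  · simp [Finset.sum_range_succ, cbinom, d.creation_neg_one] at hb
    rw [hu, eq_neg_of_add_eq_zero_left hb, neg_smul]
  · intro i
    rw [W.vacuum_act, W.vacuum_act, if_neg (by omega), if_neg (by omega)]
    simp
  · refine Function.support_subset_iff'.2 fun i hi => ?_
    have : 1 < i := by simpa using hi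
    rw [d.creation _ _ (by omega), W.act_zero]
    simp

/-- The commutator of `L(0)` with a mode of a homogeneous vector. -/
theorem WeakMod.L0_act (W : WeakMod d M) {r : ℤ} {u : V} (hu : u ∈ d.grading r) (m : ℤ) (w : M) :
    W.act d.conformal 1 (W.act u m w) =
      W.act u m (W.act d.conformal 1 w) + ((r - m - 1 : ℤ) : ℂ) • W.act u m w := by
  have hb := W.borcherds 1 m 0 d.conformal u w
  rw [finsum_eq_sum_of_support_subset (s := Finset.range 2),
    finsum_eq_sum_of_support_subset (s := Finset.range 1)] at hb
  · simp [Finset.sum_range_succ, cbinom, W.act_Lneg1, d.L0_eigen r u hu, W.act_smul] at hb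
    rw [eq_comm, sub_eq_iff_eq_add] at hb
    rw [hb]
    push_cast
    module
  · refine Function.support_subset_iff'.2 fun i hi => ?_
    have hi' : 0 < i := by
      simp at hi
      omega
    have : cbinom 0 i = 0 := by exact_mod_cast cbinom_eq_zero hi'
    simp [this]
  · refine Function.support_subset_iff'.2 fun i hi => ?_
    have hi' : 1 < i := by simpa using hi
    have : cbinom 1 i = 0 := by exact_mod_cast cbinom_eq_zero hi'
    simp [this]

/-- On an irreducible module `L(0)` acts on the degree `n` piece as a scalar `c + n`. -/
theorem AdmMod.IsIrreducible.exists_L0_eq {A : AdmMod d M} (hA : A.IsIrreducible) :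
    ∃ c : ℂ, ∀ n, ∀ w ∈ A.gr n, A.act d.conformal 1 w = (c + n) • w := by
  obtain ⟨D, hD⟩ := exists_diagonal (fun n : ℤ => (n : ℂ)) A.gr_internal
  have hE : IsAdmHom A A (A.act d.conformal 1 - D) := by
    refine ⟨fun u m w => ?_, fun n w hw => ?_⟩
    · refine graded_induction d.internal
        (p := fun u => (A.act d.conformal 1 - D) (A.act u m w)
          = A.act u m ((A.act d.conformal 1 - D) w))
        (fun r u hu => ?_) (fun x y hx hy => ?_) u
      · refine graded_induction A.gr_internal
          (p := fun w => (A.act d.conformal 1 - D) (A.act u m w)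
            = A.act u m ((A.act d.conformal 1 - D) w))
          (fun n w hw => ?_) (fun x y hx hy => by simp only [map_add, hx, hy]) w
        rw [LinearMap.sub_apply, LinearMap.sub_apply, hD n w hw, A.L0_act hu,
          hD _ _ (A.gr_act r u hu m n w hw), map_sub, map_smul]
        push_cast
        module
      · simp only [A.act_add, LinearMap.add_apply, map_add, hx, hy]
    · rw [LinearMap.sub_apply, hD n w hw]
      refine sub_mem ?_ ((A.gr n).smul_mem _ hw)
      have := A.gr_act 2 _ d.conformal_mem 1 n w hw
      rwa [show 2 + n - 1 - 1 = n by ring] at this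
  obtain ⟨c, hc⟩ := hE.exists_eq_smul hA
  refine ⟨c, fun n w hw => ?_⟩
  rw [add_smul, ← hc w, LinearMap.sub_apply, hD n w hw, sub_add_cancel]

theorem AdmMod.IsIrreducible.isOrdinary (h : Rational d) {A : AdmMod d M}
    (hA : A.IsIrreducible) : A.IsOrdinary := by
  obtain ⟨c, hc⟩ := hA.exists_L0_eq
  have hcomp : ∀ n w, A.act d.conformal 1 (gradedComp A.gr A.gr_internal n w)
      = gradedComp A.gr A.gr_internal n (A.act d.conformal 1 w) := fun n w => by
    refine graded_induction A.gr_internal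
      (p := fun w => A.act d.conformal 1 (gradedComp A.gr A.gr_internal n w)
        = gradedComp A.gr A.gr_internal n (A.act d.conformal 1 w))
      (fun m w hw => ?_) (fun x y hx hy => by simp only [map_add, hx, hy]) w
    by_cases hmn : m = n
    · subst hmn
      rw [hc m w hw, map_smul, gradedComp_of_mem _ hw, hc m w hw]
    · rw [hc m w hw, map_smul, gradedComp_of_mem_ne _ hmn hw, map_zero, smul_zero]
  have hzero : ∀ lam w, w ∈ Module.End.eigenspace (A.act d.conformal 1) lam →
      ∀ n : ℤ, lam ≠ c + n → gradedComp A.gr A.gr_internal n w = 0 := by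
    intro lam w hw n hne
    have h1 := hc n _ (gradedComp_mem A.gr_internal n w)
    rw [hcomp, Module.End.mem_eigenspace_iff.1 hw, map_smul, ← sub_eq_zero, ← sub_smul] at h1
    exact (smul_eq_zero.1 h1).resolve_left (sub_ne_zero.2 hne)
  have hle : ∀ n : ℤ, Module.End.eigenspace (A.act d.conformal 1) (c + n) ≤ A.gr n := by
    intro n w hw
    refine mem_of_gradedComp_mem A.gr_internal fun m => ?_
    by_cases hmn : m = n
    · exact hmn ▸ gradedComp_mem _ _ _
    · rw [hzero _ w hw m (by simpa using Ne.symm hmn)]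
      exact zero_mem _
  have hbot : ∀ lam, (∀ n : ℤ, lam ≠ c + n) →
      Module.End.eigenspace (A.act d.conformal 1) lam = ⊥ := fun lam hlam =>
    (Submodule.eq_bot_iff _).2 fun w hw =>
      eq_zero_of_gradedComp_eq_zero A.gr_internal fun n => hzero lam w hw n (hlam n)
  refine ⟨⟨Module.End.eigenspace (A.act d.conformal 1), ?_,
    fun lam w hw => Module.End.mem_eigenspace_iff.1 hw, fun lam => ?_, fun lam => ?_⟩⟩
  · refine (DirectSum.isInternal_submodule_iff_iSupIndep_and_iSup_eq_top _).2
      ⟨Module.End.eigenspaces_iSupIndep _, top_le_iff.1 ?_⟩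
    rw [← iSup_eq_top_of_bijective A.gr_internal]
    exact iSup_le fun n w hw => Submodule.mem_iSup_of_mem (c + n)
      (Module.End.mem_eigenspace_iff.2 (hc n w hw))
  · by_cases hlam : ∃ n : ℤ, lam = c + n
    · obtain ⟨n, rfl⟩ := hlam
      have := hA.finiteDimensional_gr h n
      exact Submodule.finiteDimensional_of_le (hle n)
    · rw [hbot lam (not_exists.1 hlam)]
      infer_instance
  · by_cases hlam : ∃ n : ℤ, lam = c + n
    · obtain ⟨k, rfl⟩ := hlam
      refine ⟨-k, fun n hn => ?_⟩
      have := hle (k + n)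
      rw [A.gr_neg _ (by omega), Int.cast_add, ← add_assoc] at this
      exact le_bot_iff.1 this
    · refine ⟨0, fun n _ => hbot _ fun m hm => hlam ⟨m - n, ?_⟩⟩
      push_cast
      linear_combination hm

/-- The regrading of an admissible module by a shift of degrees. -/
def AdmMod.shift (A : AdmMod d M) (k : ℤ) (hk : ∀ n < k, A.gr n = ⊥) : AdmMod d M where
  toWeakMod := A.toWeakMod
  gr n := A.gr (n + k)
  gr_internal := by
    obtain ⟨hi, hs⟩ := (DirectSum.isInternal_submodule_iff_iSupIndep_and_iSup_eq_top A.gr).1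
      A.gr_internal
    exact (DirectSum.isInternal_submodule_iff_iSupIndep_and_iSup_eq_top _).2
      ⟨hi.comp (Equiv.addRight k).injective, ((Equiv.addRight k).iSup_comp (g := A.gr)).trans hs⟩
  gr_neg n hn := hk _ (by omega)
  gr_act r u hu m n w hw := by
    have := A.gr_act r u hu m (n + k) w hw
    rwa [show r + (n + k) - m - 1 = r + n - m - 1 + k by ring] at this

theorem AdmMod.IsIrreducible.exists_shift {A : AdmMod d M} (hA : A.IsIrreducible) :
    ∃ A' : AdmMod d M, A'.toWeakMod = A.toWeakMod ∧ A'.IsIrreducible ∧ A'.gr 0 ≠ ⊥ := by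
  classical
  obtain ⟨w, hw⟩ := hA.1
  have hex : ∃ n : ℕ, A.gr n ≠ ⊥ := by
    by_contra! hc
    refine hw (eq_zero_of_gradedComp_eq_zero A.gr_internal fun n => ?_)
    have hn : A.gr n = ⊥ := by
      rcases lt_or_ge n 0 with hn | hn
      · exact A.gr_neg n hn
      · exact Int.toNat_of_nonneg hn ▸ hc n.toNat
    exact (Submodule.mem_bot ℂ).1 (hn ▸ gradedComp_mem A.gr_internal n w)
  have hmin : ∀ n < (Nat.find hex : ℤ), A.gr n = ⊥ := fun n hn => by
    rcases lt_or_ge n 0 with h0 | h0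
    · exact A.gr_neg n h0
    · have := Nat.find_min hex (m := n.toNat) (by omega)
      rw [Int.toNat_of_nonneg h0] at this
      exact not_not.1 this
  refine ⟨A.shift _ hmin, rfl, ⟨hA.1, fun P hP hgr => hA.2 P hP ?_⟩, ?_⟩
  · exact hgr.trans ((Equiv.addRight (Nat.find hex : ℤ)).iSup_comp (g := fun n => P ⊓ A.gr n))
  · have := Nat.find_spec hex
    simpa [AdmMod.shift] using this

/-- An admissible module bundled with its underlying space. -/
structure BundledAdmMod (d : VOA V) where
  carrier : Type
  [instGroup : AddCommGroup carrier]
  [instModule : Module ℂ carrier]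
  adm : AdmMod d carrier

attribute [instance] BundledAdmMod.instGroup BundledAdmMod.instModule

theorem AdmEquiv.of_irredSub {N M₁ M₂ : Type} [AddCommGroup N] [Module ℂ N]
    [AddCommGroup M₁] [Module ℂ M₁] [AddCommGroup M₂] [Module ℂ M₂]
    {B : AdmMod d N} {A₁ : AdmMod d M₁} {A₂ : AdmMod d M₂} {S : Submodule ℂ N}
    (hS : B.IrredSub S) {φ₁ : N →ₗ[ℂ] M₁} {φ₂ : N →ₗ[ℂ] M₂}
    (h₁ : IsAdmHom B A₁ φ₁) (h₂ : IsAdmHom B A₂ φ₂)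
    (hb₁ : Function.Bijective (φ₁ ∘ₗ S.subtype)) (hb₂ : Function.Bijective (φ₂ ∘ₗ S.subtype)) :
    AdmEquiv A₁ A₂ := by
  refine ⟨(LinearEquiv.ofBijective _ hb₁).symm.trans (LinearEquiv.ofBijective _ hb₂),
    fun u n w => ?_⟩
  obtain ⟨s, rfl⟩ := (LinearEquiv.ofBijective _ hb₁).surjective w
  have : A₁.act u n (LinearEquiv.ofBijective _ hb₁ s)
      = LinearEquiv.ofBijective _ hb₁ ⟨B.act u n s, hS.2.1 u n s s.2⟩ :=
    (h₁.map_act u n s).symm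
  rw [this, LinearEquiv.trans_apply, LinearEquiv.trans_apply, LinearEquiv.symm_apply_apply,
    LinearEquiv.symm_apply_apply]
  exact h₂.map_act u n s

/-- In an infinite sequence of irreducible modules with nonzero bottom degree, two are
equivalent. -/
theorem Rational.exists_admEquiv (h : Rational d) (f : ℕ → BundledAdmMod d)
    (hf : ∀ i, (f i).adm.IsIrreducible ∧ (f i).adm.gr 0 ≠ ⊥) :
    ∃ i j, i < j ∧ AdmEquiv (f j).adm (f i).adm := by
  choose x hx hx0 using fun i => Submodule.exists_mem_ne_zero_of_ne_bot (hf i).2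
  obtain ⟨J, _, S, y, hS, hy, hsum⟩ := h.exists_decomposition (fun i => (f i).adm) x hx
  have hJ : ∀ i, ∃ j, prodCoord (fun i => (f i).adm) i (y j) ≠ 0 := fun i => by
    by_contra! hc
    exact hx0 i (by rw [hsum i, Finset.sum_eq_zero fun j _ => hc j])
  choose t ht using hJ
  have hbij := fun i => ((isAdmHom_prodCoord (fun i => (f i).adm) i).eq_zero_or_bijective
    (hf i).1 (hS (t i))).resolve_left fun h0 => ht i (h0 _ (hy (t i)))
  have key : ∀ i j, t i = t j → AdmEquiv (f i).adm (f j).adm := fun i j hij =>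
    AdmEquiv.of_irredSub (hS (t i)) (isAdmHom_prodCoord _ i) (isAdmHom_prodCoord _ j)
      (hbij i) (hij ▸ hbij j)
  obtain ⟨i, j, hne, hij⟩ := Finite.exists_ne_map_eq_of_infinite t
  rcases lt_or_gt_of_ne hne with hlt | hlt
  · exact ⟨i, j, hlt, key j i hij.symm⟩
  · exact ⟨j, i, hlt, key i j hij⟩

/-- Finitely many modules represent all irreducible admissible modules. -/
theorem Rational.exists_finset (h : Rational d) : ∃ s : Finset (BundledAdmMod d),
    ∀ (M : Type) [AddCommGroup M] [Module ℂ M] (A : AdmMod d M), A.IsIrreducible →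
      ∃ B ∈ s, AdmEquiv A B.adm := by
  by_contra! hc
  obtain ⟨f, hf, hne⟩ := exists_seq_of_forall_finset_exists
    (fun B : BundledAdmMod d => B.adm.IsIrreducible ∧ B.adm.gr 0 ≠ ⊥)
    (fun B₁ B₂ => ¬ AdmEquiv B₂.adm B₁.adm) fun s _ => by
      obtain ⟨M, _, _, A, hA, hs⟩ := hc s
      obtain ⟨A', hact, hirr, h0⟩ := hA.exists_shift
      refine ⟨⟨M, A'⟩, ⟨hirr, h0⟩, fun B hB he => hs B hB ?_⟩
      simpa only [AdmEquiv, hact] using he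
  obtain ⟨i, j, hij, he⟩ := h.exists_admEquiv f hf
  exact hne i j hij he

end Consequences

/-- if `V` is rational, there are only finitely many irreducible admissible
modules up to isomorphism, and every irreducible admissible module is ordinary. -/
theorem stmt8 (d : VOA V) (h : Rational d) :
    (∃ (k : ℕ) (Mt : Fin k → Type) (iA : ∀ i, AddCommGroup (Mt i)),
      letI := iA;
      ∃ (iM : ∀ i, Module ℂ (Mt i)),
        letI := iM;
        ∃ As : ∀ i, AdmMod d (Mt i),
          ∀ (M : Type) [AddCommGroup M] [Module ℂ M] (A : AdmMod d M),
            A.IsIrreducible → ∃ i, AdmEquiv A (As i)) ∧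
    (∀ (M : Type) [AddCommGroup M] [Module ℂ M] (A : AdmMod d M),
      A.IsIrreducible → A.IsOrdinary) := by
  obtain ⟨s, hs⟩ := h.exists_finset
  refine ⟨⟨s.card, fun i => (s.equivFin.symm i).1.carrier,
    fun i => (s.equivFin.symm i).1.instGroup, fun i => (s.equivFin.symm i).1.instModule,
    fun i => (s.equivFin.symm i).1.adm, fun M _ _ A hA => ?_⟩,
    fun M _ _ A hA => hA.isOrdinary h⟩
  obtain ⟨B, hB, he⟩ := hs M A hA
  refine ⟨s.equivFin ⟨B, hB⟩, ?_⟩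
  change AdmEquiv A (s.equivFin.symm (s.equivFin ⟨B, hB⟩)).1.adm
  rwa [Equiv.symm_apply_apply]
end
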